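/- Let (W,S) be a finite Coxeter system and λ a Coxeter class of (W,S). Then the λ-set C(λ) is a union of conjugacy classes of W: C(λ) is the disjoint union of all conjugacy classes C of W with C ⊆ C(λ). Moreover, W is the disjoint union of its λ-sets: every element of W is a λ-element for exactly one Coxeter class λ. -/

import Mathlib

open scoped Classical

variable {B : Type*} {W : Type*} [Group W] {M : CoxeterMatrix B}

/-- The parabolic subgroup `W_I` generated by the simple reflections indexed by `I`. -/
def parabolic (cs : CoxeterSystem M W) (I : Set B) : Subgroup W :=
  Subgroup.closure (cs.simple '' I)

/-- `X_I`: minimal length coset representatives of `W / W_I`. -/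
def minReps (cs : CoxeterSystem M W) (I : Set B) : Set W :=
  {w : W | ∀ i ∈ I, cs.length w < cs.length (w * cs.simple i)}

/-- `I ∼_W J`: the subsets of simple reflections are conjugate under `W`. -/
def ConjSubsets (cs : CoxeterSystem M W) (I J : Set B) : Prop :=
  ∃ w : W, (fun x => w * x * w⁻¹) '' (cs.simple '' I) = cs.simple '' J

theorem conjSubsets_equivalence (cs : CoxeterSystem M W) : Equivalence (ConjSubsets cs) where
  refl I := ⟨1, by simp⟩
  symm := by
    rintro I J ⟨w, h⟩
    refine ⟨w⁻¹, ?_⟩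
    rw [← h, Set.image_image]
    simp [mul_assoc]
  trans := by
    rintro I J K ⟨w, h⟩ ⟨v, h'⟩
    refine ⟨v * w, ?_⟩
    rw [← h', ← h]
    simp [Set.image_image, mul_assoc]

/-- The setoid of Coxeter classes. -/
def coxSetoid (cs : CoxeterSystem M W) : Setoid (Set B) :=
  ⟨ConjSubsets cs, conjSubsets_equivalence cs⟩

/-- The set of Coxeter classes `Λ(W)`. -/
def CoxeterClass (cs : CoxeterSystem M W) := Quotient (coxSetoid cs)

/-- `C` is a conjugacy class of the parabolic subgroup `W_I`. -/
def IsConjClassOfParabolic (cs : CoxeterSystem M W) (I : Set B) (C : Set W) : Prop :=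
  ∃ v ∈ parabolic cs I, C = {x : W | ∃ u ∈ parabolic cs I, u * v * u⁻¹ = x}

/-- `C` is an `I`-cuspidal class: a conjugacy class of `W_I` meeting no proper
parabolic subgroup of `W_I`. -/
def IsCuspidalClass (cs : CoxeterSystem M W) (I : Set B) (C : Set W) : Prop :=
  IsConjClassOfParabolic cs I C ∧ ∀ K : Set B, K ⊂ I → C ∩ (parabolic cs K : Set W) = ∅

/-- `w` is an `I`-element: `C(w) ∩ W_I` is an `I`-cuspidal class. -/
def IsElementOf (cs : CoxeterSystem M W) (I : Set B) (w : W) : Prop :=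
  IsCuspidalClass cs I ({x : W | IsConj w x} ∩ (parabolic cs I : Set W))

/-- The λ-set `C(λ)` of the Coxeter class of `I`: the set of `λ(I)`-elements. -/
def lambdaSet (cs : CoxeterSystem M W) (I : Set B) : Set W :=
  {w : W | ∃ J : Set B, ConjSubsets cs I J ∧ IsElementOf cs J w}

/-- The λ-set of a Coxeter class. -/
def lambdaSetQ (cs : CoxeterSystem M W) (lam : CoxeterClass cs) : Set W :=
  {w : W | ∃ I : Set B, Quotient.mk (coxSetoid cs) I = lam ∧ IsElementOf cs I w}

/-- The induced character `1_{W_I}^W` of the trivial character of `W_I`,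
as a `ℚ`-valued function on `W`. -/
noncomputable def indTriv (cs : CoxeterSystem M W) (I : Set B) : W → ℚ :=
  fun w => (Nat.card {g : W | g ∈ minReps cs I ∧ g⁻¹ * w * g ∈ parabolic cs I} : ℚ)

/-! ### The exchange condition -/

section Exchange

/-- The signed conjugation action of a simple reflection on `W × ℤ/2`. -/
noncomputable def signedConj (cs : CoxeterSystem M W) (i : B) : Equiv.Perm (W × ZMod 2) where
  toFun p := (cs.simple i * p.1 * cs.simple i, p.2 + if p.1 = cs.simple i then 1 else 0)
  invFun p := (cs.simple i * p.1 * cs.simple i, p.2 + if p.1 = cs.simple i then 1 else 0)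
  left_inv p := by
    have h : cs.simple i * p.1 * cs.simple i = cs.simple i ↔ p.1 = cs.simple i := by
      constructor
      · intro h
        have := congrArg (fun x => cs.simple i * x * cs.simple i) h
        simpa [mul_assoc] using this
      · intro h
        simp [h]
    refine Prod.ext (by simp [mul_assoc]) ?_
    simp only [h, add_assoc]
    split_ifs
    · rw [CharTwo.add_self_eq_zero, add_zero]
    · simp
  right_inv p := by
    have h : cs.simple i * p.1 * cs.simple i = cs.simple i ↔ p.1 = cs.simple i := by
      constructor
      · intro h
        have := congrArg (fun x => cs.simple i * x * cs.simple i) h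
        simpa [mul_assoc] using this
      · intro h
        simp [h]
    refine Prod.ext (by simp [mul_assoc]) ?_
    simp only [h, add_assoc]
    split_ifs
    · rw [CharTwo.add_self_eq_zero, add_zero]
    · simp

theorem signedConj_prod (cs : CoxeterSystem M W) (ω : List B) (t : W) (e : ZMod 2) :
    (ω.map (signedConj cs)).prod (t, e) =
      (cs.wordProd ω * t * (cs.wordProd ω)⁻¹, e + ((cs.rightInvSeq ω).count t : ℕ)) := by
  induction ω with
  | nil => simp
  | cons i ω ih =>
    rw [List.map_cons, List.prod_cons, Equiv.Perm.mul_apply, ih, CoxeterSystem.rightInvSeq,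
      List.count_cons]
    have h : cs.wordProd ω * t * (cs.wordProd ω)⁻¹ = cs.simple i ↔
        (cs.wordProd ω)⁻¹ * cs.simple i * cs.wordProd ω = t := by
      constructor
      · intro h
        rw [← h]
        group
      · intro h
        rw [← h]
        group
    refine Prod.ext ?_ ?_
    · simp [signedConj, CoxeterSystem.wordProd_cons, mul_assoc]
    · simp only [signedConj, Equiv.coe_fn_mk, h, beq_iff_eq]
      push_cast
      rw [add_assoc]

theorem alternatingWord_map_prod {G : Type*} [Group G] (f : B → G) (i j : B) (m : ℕ) :
    ((CoxeterSystem.alternatingWord i j (2 * m)).map f).prod = (f i * f j) ^ m := by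
  induction m with
  | zero => simp [CoxeterSystem.alternatingWord]
  | succ m ih =>
    have h : 2 * (m + 1) = 2 * m + 1 + 1 := by ring
    rw [h, CoxeterSystem.alternatingWord_succ', CoxeterSystem.alternatingWord_succ']
    simp [ih, pow_succ', mul_assoc]

theorem even_count_leftInvSeq_alternatingWord (cs : CoxeterSystem M W) (i j : B) (t : W) :
    Even ((cs.leftInvSeq (CoxeterSystem.alternatingWord i j (2 * M i j))).count t) := by
  set l := cs.leftInvSeq (CoxeterSystem.alternatingWord i j (2 * M i j)) with hl
  have hlen : l.length = 2 * M i j := by simp [hl]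
  have hhalf : l.take (M i j) = l.drop (M i j) := by
    refine List.ext_getElem (by simp [hlen]; omega) fun k h1 h2 => ?_
    have hk : k < M i j := by
      simp [hlen] at h1
      omega
    rw [List.getElem_take, List.getElem_drop]
    simp only [hl]
    rw [cs.getElem_leftInvSeq_alternatingWord i j _ _ (by omega),
      cs.getElem_leftInvSeq_alternatingWord i j _ _ (by omega),
      cs.prod_alternatingWord_eq_mul_pow, cs.prod_alternatingWord_eq_mul_pow]
    have h1 : (2 * k + 1) / 2 = k := by omega
    have h2 : (2 * (M i j + k) + 1) / 2 = M i j + k := by omega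
    rw [h1, h2, pow_add]
    simp
  rw [← List.take_append_drop (M i j) l, List.count_append, ← hhalf]
  exact ⟨_, rfl⟩

theorem reverse_alternatingWord (i j : B) (m : ℕ) :
    (CoxeterSystem.alternatingWord i j (2 * m)).reverse =
      CoxeterSystem.alternatingWord j i (2 * m) := by
  induction m with
  | zero => simp [CoxeterSystem.alternatingWord]
  | succ m ih =>
    have h : 2 * (m + 1) = 2 * m + 1 + 1 := by ring
    rw [h, CoxeterSystem.alternatingWord_succ, CoxeterSystem.alternatingWord_succ,
      CoxeterSystem.alternatingWord_succ', CoxeterSystem.alternatingWord_succ']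
    simp [ih]

theorem signedConj_isLiftable (cs : CoxeterSystem M W) : M.IsLiftable (signedConj cs) := by
  intro i j
  rw [← alternatingWord_map_prod]
  ext1 ⟨t, e⟩
  rw [signedConj_prod]
  have h1 : cs.wordProd (CoxeterSystem.alternatingWord i j (2 * M i j)) = 1 := by
    rw [cs.prod_alternatingWord_eq_mul_pow]
    simp
  have h2 : Even ((cs.rightInvSeq (CoxeterSystem.alternatingWord i j (2 * M i j))).count t) := by
    rw [← List.reverse_reverse (CoxeterSystem.alternatingWord i j _), cs.rightInvSeq_reverse,
      List.count_reverse, reverse_alternatingWord, M.symmetric i j]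
    exact even_count_leftInvSeq_alternatingWord cs j i t
  rw [h1, (ZMod.natCast_eq_zero_iff_even).2 h2]
  simp

theorem count_rightInvSeq_eq (cs : CoxeterSystem M W) {ω ω' : List B}
    (h : cs.wordProd ω = cs.wordProd ω') (t : W) :
    ((cs.rightInvSeq ω).count t : ZMod 2) = ((cs.rightInvSeq ω').count t : ℕ) := by
  have key : ∀ ω : List B, cs.lift ⟨signedConj cs, signedConj_isLiftable cs⟩ (cs.wordProd ω) =
      (ω.map (signedConj cs)).prod := by
    intro ω
    rw [CoxeterSystem.wordProd, map_list_prod, List.map_map]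
    congr 1
    refine List.map_congr_left fun i _ => ?_
    simp [cs.lift_apply_simple (signedConj_isLiftable cs)]
  have h1 := signedConj_prod cs ω t 0
  have h2 := signedConj_prod cs ω' t 0
  rw [← key, h, key, h2] at h1
  simpa using (congrArg Prod.snd h1).symm

/-- The exchange condition, for an arbitrary word. -/
theorem exchange_right (cs : CoxeterSystem M W) {ω : List B} {i : B}
    (h : cs.length (cs.wordProd ω * cs.simple i) < cs.length (cs.wordProd ω)) :
    ∃ j < ω.length, cs.wordProd ω * cs.simple i = cs.wordProd (ω.eraseIdx j) := by
  obtain ⟨ω', hω', hw⟩ := cs.exists_isReduced (cs.wordProd ω * cs.simple i)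
  have hprod : cs.wordProd (ω'.concat i) = cs.wordProd ω := by
    rw [cs.wordProd_concat, ← hw]
    simp
  have hred : cs.IsReduced (ω'.concat i) := by
    have h1 := cs.length_mul_simple (cs.wordProd ω) i
    have h2 := hω'.eq
    rw [CoxeterSystem.IsReduced, hprod]
    rw [← hw] at h2
    simp
    omega
  have hmem : cs.simple i ∈ cs.rightInvSeq (ω'.concat i) := by
    rw [cs.rightInvSeq_concat]
    simp
  have hcount : (cs.rightInvSeq (ω'.concat i)).count (cs.simple i) = 1 :=
    List.count_eq_one_of_mem hred.nodup_rightInvSeq hmem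
  have h3 := count_rightInvSeq_eq cs hprod (cs.simple i)
  rw [hcount] at h3
  have h4 : cs.simple i ∈ cs.rightInvSeq ω := by
    by_contra hn
    rw [List.count_eq_zero_of_not_mem hn] at h3
    simp at h3
  obtain ⟨j, hj, hji⟩ := List.mem_iff_getElem.mp h4
  refine ⟨j, by simpa using hj, ?_⟩
  rw [← cs.wordProd_mul_getD_rightInvSeq, List.getD_eq_getElem _ 1 hj, hji]

end Exchange

/-! ### Standard parabolic subgroups and double cosets -/

section Parabolic

theorem simple_mem_parabolic (cs : CoxeterSystem M W) {I : Set B} {i : B} (hi : i ∈ I) :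
    cs.simple i ∈ parabolic cs I :=
  Subgroup.subset_closure ⟨i, hi, rfl⟩

theorem parabolic_mono (cs : CoxeterSystem M W) {I J : Set B} (h : I ⊆ J) :
    parabolic cs I ≤ parabolic cs J :=
  Subgroup.closure_mono (Set.image_mono h)

theorem wordProd_mem_parabolic (cs : CoxeterSystem M W) {I : Set B} {ω : List B}
    (h : ∀ i ∈ ω, i ∈ I) : cs.wordProd ω ∈ parabolic cs I := by
  refine Subgroup.list_prod_mem _ fun x hx => ?_
  obtain ⟨i, hi, rfl⟩ := List.mem_map.1 hx
  exact simple_mem_parabolic cs (h i hi)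

/-- Induction on a parabolic subgroup by right multiplication with simple reflections. -/
theorem parabolic_induction (cs : CoxeterSystem M W) {I : Set B} {p : W → Prop} (one : p 1)
    (mul : ∀ w ∈ parabolic cs I, ∀ i ∈ I, p w → p (w * cs.simple i)) {w : W}
    (hw : w ∈ parabolic cs I) : p w := by
  induction hw using Subgroup.closure_induction_right with
  | one => exact one
  | mul_right x hx y hy ih =>
    obtain ⟨i, hi, rfl⟩ := hy
    exact mul x hx i hi ih
  | mul_inv_cancel x hx y hy ih =>
    obtain ⟨i, hi, rfl⟩ := hy
    rw [cs.inv_simple]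
    exact mul x hx i hi ih

theorem exists_isReduced_mem (cs : CoxeterSystem M W) {I : Set B} {w : W}
    (hw : w ∈ parabolic cs I) :
    ∃ ω : List B, cs.IsReduced ω ∧ (∀ i ∈ ω, i ∈ I) ∧ cs.wordProd ω = w := by
  refine parabolic_induction cs (p := fun w => ∃ ω : List B, cs.IsReduced ω ∧ (∀ i ∈ ω, i ∈ I) ∧
    cs.wordProd ω = w) ⟨[], by simp [CoxeterSystem.IsReduced]⟩ ?_ hw
  rintro _ - i hi ⟨ω, hred, hω, rfl⟩
  rcases cs.length_mul_simple (cs.wordProd ω) i with h | h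
  · refine ⟨ω.concat i, ?_, ?_, cs.wordProd_concat i ω⟩
    · rw [CoxeterSystem.IsReduced, cs.wordProd_concat, h, hred.eq]
      simp
    · intro k hk
      simp at hk
      rcases hk with hk | rfl
      exacts [hω k hk, hi]
  · obtain ⟨j, hj, hji⟩ := exchange_right cs (ω := ω) (i := i) (by omega)
    refine ⟨ω.eraseIdx j, ?_, fun k hk => hω k (List.mem_of_mem_eraseIdx hk), hji.symm⟩
    have := hred.eq
    rw [CoxeterSystem.IsReduced, ← hji, List.length_eraseIdx_of_lt hj]
    omega

/-- The alternatives of the exchange condition for a concatenation of two words. -/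
theorem exchange_right_append (cs : CoxeterSystem M W) {ω₁ ω₂ : List B} {i : B}
    (h : cs.length (cs.wordProd ω₁ * cs.wordProd ω₂ * cs.simple i) <
      cs.length (cs.wordProd ω₁ * cs.wordProd ω₂)) :
    (∃ j < ω₁.length, cs.wordProd ω₁ * cs.wordProd ω₂ * cs.simple i =
      cs.wordProd (ω₁.eraseIdx j) * cs.wordProd ω₂) ∨
    (∃ j < ω₂.length, cs.wordProd ω₂ * cs.simple i = cs.wordProd (ω₂.eraseIdx j)) := by
  rw [← cs.wordProd_append] at h
  obtain ⟨j, hj, hji⟩ := exchange_right cs h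
  rw [List.length_append] at hj
  by_cases hlt : j < ω₁.length
  · left
    refine ⟨j, hlt, ?_⟩
    rw [List.eraseIdx_append_of_lt_length hlt, cs.wordProd_append, cs.wordProd_append] at hji
    exact hji
  · right
    refine ⟨j - ω₁.length, by omega, ?_⟩
    rw [List.eraseIdx_append_of_length_le (by omega), cs.wordProd_append, cs.wordProd_append,
      mul_assoc] at hji
    exact mul_left_cancel hji

theorem length_wordProd_eraseIdx_lt (cs : CoxeterSystem M W) {ω : List B} (hω : cs.IsReduced ω)
    {j : ℕ} (hj : j < ω.length) :
    cs.length (cs.wordProd (ω.eraseIdx j)) < cs.length (cs.wordProd ω) := by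
  have h1 := cs.length_wordProd_le (ω.eraseIdx j)
  have h2 := List.length_eraseIdx_add_one hj
  have h3 := hω.eq
  omega

theorem length_mul_of_minimal (cs : CoxeterSystem M W) {I : Set B} {g : W}
    (hg : ∀ x ∈ parabolic cs I, cs.length g ≤ cs.length (g * x)) {x : W}
    (hx : x ∈ parabolic cs I) : cs.length (g * x) = cs.length g + cs.length x := by
  refine parabolic_induction cs (p := fun x => cs.length (g * x) = cs.length g + cs.length x)
    (by simp) ?_ hx
  intro x hx i hi ih
  obtain ⟨γ, hγ, rfl⟩ := cs.exists_isReduced g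
  obtain ⟨ω, hω, hωI, rfl⟩ := exists_isReduced_mem cs hx
  have h1 := cs.length_mul_simple (cs.wordProd γ * cs.wordProd ω) i
  have h2 := cs.length_mul_simple (cs.wordProd ω) i
  have h3 := cs.length_mul_le (cs.wordProd γ) (cs.wordProd ω * cs.simple i)
  rw [← mul_assoc] at h3 ⊢
  rcases h1 with h1 | h1
  · omega
  · rcases exchange_right_append cs (ω₁ := γ) (ω₂ := ω) (i := i) (by omega) with
      ⟨j, hj, h⟩ | ⟨j, hj, h⟩
    · have h4 := length_wordProd_eraseIdx_lt cs hγ hj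
      have h5 := hg (cs.wordProd ω * cs.simple i * (cs.wordProd ω)⁻¹)
        (mul_mem (mul_mem hx (simple_mem_parabolic cs hi)) (inv_mem hx))
      rw [← mul_assoc, ← mul_assoc, h, mul_inv_cancel_right] at h5
      omega
    · have h4 := length_wordProd_eraseIdx_lt cs hω hj
      rw [← h] at h4
      omega

/-- If `g` has minimal length in the double coset `W_J g W_I` then
`W_I ∩ g⁻¹ W_J g` is generated by the simple reflections it contains. -/
theorem mem_parabolic_of_minimal (cs : CoxeterSystem M W) {I J : Set B} {g : W}
    (hg : ∀ y ∈ parabolic cs J, ∀ x ∈ parabolic cs I, cs.length g ≤ cs.length (y * g * x))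
    {x y : W} (hx : x ∈ parabolic cs I) (hy : y ∈ parabolic cs J) (h : g * x = y * g) :
    x ∈ parabolic cs {i | i ∈ I ∧ ∃ j ∈ J, g * cs.simple i * g⁻¹ = cs.simple j} := by
  have hgI : ∀ x ∈ parabolic cs I, cs.length g ≤ cs.length (g * x) := fun x hx => by
    simpa using hg 1 (one_mem _) x hx
  obtain ⟨ω, hω, hωI, rfl⟩ := exists_isReduced_mem cs hx
  clear hx
  induction ω using List.reverseRecOn generalizing y with
  | nil => simp [one_mem]
  | append_singleton ω i ih =>
    have hiI : i ∈ I := hωI i (by simp)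
    have hωI' : ∀ k ∈ ω, k ∈ I := fun k hk => hωI k (by simp [hk])
    have hωred : cs.IsReduced ω := by simpa using hω.take ω.length
    have hmem : cs.wordProd ω ∈ parabolic cs I := wordProd_mem_parabolic cs hωI'
    have hmem' : cs.wordProd (ω ++ [i]) ∈ parabolic cs I := wordProd_mem_parabolic cs hωI
    have hprod : cs.wordProd (ω ++ [i]) = cs.wordProd ω * cs.simple i := by
      simp [cs.wordProd_append]
    obtain ⟨γ, hγ, rfl⟩ := cs.exists_isReduced g
    obtain ⟨υ, hυ, hυJ, rfl⟩ := exists_isReduced_mem cs hy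
    have hs : cs.wordProd υ * cs.wordProd γ * cs.simple i =
        cs.wordProd γ * cs.wordProd ω := by
      rw [← h, hprod]
      simp [mul_assoc]
    have hl1 := length_mul_of_minimal cs hgI hmem
    have hl2 := length_mul_of_minimal cs hgI hmem'
    have hl3 := hω.eq
    have hl4 := hωred.eq
    rw [List.length_append, List.length_singleton] at hl3
    rcases exchange_right_append cs (ω₁ := υ) (ω₂ := γ) (i := i)
      (by rw [hs, ← h]; omega) with ⟨j, hj, hji⟩ | ⟨j, hj, hji⟩
    · have hmem'' : cs.wordProd (υ.eraseIdx j) ∈ parabolic cs J :=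
        wordProd_mem_parabolic cs fun k hk => hυJ k (List.mem_of_mem_eraseIdx hk)
      have hrec := ih hmem'' hωred hωI' (by rw [← hs, hji])
      rw [hprod]
      refine mul_mem hrec (simple_mem_parabolic cs ⟨hiI, ?_⟩)
      set y' := (cs.wordProd υ)⁻¹ * cs.wordProd (υ.eraseIdx j) with hy'
      have hy'J : y' ∈ parabolic cs J := mul_mem (inv_mem hy) hmem''
      have hconj : y' * cs.wordProd γ = cs.wordProd γ * cs.simple i := by
        rw [hy', mul_assoc, ← hji]
        group
      have hgJ : ∀ x ∈ parabolic cs J,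
          cs.length (cs.wordProd γ)⁻¹ ≤ cs.length ((cs.wordProd γ)⁻¹ * x) := fun x hx => by
        have := hg x⁻¹ (inv_mem hx) 1 (one_mem _)
        rw [cs.length_inv, ← cs.length_inv ((cs.wordProd γ)⁻¹ * x)]
        simpa using this
      have hlen1 := length_mul_of_minimal cs hgJ (inv_mem hy'J)
      rw [← mul_inv_rev, cs.length_inv, cs.length_inv, cs.length_inv, hconj,
        length_mul_of_minimal cs hgI (simple_mem_parabolic cs hiI), cs.length_simple] at hlen1
      obtain ⟨τ, hτ, hτJ, hτy⟩ := exists_isReduced_mem cs hy'J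
      have hτlen := hτ.eq
      rw [hτy] at hτlen
      obtain ⟨k, rfl⟩ := List.length_eq_one_iff.1 (show τ.length = 1 by omega)
      refine ⟨k, hτJ k (by simp), ?_⟩
      rw [← hconj, ← hτy]
      simp
    · exfalso
      have h4 := length_wordProd_eraseIdx_lt cs hγ hj
      have h5 := hgI _ (simple_mem_parabolic cs hiI)
      rw [hji] at h5
      omega

/-- `w` lies in `W_I` and no `W_I`-conjugate of it lies in a smaller standard parabolic. -/
def IsCuspidal (cs : CoxeterSystem M W) (I : Set B) (w : W) : Prop :=
  w ∈ parabolic cs I ∧ ∀ K ⊂ I, ∀ u ∈ parabolic cs I, u * w * u⁻¹ ∉ parabolic cs K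

theorem IsCuspidal.conj {cs : CoxeterSystem M W} {I : Set B} {w : W} (hw : IsCuspidal cs I w)
    {u : W} (hu : u ∈ parabolic cs I) : IsCuspidal cs I (u * w * u⁻¹) := by
  refine ⟨mul_mem (mul_mem hu hw.1) (inv_mem hu), fun K hK v hv => ?_⟩
  have := hw.2 K hK (v * u) (mul_mem hv hu)
  rwa [show v * (u * w * u⁻¹) * v⁻¹ = v * u * w * (v * u)⁻¹ by group]

theorem IsCuspidal.image_subset {cs : CoxeterSystem M W} {I J : Set B} {w g : W}
    (hw : IsCuspidal cs I w) (hgw : g * w * g⁻¹ ∈ parabolic cs J)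
    (hg : ∀ y ∈ parabolic cs J, ∀ x ∈ parabolic cs I, cs.length g ≤ cs.length (y * g * x)) :
    ∀ i ∈ I, ∃ j ∈ J, g * cs.simple i * g⁻¹ = cs.simple j := by
  have h := mem_parabolic_of_minimal cs hg hw.1 hgw (by simp)
  by_contra hcon
  push Not at hcon
  obtain ⟨i, hi, hij⟩ := hcon
  refine hw.2 {i | i ∈ I ∧ ∃ j ∈ J, g * cs.simple i * g⁻¹ = cs.simple j}
    ⟨fun k hk => hk.1, fun hsub => ?_⟩ 1 (one_mem _) (by simpa using h)
  obtain ⟨-, j, hj, h⟩ := hsub hi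
  exact hij j hj h

/-- Two conjugate elements, cuspidal in `W_I` and `W_J`, are conjugate through an element that
carries `I` to `J`. -/
theorem IsCuspidal.exists_conj {cs : CoxeterSystem M W} {I J : Set B} {w g : W}
    (hw : IsCuspidal cs I w) (hgw : IsCuspidal cs J (g * w * g⁻¹)) :
    ∃ u ∈ parabolic cs I, ∃ v ∈ parabolic cs J, ∃ n : W, g = v * n * u ∧
      (∀ i ∈ I, ∃ j ∈ J, n * cs.simple i * n⁻¹ = cs.simple j) ∧
      (∀ j ∈ J, ∃ i ∈ I, n⁻¹ * cs.simple j * n = cs.simple i) := by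
  let D : Set W := {n | ∃ u ∈ parabolic cs I, ∃ v ∈ parabolic cs J, g = v * n * u}
  have hD : D.Nonempty := ⟨g, 1, one_mem _, 1, one_mem _, by simp⟩
  obtain ⟨n, ⟨u, hu, v, hv, hguv⟩, hmin⟩ :=
    (measure cs.length).wf.has_min D hD
  have hmin' : ∀ y ∈ parabolic cs J, ∀ x ∈ parabolic cs I,
      cs.length n ≤ cs.length (y * n * x) := by
    intro y hy x hx
    refine not_lt.1 (hmin (y * n * x) ⟨x⁻¹ * u, mul_mem (inv_mem hx) hu, v * y⁻¹,
      mul_mem hv (inv_mem hy), ?_⟩)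
    rw [hguv]
    group
  refine ⟨u, hu, v, hv, n, hguv, (hw.conj hu).image_subset ?_ hmin', ?_⟩
  · have := mul_mem (mul_mem (inv_mem hv) hgw.1) hv
    rw [hguv] at this
    convert this using 1
    group
  · have hw' : IsCuspidal cs J (v⁻¹ * (g * w * g⁻¹) * v⁻¹⁻¹) := hgw.conj (inv_mem hv)
    have := hw'.image_subset (J := I) (g := n⁻¹) ?_ ?_
    · simpa using this
    · have := mul_mem (mul_mem hu hw.1) (inv_mem hu)
      rw [hguv]
      convert this using 1
      group
    · intro y hy x hx
      have := hmin' x⁻¹ (inv_mem hx) y⁻¹ (inv_mem hy)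
      rw [cs.length_inv, ← cs.length_inv (y * n⁻¹ * x)]
      simpa [mul_assoc] using this

end Parabolic

/-! ### The geometric representation and positivity -/

section Geometric

/-- The entries of the Gram matrix of the geometric representation. -/
noncomputable def gram (M : CoxeterMatrix B) (i j : B) : ℝ := -Real.cos (Real.pi / M i j)

theorem gram_self (i : B) : gram M i i = 1 := by simp [gram]

theorem gram_comm (i j : B) : gram M i j = gram M j i := by simp [gram, M.symmetric i j]

/-- Twice the pairing with the simple root `α_i`. -/
noncomputable def coroot (M : CoxeterMatrix B) (i : B) : (B →₀ ℝ) →ₗ[ℝ] ℝ :=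
  Finsupp.linearCombination ℝ fun j => 2 * gram M i j

theorem coroot_single (i j : B) (c : ℝ) : coroot M i (Finsupp.single j c) = c * (2 * gram M i j) := by
  simp [coroot]

theorem coroot_self (i : B) : coroot M i (Finsupp.single i 1) = 2 := by
  simp [coroot_single, gram_self]

/-- The simple reflections of the geometric representation. -/
noncomputable def geomReflection (M : CoxeterMatrix B) (i : B) : (B →₀ ℝ) ≃ₗ[ℝ] (B →₀ ℝ) :=
  Module.reflection (coroot_self (M := M) i)

theorem geomReflection_apply (i : B) (v : B →₀ ℝ) :
    geomReflection M i v = v - coroot M i v • Finsupp.single i 1 :=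
  Module.reflection_apply _ _

theorem geomReflection_isLiftable (M : CoxeterMatrix B) : M.IsLiftable (geomReflection M) := by
  intro i j
  have hsin : ∀ (n : ℤ) (θ : ℝ), ((Polynomial.Chebyshev.S ℝ n).eval (2 * Real.cos θ)) *
      Real.sin θ = Real.sin ((n + 1) * θ) := fun n θ => Polynomial.Chebyshev.S_two_mul_real_cos θ n
  by_cases hij : i = j
  · subst hij
    rw [M.diagonal, pow_one]
    ext1 v
    exact Module.involutive_reflection (coroot_self (M := M) i) v
  have h1 : M i j ≠ 1 := M.off_diagonal i j hij
  obtain h0 | h2 | h3 : M i j = 0 ∨ M i j = 2 ∨ 3 ≤ M i j := by omega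
  · rw [h0, pow_zero]
  · have hg : gram M i j = 0 := by simp [gram, h2]
    have hg' : gram M j i = 0 := by rw [gram_comm, hg]
    rw [h2, pow_two]
    refine LinearEquiv.ext fun v => ?_
    simp only [LinearEquiv.mul_apply, geomReflection_apply, map_sub, map_smul, coroot_single,
      gram_self, hg, hg', LinearEquiv.coe_one, id]
    match_scalars <;> ring
  · set m := M i j with hm
    have hm0 : (m : ℝ) ≠ 0 := by positivity
    have hm3 : (3 : ℝ) ≤ m := by exact_mod_cast h3
    set θ : ℝ := 2 * (Real.pi / m) with hθ
    have hmθ : m * θ = 2 * Real.pi := by rw [hθ]; field_simp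
    have hsθ : Real.sin θ ≠ 0 := by
      refine (Real.sin_pos_of_pos_of_lt_pi (by positivity) ?_).ne'
      rw [hθ, ← mul_div_assoc, div_lt_iff₀ (by linarith)]
      nlinarith [Real.pi_pos]
    refine LinearEquiv.ext fun v => ?_
    have ht : 2 * Real.cos θ = coroot M i (Finsupp.single j 1) * coroot M j (Finsupp.single i 1)
        - 2 := by
      rw [coroot_single, coroot_single, gram_comm j i, gram, ← hm, hθ, Real.cos_two_mul]
      ring
    have key := Module.reflection_mul_reflection_pow_apply (coroot_self (M := M) i)
      (coroot_self (M := M) j) m v (2 * Real.cos θ) ht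
    have hS : ∀ n : ℤ, ((n : ℝ) + 1) * θ = Real.pi →
        (Polynomial.Chebyshev.S ℝ n).eval (2 * Real.cos θ) = 0 := by
      intro n hn
      have := hsin n θ
      rw [hn, Real.sin_pi] at this
      exact (mul_eq_zero.1 this).resolve_right hsθ
    have hSS : ∀ n n' : ℤ, ((n : ℝ) + 1) * θ + ((n' : ℝ) + 1) * θ = 2 * Real.pi →
        (Polynomial.Chebyshev.S ℝ n).eval (2 * Real.cos θ) +
        (Polynomial.Chebyshev.S ℝ n').eval (2 * Real.cos θ) = 0 := by
      intro n n' hn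
      have h1 := hsin n θ
      have h2 := hsin n' θ
      rw [eq_sub_of_add_eq hn, Real.sin_two_pi_sub] at h1
      have : ((Polynomial.Chebyshev.S ℝ n).eval (2 * Real.cos θ) +
        (Polynomial.Chebyshev.S ℝ n').eval (2 * Real.cos θ)) * Real.sin θ = 0 := by linarith
      exact (mul_eq_zero.1 this).resolve_right hsθ
    rw [geomReflection, geomReflection, key]
    obtain ⟨k, hk | hk⟩ := Nat.even_or_odd' m
    · have e1 : ((m : ℤ) - 2) / 2 = k - 1 := by omega
      have e2 : ((m : ℤ) - 1) / 2 = k - 1 := by omega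
      have : (Polynomial.Chebyshev.S ℝ ((k : ℤ) - 1)).eval (2 * Real.cos θ) = 0 := by
        apply hS
        have : (m : ℝ) = 2 * k := by exact_mod_cast hk
        rw [this] at hmθ
        push_cast
        linarith
      rw [e1, e2, this]
      simp
    · have e1 : ((m : ℤ) - 2) / 2 = k - 1 := by omega
      have e2 : ((m : ℤ) - 1) / 2 = k := by omega
      have e3 : ((m : ℤ) - 3) / 2 = k - 1 := by omega
      have e4 : (m : ℤ) / 2 = k := by omega
      have : (Polynomial.Chebyshev.S ℝ (k : ℤ)).eval (2 * Real.cos θ) +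
          (Polynomial.Chebyshev.S ℝ ((k : ℤ) - 1)).eval (2 * Real.cos θ) = 0 := by
        apply hSS
        have : (m : ℝ) = 2 * k + 1 := by exact_mod_cast hk
        rw [this] at hmθ
        push_cast
        linarith
      rw [e1, e2, e3, e4, this]
      simp

/-- The geometric representation. -/
noncomputable def geom (cs : CoxeterSystem M W) : W →* ((B →₀ ℝ) ≃ₗ[ℝ] (B →₀ ℝ)) :=
  cs.lift ⟨geomReflection M, geomReflection_isLiftable M⟩

theorem geom_simple (cs : CoxeterSystem M W) (i : B) (v : B →₀ ℝ) :
    geom cs (cs.simple i) v = v - coroot M i v • Finsupp.single i 1 := by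
  rw [geom, cs.lift_apply_simple (geomReflection_isLiftable M), geomReflection_apply]

theorem geom_simple_self (cs : CoxeterSystem M W) (i : B) :
    geom cs (cs.simple i) (Finsupp.single i 1) = -Finsupp.single i 1 := by
  rw [geom_simple, coroot_self]
  module

theorem simple_injective (cs : CoxeterSystem M W) : Function.Injective cs.simple := by
  intro i j hij
  by_contra hne
  have h := geom_simple cs j (Finsupp.single i 1)
  rw [← hij, geom_simple_self] at h
  have := DFunLike.congr_fun h i
  simp [Ne.symm hne] at this
  linarith

/-- Averaging an inner product and normalizing the simple roots gives an invariant inner product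
with unit simple roots, whose Gram matrix is `gram M`. -/
theorem exists_unit_roots [Finite W] (cs : CoxeterSystem M W) :
    ∃ (P : LinearMap.BilinForm ℝ (B →₀ ℝ)) (β : B → B →₀ ℝ), (∀ u v, P u v = P v u) ∧
      (∀ u, u ≠ 0 → 0 < P u u) ∧ (∀ (w : W) u v, P (geom cs w u) (geom cs w v) = P u v) ∧
      (∀ i j, P (β i) (β j) = gram M i j) ∧
      ∀ i, ∃ c : ℝ, 0 < c ∧ β i = c • Finsupp.single i 1 := by
  have : Finite B := Finite.of_injective _ (simple_injective cs)
  cases nonempty_fintype B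
  cases nonempty_fintype W
  let P : LinearMap.BilinForm ℝ (B →₀ ℝ) :=
    LinearMap.mk₂ ℝ (fun u v => ∑ g : W, ∑ i, geom cs g u i * geom cs g v i)
      (by intros; simp [add_mul, Finset.sum_add_distrib])
      (by intros; simp [Finset.mul_sum, mul_assoc])
      (by intros; simp [mul_add, Finset.sum_add_distrib])
      (by intros; simp [Finset.mul_sum, mul_left_comm])
  have hP : ∀ u v, P u v = ∑ g : W, ∑ i, geom cs g u i * geom cs g v i := fun u v => rfl
  have hsymm : ∀ u v, P u v = P v u := fun u v => by simp only [hP, mul_comm]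
  have hpos : ∀ u, u ≠ 0 → 0 < P u u := by
    intro u hu
    rw [hP]
    refine Finset.sum_pos' (fun g _ => Finset.sum_nonneg fun i _ => mul_self_nonneg _)
      ⟨1, Finset.mem_univ _, ?_⟩
    obtain ⟨i, hi⟩ := Finsupp.ne_iff.1 hu
    refine Finset.sum_pos' (fun i _ => mul_self_nonneg _) ⟨i, Finset.mem_univ _, ?_⟩
    rw [map_one]
    exact mul_self_pos.2 hi
  have hinv : ∀ (w : W) u v, P (geom cs w u) (geom cs w v) = P u v := by
    intro w u v
    rw [hP, hP, ← Equiv.sum_comp (Equiv.mulRight w)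
      (fun g => ∑ i, geom cs g u i * geom cs g v i)]
    simp [map_mul]
  set α : B → B →₀ ℝ := fun i => Finsupp.single i 1 with hα
  have hp : ∀ i, 0 < P (α i) (α i) := fun i => hpos _ (by simp [hα])
  have hcor : ∀ i v, 2 * P (α i) v = coroot M i v * P (α i) (α i) := by
    intro i v
    have h := hinv (cs.simple i) (α i) v
    rw [geom_simple, geom_simple, coroot_self] at h
    simp only [map_sub, map_smul, LinearMap.sub_apply, LinearMap.smul_apply, smul_eq_mul] at h
    simp only [hα] at h ⊢
    linarith
  have hgram : ∀ i j, P (α i) (α j) = gram M i j * P (α i) (α i) := by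
    intro i j
    have := hcor i (α j)
    rw [hα, coroot_single] at this
    simp only [hα]
    linarith
  choose r hr hrr using fun i => (⟨√(P (α i) (α i)), Real.sqrt_pos.2 (hp i),
    Real.mul_self_sqrt (hp i).le⟩ : ∃ r : ℝ, 0 < r ∧ r * r = P (α i) (α i))
  refine ⟨P, fun i => (r i)⁻¹ • α i, hsymm, hpos, hinv, fun i j => ?_,
    fun i => ⟨_, inv_pos.2 (hr i), rfl⟩⟩
  simp only [map_smul, LinearMap.smul_apply, smul_eq_mul]
  by_cases h0 : gram M i j = 0
  · simp [hgram i j, h0]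
  · have hij : P (α i) (α i) = P (α j) (α j) := by
      have h1 := hgram i j
      have h2 := hgram j i
      rw [hsymm, h1, gram_comm] at h2
      refine mul_left_cancel₀ ?_ h2
      rwa [gram_comm]
    have hrij : r j = r i := by
      rw [← hrr, ← hrr] at hij
      exact ((mul_self_eq_mul_self_iff.1 hij).resolve_right
        (by have := hr i; have := hr j; intro h; linarith)).symm
    rw [hgram i j, hrij, ← hrr i]
    have := (hr i).ne'
    field_simp

theorem gram_nonpos {i j : B} (h : i ≠ j) : gram M i j ≤ 0 := by
  have h1 := M.off_diagonal i j h
  rw [gram, neg_nonpos]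
  obtain h0 | h2 : M i j = 0 ∨ 2 ≤ M i j := by omega
  · simp [h0]
  · have : (2 : ℝ) ≤ M i j := by exact_mod_cast h2
    refine Real.cos_nonneg_of_neg_pi_div_two_le_of_le ?_ ?_
    · have : 0 ≤ Real.pi / M i j := by positivity
      linarith [Real.pi_pos]
    · gcongr

theorem cos_pi_div_le {k m : ℕ} (hk : 1 ≤ k) (h : k ≤ m) :
    Real.cos (Real.pi / k) ≤ Real.cos (Real.pi / m) := by
  have hk' : (1 : ℝ) ≤ k := by exact_mod_cast hk
  have h' : (k : ℝ) ≤ m := by exact_mod_cast h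
  refine Real.cos_le_cos_of_nonneg_of_le_pi (by positivity) ?_ (by gcongr)
  exact div_le_self Real.pi_pos.le hk'

theorem gram_le_half {i j : B} (h : 3 ≤ M i j) : gram M i j ≤ -(1 / 2) := by
  have := cos_pi_div_le (by norm_num) h
  rw [Nat.cast_ofNat, Real.cos_pi_div_three] at this
  rw [gram]
  linarith

theorem gram_le_sqrt {i j : B} (h : 4 ≤ M i j) : gram M i j ≤ -(√2 / 2) := by
  have := cos_pi_div_le (by norm_num) h
  rw [Nat.cast_ofNat, Real.cos_pi_div_four] at this
  rw [gram]
  linarith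

theorem gram_le_five {i j : B} (h : 5 ≤ M i j) : gram M i j ≤ -(4 / 5) := by
  have := cos_pi_div_le (by norm_num) h
  rw [Nat.cast_ofNat, Real.cos_pi_div_five] at this
  have h5 : (2.2 : ℝ) ≤ √5 := Real.le_sqrt_of_sq_le (by norm_num)
  rw [gram]
  linarith

theorem eq_of_gram_eq {i j k l : B} (h1 : M i j ≠ 0) (h2 : M k l ≠ 0)
    (h : gram M i j = gram M k l) : M i j = M k l := by
  rw [gram, gram, neg_inj] at h
  rcases lt_trichotomy (M i j) (M k l) with hlt | heq | hlt
  · have h1' : (1 : ℝ) ≤ M i j := by exact_mod_cast Nat.one_le_iff_ne_zero.2 h1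
    have := Real.cos_lt_cos_of_nonneg_of_le_pi (x := Real.pi / M k l) (y := Real.pi / M i j)
      (by positivity) (div_le_self Real.pi_pos.le h1')
      (div_lt_div_of_pos_left Real.pi_pos (by positivity) (by exact_mod_cast hlt))
    linarith
  · exact heq
  · have h1' : (1 : ℝ) ≤ M k l := by exact_mod_cast Nat.one_le_iff_ne_zero.2 h2
    have := Real.cos_lt_cos_of_nonneg_of_le_pi (x := Real.pi / M i j) (y := Real.pi / M k l)
      (by positivity) (div_le_self Real.pi_pos.le h1')
      (div_lt_div_of_pos_left Real.pi_pos (by positivity) (by exact_mod_cast hlt))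
    linarith

/-- The pairing of a vertex with a list of weighted vertices. -/
noncomputable def listPair (M : CoxeterMatrix B) (v : B) : List (B × ℝ) → ℝ
  | [] => 0
  | p :: l => p.2 * gram M v p.1 + listPair M v l

/-- The quadratic form of the Gram matrix on a list of weighted vertices. -/
noncomputable def listForm (M : CoxeterMatrix B) : List (B × ℝ) → ℝ
  | [] => 0
  | p :: l => p.2 ^ 2 + 2 * (p.2 * listPair M p.1 l) + listForm M l

theorem listForm_pos [Finite W] (cs : CoxeterSystem M W) {l : List (B × ℝ)} (hl : l ≠ [])
    (hc : ∀ p ∈ l, 0 < p.2) : 0 < listForm M l := by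
  obtain ⟨P, β, hsymm, hpos, -, hgram, hβ⟩ := exists_unit_roots cs
  let F : List (B × ℝ) → B →₀ ℝ := fun l => (l.map fun p => p.2 • β p.1).sum
  have hpair : ∀ v l, P (β v) (F l) = listPair M v l := by
    intro v l
    induction l with
    | nil => simp [F, listPair]
    | cons p l ih =>
      have : F (p :: l) = p.2 • β p.1 + F l := by simp [F]
      rw [this, map_add, map_smul, hgram, ih, listPair, smul_eq_mul]
  have hform : ∀ l, P (F l) (F l) = listForm M l := by
    intro l
    induction l with
    | nil => simp [F, listForm]
    | cons p l ih =>
      have : F (p :: l) = p.2 • β p.1 + F l := by simp [F]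
      rw [this, listForm, ← ih, ← hpair]
      simp only [map_add, map_smul, LinearMap.add_apply, LinearMap.smul_apply, smul_eq_mul, hgram,
        gram_self, hsymm (F l) (β p.1)]
      ring
  rw [← hform]
  refine hpos _ fun h0 => ?_
  have hnn : ∀ v, ∀ l : List (B × ℝ), (∀ p ∈ l, 0 < p.2) → 0 ≤ F l v := by
    intro v l hl
    induction l with
    | nil => simp [F]
    | cons p l ih =>
      have : F (p :: l) = p.2 • β p.1 + F l := by simp [F]
      obtain ⟨c, hc, hcβ⟩ := hβ p.1
      rw [this, hcβ, Finsupp.add_apply]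
      have h1 := ih fun q hq => hl q (by simp [hq])
      have h2 := hl p (by simp)
      refine add_nonneg ?_ h1
      simp only [Finsupp.smul_apply, Finsupp.single_apply, smul_eq_mul]
      split_ifs <;> positivity
  obtain _ | ⟨p, l⟩ := l
  · exact hl rfl
  · have : F (p :: l) = p.2 • β p.1 + F l := by simp [F]
    obtain ⟨c, hc', hcβ⟩ := hβ p.1
    have h1 := hnn p.1 l fun q hq => hc q (by simp [hq])
    have h2 := hc p (by simp)
    have h3 := DFunLike.congr_fun h0 p.1
    rw [this, hcβ, Finsupp.add_apply] at h3
    simp at h3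
    have : 0 < p.2 * c := by positivity
    linarith

theorem matrix_ne_zero [Finite W] (cs : CoxeterSystem M W) (i j : B) : M i j ≠ 0 := by
  intro h
  have := listForm_pos cs (l := [(i, 1), (j, 1)]) (by simp) (by simp)
  simp [listForm, listPair, gram, h] at this
  linarith

theorem matrix_eq_of_conj [Finite W] (cs : CoxeterSystem M W) {n : W} {i j i' j' : B}
    (hi : n * cs.simple i * n⁻¹ = cs.simple i') (hj : n * cs.simple j * n⁻¹ = cs.simple j') :
    M i j = M i' j' := by
  by_cases hij : i = j
  · subst hij
    rw [hi] at hj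
    rw [simple_injective cs hj, M.diagonal, M.diagonal]
  have hij' : i' ≠ j' := by
    rintro rfl
    exact hij (simple_injective cs (by rw [← hj] at hi; simpa using hi))
  obtain ⟨P, β, hsymm, hpos, hinv, hgram, hβ⟩ := exists_unit_roots cs
  have key : ∀ {i i' : B}, n * cs.simple i * n⁻¹ = cs.simple i' →
      ∃ d : ℝ, geom cs n (β i) = d • β i' ∧ (d = 1 ∨ d = -1) := by
    intro i i' h
    have hβi : geom cs (cs.simple i) (β i) = -β i := by
      obtain ⟨c, -, hc⟩ := hβ i
      rw [hc, map_smul, geom_simple_self, smul_neg]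
    have h1 : geom cs (cs.simple i') (geom cs n (β i)) = -geom cs n (β i) := by
      rw [← map_neg, ← hβi, ← LinearEquiv.mul_apply, ← LinearEquiv.mul_apply, ← map_mul, ← map_mul,
        ← h, inv_mul_cancel_right]
    obtain ⟨c, hc, hcβ⟩ := hβ i'
    have h2 : geom cs n (β i) = (coroot M i' (geom cs n (β i)) / 2 * c⁻¹) • β i' := by
      rw [geom_simple] at h1
      rw [hcβ, smul_smul, inv_mul_cancel_right₀ hc.ne', div_eq_inv_mul, mul_smul]
      rw [sub_eq_iff_eq_add, neg_add_eq_sub] at h1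
      have h3 : (2 : ℝ) • geom cs n (β i) =
          coroot M i' (geom cs n (β i)) • Finsupp.single i' 1 := by
        rw [two_smul]
        nth_rewrite 1 [h1]
        abel
      rw [← h3, smul_smul]
      norm_num
    refine ⟨_, h2, ?_⟩
    have h3 := hinv n (β i) (β i)
    rw [h2] at h3
    simp only [map_smul, LinearMap.smul_apply, smul_eq_mul, hgram, gram_self, mul_one] at h3
    exact mul_self_eq_one_iff.1 h3
  obtain ⟨d, hd, hd'⟩ := key hi
  obtain ⟨e, he, he'⟩ := key hj
  have h := hinv n (β i) (β j)
  rw [hd, he] at h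
  simp only [map_smul, LinearMap.smul_apply, smul_eq_mul, hgram] at h
  refine eq_of_gram_eq (matrix_ne_zero cs i j) (matrix_ne_zero cs i' j') ?_
  have h1 := gram_nonpos (M := M) hij
  have h2 := gram_nonpos (M := M) hij'
  rcases hd' with rfl | rfl <;> rcases he' with rfl | rfl <;> linarith

end Geometric

/-! ### Coxeter graphs of finite Coxeter groups -/

section Graph

theorem ne_of_three_le {i j : B} (h : 3 ≤ M i j) : i ≠ j := by
  rintro rfl
  rw [M.diagonal] at h
  omega

theorem three_le_symm {i j : B} (h : 3 ≤ M i j) : 3 ≤ M j i := by rwa [M.symmetric]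

theorem listPair_eq_sum (v : B) (l : List (B × ℝ)) :
    listPair M v l = (l.map fun p => p.2 * gram M v p.1).sum := by
  induction l with
  | nil => rfl
  | cons p l ih => rw [listPair, ih, List.map_cons, List.sum_cons]

theorem listPair_nonpos {v : B} {l : List (B × ℝ)} (hc : ∀ p ∈ l, 0 ≤ p.2) (hv : ∀ p ∈ l, v ≠ p.1) :
    listPair M v l ≤ 0 := by
  induction l with
  | nil => exact le_rfl
  | cons p l ih =>
    have h1 := ih (fun q hq => hc q (by simp [hq])) fun q hq => hv q (by simp [hq])
    have h2 := mul_nonpos_of_nonneg_of_nonpos (hc p (by simp))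
      (gram_nonpos (M := M) (hv p (by simp)))
    rw [listPair]
    linarith

theorem listPair_le {v : B} {l : List (B × ℝ)} (hc : ∀ p ∈ l, 0 ≤ p.2) (hv : ∀ p ∈ l, v ≠ p.1)
    {p : B × ℝ} (hp : p ∈ l) : listPair M v l ≤ p.2 * gram M v p.1 := by
  have hperm := List.perm_cons_erase hp
  rw [listPair_eq_sum, (hperm.map _).sum_eq, List.map_cons, List.sum_cons, ← listPair_eq_sum]
  have := listPair_nonpos (M := M) (v := v) (l := l.erase p)
    (fun q hq => hc q (List.mem_of_mem_erase hq)) (fun q hq => hv q (List.mem_of_mem_erase hq))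
  linarith

theorem listPair_le_two {v : B} {l : List (B × ℝ)} (hc : ∀ p ∈ l, 0 ≤ p.2)
    (hv : ∀ p ∈ l, v ≠ p.1) {p q : B × ℝ} (hp : p ∈ l) (hq : q ∈ l) (hpq : p ≠ q) :
    listPair M v l ≤ p.2 * gram M v p.1 + q.2 * gram M v q.1 := by
  have hperm := List.perm_cons_erase hp
  rw [listPair_eq_sum, (hperm.map _).sum_eq, List.map_cons, List.sum_cons, ← listPair_eq_sum]
  have := listPair_le (M := M) (v := v) (l := l.erase p)
    (fun q hq => hc q (List.mem_of_mem_erase hq)) (fun q hq => hv q (List.mem_of_mem_erase hq))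
    ((List.mem_erase_of_ne hpq.symm).2 hq)
  linarith

/-- Attaching a weighted vertex to a weighted vertex of a list. -/
theorem listForm_cons_le {y v : B} {c d : ℝ} {l : List (B × ℝ)} (hc0 : 0 ≤ c)
    (hc : ∀ p ∈ l, 0 ≤ p.2) (hy : ∀ p ∈ l, y ≠ p.1) (hv : (v, d) ∈ l) :
    listForm M ((y, c) :: l) ≤ c ^ 2 + 2 * (c * (d * gram M y v)) + listForm M l := by
  have := listPair_le (M := M) hc hy hv
  rw [listForm]
  nlinarith [mul_le_mul_of_nonneg_left this hc0]

/-- A path in the Coxeter graph, as a list of vertices. -/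
def IsPath (M : CoxeterMatrix B) (p : List B) : Prop :=
  p.Nodup ∧ p.IsChain fun a b => 3 ≤ M a b

theorem IsPath.of_suffix {p q : List B} (hp : IsPath M p) (h : q <:+ p) : IsPath M q :=
  ⟨hp.1.sublist h.sublist, hp.2.suffix h⟩

theorem IsPath.of_prefix {p q : List B} (hp : IsPath M p) (h : q <+: p) : IsPath M q :=
  ⟨hp.1.sublist h.sublist, hp.2.prefix h⟩

theorem IsPath.tail {p : List B} {a : B} (hp : IsPath M (a :: p)) : IsPath M p :=
  hp.of_suffix (List.suffix_cons a p)

theorem IsPath.reverse {p : List B} (hp : IsPath M p) : IsPath M p.reverse := by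
  refine ⟨List.nodup_reverse.2 hp.1, List.isChain_reverse.2 (hp.2.imp fun a b h => ?_)⟩
  exact three_le_symm h

theorem isPath_cons_cons {a b : B} {p : List B} :
    IsPath M (a :: b :: p) ↔ a ∉ b :: p ∧ 3 ≤ M a b ∧ IsPath M (b :: p) := by
  simp only [IsPath, List.nodup_cons, List.isChain_cons_cons]
  tauto

/-- A path weighted by ones. -/
noncomputable def unitWeights (p : List B) : List (B × ℝ) := p.map fun v => (v, 1)

theorem mem_unitWeights {p : List B} {q : B × ℝ} : q ∈ unitWeights p ↔ q.1 ∈ p ∧ q.2 = 1 := by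
  obtain ⟨v, c⟩ := q
  simp only [unitWeights, List.mem_map, Prod.mk.injEq]
  constructor
  · rintro ⟨a, ha, rfl, rfl⟩
    exact ⟨ha, rfl⟩
  · rintro ⟨h, rfl⟩
    exact ⟨v, h, rfl, rfl⟩

theorem listForm_unitWeights_le {p : List B} (hp : IsPath M p) :
    listForm M (unitWeights p) ≤ 1 := by
  induction p with
  | nil => simp [unitWeights, listForm]
  | cons a p ih =>
    cases p with
    | nil => simp [unitWeights, listForm, listPair]
    | cons b p =>
      obtain ⟨h1, h2, h3⟩ := isPath_cons_cons.1 hp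
      have := listForm_cons_le (M := M) (y := a) (v := b) (c := 1) (d := 1)
        (l := unitWeights (b :: p)) zero_le_one
        (fun q hq => by rw [(mem_unitWeights.1 hq).2]; exact zero_le_one)
        (fun q hq => by rintro rfl; exact h1 (mem_unitWeights.1 hq).1)
        (mem_unitWeights.2 ⟨by simp, rfl⟩)
      have h4 := ih h3
      have h5 := gram_le_half h2
      have : unitWeights (a :: b :: p) = (a, 1) :: unitWeights (b :: p) := rfl
      rw [this]
      linarith

/-- The Coxeter graph of a finite Coxeter group contains no cycles. -/
theorem IsPath.eq_of_adj [Finite W] (cs : CoxeterSystem M W) {p : List B} (hp : IsPath M p)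
    {v a b : B} (hv : v ∉ p) (ha : a ∈ p) (hb : b ∈ p) (hva : 3 ≤ M v a) (hvb : 3 ≤ M v b) :
    a = b := by
  by_contra hab
  have h := listForm_pos cs (l := (v, 1) :: unitWeights p) (by simp) (by
    intro q hq
    rcases List.mem_cons.1 hq with rfl | hq
    · exact one_pos
    · rw [(mem_unitWeights.1 hq).2]
      exact one_pos)
  have h2 := listPair_le_two (M := M) (v := v) (l := unitWeights p)
    (fun q hq => by rw [(mem_unitWeights.1 hq).2]; exact zero_le_one)
    (fun q hq => by rintro rfl; exact hv (mem_unitWeights.1 hq).1)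
    (p := (a, 1)) (q := (b, 1)) (mem_unitWeights.2 ⟨ha, rfl⟩) (mem_unitWeights.2 ⟨hb, rfl⟩)
    (by simpa using hab)
  have h3 := gram_le_half hva
  have h4 := gram_le_half hvb
  have h5 := listForm_unitWeights_le hp
  rw [listForm] at h
  simp only at h h2
  linarith

theorem IsPath.not_adj_of_mem [Finite W] (cs : CoxeterSystem M W) {p : List B} {a b c : B}
    (hp : IsPath M (a :: b :: p)) (hc : c ∈ p) : ¬ 3 ≤ M a c := by
  intro hac
  obtain ⟨h1, h2, h3⟩ := isPath_cons_cons.1 hp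
  have := h3.eq_of_adj cs h1 (by simp) (List.mem_cons_of_mem _ hc) h2 hac
  subst this
  exact (List.nodup_cons.1 h3.1).1 hc

/-- A walk that never turns back immediately is a path. -/
theorem IsPath.cons [Finite W] (cs : CoxeterSystem M W) {p : List B} {a b : B}
    (hp : IsPath M (b :: p)) (hab : 3 ≤ M a b) (hne : ∀ c ∈ p.head?, a ≠ c) :
    IsPath M (a :: b :: p) := by
  refine isPath_cons_cons.2 ⟨fun ha => ?_, hab, hp⟩
  obtain ⟨s, t, hst⟩ := List.append_of_mem ha
  cases s with
  | nil =>
    simp only [List.nil_append, List.cons.injEq] at hst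
    exact ne_of_three_le hab hst.1.symm
  | cons b' s =>
    simp only [List.cons_append, List.cons.injEq] at hst
    obtain ⟨rfl, rfl⟩ := hst
    cases s using List.reverseRecOn with
    | nil => simp at hne
    | append_singleton s c =>
      have hp1 : IsPath M (b :: (s ++ [c])) := hp.of_prefix ⟨a :: t, by simp⟩
      have hca : 3 ≤ M c a := by
        have h1 := hp.2
        rw [show b :: (s ++ [c] ++ a :: t) = (b :: s) ++ c :: a :: t by simp] at h1
        have := (List.IsChain.right_of_append h1)
        exact (List.isChain_cons_cons.1 this).1
      have ha' : a ∉ b :: (s ++ [c]) := by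
        have h1 := hp.1
        rw [show b :: (s ++ [c] ++ a :: t) = (b :: (s ++ [c])) ++ a :: t by simp] at h1
        have := List.disjoint_of_nodup_append h1
        exact fun h => this h (by simp)
      have := hp1.eq_of_adj cs ha' (by simp) (by simp) hab (three_le_symm hca)
      subst this
      have := (List.nodup_cons.1 hp1.1).1
      simp at this

theorem exists_path_of_reflTransGen {R : B → B → Prop} {x y : B} (h : Relation.ReflTransGen R x y) :
    ∃ p : List B, (x :: p).Nodup ∧ (x :: p).IsChain R ∧ (x :: p).getLast (by simp) = y := by
  induction h using Relation.ReflTransGen.head_induction_on with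
  | refl => exact ⟨[], by simp⟩
  | head h _ ih =>
    rename_i a c _
    obtain ⟨p, h1, h2, h3⟩ := ih
    by_cases ha : a ∈ c :: p
    · obtain ⟨s, t, hst⟩ := List.append_of_mem ha
      have hsuf : (a :: t) <:+ (c :: p) := ⟨s, hst.symm⟩
      refine ⟨t, h1.sublist hsuf.sublist, h2.suffix hsuf, ?_⟩
      rw [← h3]
      simp only [hst]
      rw [List.getLast_append_of_right_ne_nil]
    · exact ⟨c :: p, List.nodup_cons.2 ⟨ha, h1⟩, List.isChain_cons_cons.2 ⟨h, h2⟩, by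
        rw [List.getLast_cons (by simp), h3]⟩

theorem exists_path {x y : B} (h : Relation.ReflTransGen (fun a b => 3 ≤ M a b) x y) :
    ∃ p : List B, IsPath M (x :: p) ∧ (x :: p).getLast (by simp) = y := by
  obtain ⟨p, h1, h2, h3⟩ := exists_path_of_reflTransGen h
  exact ⟨p, ⟨h1, h2⟩, h3⟩

theorem listForm_attach_le {p : List B} (hp : IsPath M p) (l : List (B × ℝ × B))
    (hl : ∀ t ∈ l, 0 < t.2.1 ∧ t.2.2 ∈ p ∧ t.1 ∉ p) (hnd : (l.map Prod.fst).Nodup) :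
    listForm M ((l.map fun t => (t.1, t.2.1)) ++ unitWeights p) ≤
      1 + (l.map fun t => t.2.1 ^ 2 + 2 * t.2.1 * gram M t.1 t.2.2).sum := by
  induction l with
  | nil => simpa using listForm_unitWeights_le hp
  | cons t l ih =>
    have h1 := ih (fun t ht => hl t (by simp [ht])) (List.nodup_cons.1 hnd).2
    have h2 := listForm_cons_le (M := M) (y := t.1) (v := t.2.2) (c := t.2.1) (d := 1)
      (l := (l.map fun t => (t.1, t.2.1)) ++ unitWeights p) (hl t (by simp)).1.le ?_ ?_ ?_
    · simp only [List.map_cons, List.cons_append, List.sum_cons]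
      linarith
    · intro q hq
      rcases List.mem_append.1 hq with hq | hq
      · obtain ⟨u, hu, rfl⟩ := List.mem_map.1 hq
        exact (hl u (by simp [hu])).1.le
      · rw [(mem_unitWeights.1 hq).2]
        exact zero_le_one
    · intro q hq
      rcases List.mem_append.1 hq with hq | hq
      · obtain ⟨u, hu, rfl⟩ := List.mem_map.1 hq
        intro h
        exact (List.nodup_cons.1 hnd).1 (List.mem_map.2 ⟨u, hu, h.symm⟩)
      · intro h
        exact (hl t (by simp)).2.2 (h ▸ (mem_unitWeights.1 hq).1)
    · exact List.mem_append_right _ (mem_unitWeights.2 ⟨(hl t (by simp)).2.1, rfl⟩)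

theorem attach_sum_pos [Finite W] (cs : CoxeterSystem M W) {p : List B} (hp : IsPath M p)
    (hp0 : p ≠ []) (l : List (B × ℝ × B))
    (hl : ∀ t ∈ l, 0 < t.2.1 ∧ t.2.2 ∈ p ∧ t.1 ∉ p) (hnd : (l.map Prod.fst).Nodup) :
    0 < 1 + (l.map fun t => t.2.1 ^ 2 + 2 * t.2.1 * gram M t.1 t.2.2).sum := by
  refine lt_of_lt_of_le (listForm_pos cs ?_ ?_) (listForm_attach_le hp l hl hnd)
  · simp [unitWeights, hp0]
  · intro q hq
    rcases List.mem_append.1 hq with hq | hq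
    · obtain ⟨u, hu, rfl⟩ := List.mem_map.1 hq
      exact (hl u hu).1
    · rw [(mem_unitWeights.1 hq).2]
      exact one_pos

end Graph

section Features

/-- Two vertices in the same component of the Coxeter graph. -/
abbrev Linked (M : CoxeterMatrix B) : B → B → Prop := Relation.ReflTransGen fun a b => 3 ≤ M a b

/-- A vertex with at least three neighbours in the Coxeter graph. -/
def IsBranch (M : CoxeterMatrix B) (x : B) : Prop :=
  ∃ a b c, a ≠ b ∧ a ≠ c ∧ b ≠ c ∧ 3 ≤ M x a ∧ 3 ≤ M x b ∧ 3 ≤ M x c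

theorem sqrt_attach_le {i j : B} (h : 4 ≤ M i j) :
    (√2 / 2) ^ 2 + 2 * (√2 / 2) * gram M i j ≤ -(1 / 2) := by
  have h1 := gram_le_sqrt h
  have h2 : √2 * √2 = 2 := Real.mul_self_sqrt (by norm_num)
  have h3 : 0 ≤ √2 := Real.sqrt_nonneg 2
  nlinarith [mul_le_mul_of_nonneg_left h1 h3]

theorem half_attach_le {i j : B} (h : 3 ≤ M i j) :
    (1 / 2) ^ 2 + 2 * (1 / 2) * gram M i j ≤ -(1 / 4) := by
  have h1 := gram_le_half h
  linarith

theorem exists_path_head_getLast {x y : B} (h : Linked M x y) :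
    ∃ p : List B, IsPath M p ∧ p.head? = some x ∧ p.getLast? = some y := by
  obtain ⟨p, hp, hlast⟩ := exists_path h
  exact ⟨x :: p, hp, rfl, by rw [List.getLast?_eq_getLast_of_ne_nil (by simp), hlast]⟩

theorem IsPath.exists_suffix_avoiding [Finite W] (cs : CoxeterSystem M W) {p : List B} {x y : B}
    (hp : IsPath M p) (hx : p.head? = some x) (hxy : 3 ≤ M x y) :
    ∃ x' y' q, (x' = x ∧ y' = y ∨ x' = y ∧ y' = x) ∧ q <:+ p ∧ q.head? = some x' ∧
      q.getLast? = p.getLast? ∧ y' ∉ q := by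
  by_cases hy : y ∈ p
  · obtain _ | ⟨a, p⟩ := p
    · simp at hx
    obtain rfl : a = x := by simpa using hx
    obtain _ | ⟨b, p⟩ := p
    · simp only [List.mem_singleton] at hy
      exact absurd hy.symm (ne_of_three_le hxy)
    obtain rfl : y = b := by
      by_contra hyb
      have hya := (ne_of_three_le hxy).symm
      exact hp.not_adj_of_mem cs (by simpa [hya, hyb] using hy) hxy
    exact ⟨y, a, y :: p, Or.inr ⟨rfl, rfl⟩, List.suffix_cons _ _, rfl, by simp,
      (isPath_cons_cons.1 hp).1⟩
  · exact ⟨x, y, p, Or.inl ⟨rfl, rfl⟩, List.suffix_rfl, hx, rfl, hy⟩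

theorem ne_nil_of_head? {p : List B} {x : B} (h : p.head? = some x) : p ≠ [] := by
  rintro rfl
  simp at h

/-- A component contains at most one edge with a label at least four. -/
theorem heavy_edge_unique [Finite W] (cs : CoxeterSystem M W) {x y u v : B} (hxy : 4 ≤ M x y)
    (huv : 4 ≤ M u v) (h : Linked M x u) : x = u ∧ y = v ∨ x = v ∧ y = u := by
  obtain ⟨p, hp, hpx, hpu⟩ := exists_path_head_getLast h
  obtain ⟨x', y', q, hxy', hq, hqx, hqu, hyq⟩ :=
    hp.exists_suffix_avoiding cs hpx ((by norm_num : 3 ≤ 4).trans hxy)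
  obtain ⟨u', v', r, huv', hr, hru, hrx, hvr⟩ :=
    (hp.of_suffix hq).reverse.exists_suffix_avoiding cs (x := u) (y := v)
      (by rw [List.head?_reverse, hqu, hpu]) ((by norm_num : 3 ≤ 4).trans huv)
  have hrp : IsPath M r := (hp.of_suffix hq).reverse.of_suffix hr
  have hyr : y' ∉ r := fun h => hyq (List.mem_reverse.1 (hr.subset h))
  rw [List.getLast?_reverse, hqx] at hrx
  have hxr : x' ∈ r := List.mem_of_getLast? hrx
  have hur : u' ∈ r := List.mem_of_head? hru
  have h1 : 4 ≤ M y' x' := by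
    rcases hxy' with ⟨rfl, rfl⟩ | ⟨rfl, rfl⟩
    · rwa [M.symmetric]
    · exact hxy
  have h2 : 4 ≤ M v' u' := by
    rcases huv' with ⟨rfl, rfl⟩ | ⟨rfl, rfl⟩
    · rwa [M.symmetric]
    · exact huv
  by_cases hyv : y' = v'
  · subst hyv
    obtain rfl := hrp.eq_of_adj cs hyr hxr hur (by omega) (by omega)
    rcases hxy' with ⟨rfl, rfl⟩ | ⟨rfl, rfl⟩ <;> rcases huv' with ⟨rfl, rfl⟩ | ⟨rfl, rfl⟩ <;> simp
  · exfalso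
    have := attach_sum_pos cs hrp (ne_nil_of_head? hru) [(y', √2 / 2, x'), (v', √2 / 2, u')]
      (by simp [hxr, hur, hyr, hvr]) (by simp [hyv])
    simp only [List.map_cons, List.map_nil, List.sum_cons, List.sum_nil] at this
    have h3 := sqrt_attach_le h1
    have h4 := sqrt_attach_le h2
    linarith

theorem IsBranch.exists_two_ne {x : B} (h : IsBranch M x) (e : B) :
    ∃ y z, y ≠ z ∧ 3 ≤ M x y ∧ 3 ≤ M x z ∧ y ≠ e ∧ z ≠ e := by
  obtain ⟨a, b, c, hab, hac, hbc, ha, hb, hc⟩ := h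
  by_cases h1 : a = e
  · exact ⟨b, c, hbc, hb, hc, fun h => hab (h1.trans h.symm), fun h => hac (h1.trans h.symm)⟩
  by_cases h2 : b = e
  · exact ⟨a, c, hac, ha, hc, h1, fun h => hbc (h2.trans h.symm)⟩
  · exact ⟨a, b, hab, ha, hb, h1, h2⟩

theorem IsBranch.exists_two_avoiding [Finite W] (cs : CoxeterSystem M W) {x : B}
    (h : IsBranch M x) {p : List B} (hp : IsPath M p) (hx : p.head? = some x) (e : B) :
    ∃ y z, y ≠ z ∧ 3 ≤ M x y ∧ 3 ≤ M x z ∧ y ∉ p ∧ z ∉ p ∧ (p = [x] → y ≠ e ∧ z ≠ e) := by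
  obtain _ | ⟨a, p⟩ := p
  · simp at hx
  obtain rfl : a = x := by simpa using hx
  obtain _ | ⟨b, p⟩ := p
  · obtain ⟨y, z, hyz, hy, hz, hye, hze⟩ := h.exists_two_ne e
    exact ⟨y, z, hyz, hy, hz, by simpa using (ne_of_three_le hy).symm,
      by simpa using (ne_of_three_le hz).symm, fun _ => ⟨hye, hze⟩⟩
  · obtain ⟨y, z, hyz, hy, hz, hyb, hzb⟩ := h.exists_two_ne b
    have key : ∀ y, 3 ≤ M a y → y ≠ b → y ∉ a :: b :: p := by
      intro y hy hyb hmem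
      have hya := (ne_of_three_le hy).symm
      exact hp.not_adj_of_mem cs (by simpa [hya, hyb] using hmem) hy
    exact ⟨y, z, hyz, hy, hz, key y hy hyb, key z hz hzb, by simp⟩

/-- A component contains at most one branch vertex. -/
theorem IsBranch.unique [Finite W] (cs : CoxeterSystem M W) {x u : B} (hx : IsBranch M x)
    (hu : IsBranch M u) (h : Linked M x u) : x = u := by
  by_contra hxu
  obtain ⟨p, hp, hpx, hpu⟩ := exists_path_head_getLast h
  obtain ⟨y, z, hyz, hy, hz, hyp, hzp, -⟩ := hx.exists_two_avoiding cs hp hpx x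
  obtain ⟨s, t, hst, hs, ht, hsp, htp, -⟩ := hu.exists_two_avoiding cs hp.reverse
    (by rw [List.head?_reverse, hpu]) u
  rw [List.mem_reverse] at hsp htp
  have hxp := List.mem_of_head? hpx
  have hup := List.mem_of_getLast? hpu
  have key : ∀ y s, y ∉ p → 3 ≤ M x y → 3 ≤ M u s → y ≠ s := by
    rintro y _ hyp h1 h2 rfl
    exact hxu (hp.eq_of_adj cs hyp hxp hup (three_le_symm h1) (three_le_symm h2))
  have := attach_sum_pos cs hp (ne_nil_of_head? hpx)
    [(y, 1 / 2, x), (z, 1 / 2, x), (s, 1 / 2, u), (t, 1 / 2, u)]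
    (by simp [hxp, hup, hyp, hzp, hsp, htp])
    (by simp [hyz, hst, key y s hyp hy hs, key y t hyp hy ht, key z s hzp hz hs, key z t hzp hz ht])
  simp only [List.map_cons, List.map_nil, List.sum_cons, List.sum_nil] at this
  have h1 := half_attach_le (three_le_symm hy)
  have h2 := half_attach_le (three_le_symm hz)
  have h3 := half_attach_le (three_le_symm hs)
  have h4 := half_attach_le (three_le_symm ht)
  linarith

theorem eq_singleton_of_head?_getLast? {p : List B} {x : B} (hp : p.Nodup)
    (h1 : p.head? = some x) (h2 : p.getLast? = some x) : p = [x] := by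
  obtain _ | ⟨a, p⟩ := p
  · simp at h1
  obtain rfl : a = x := by simpa using h1
  obtain _ | ⟨b, p⟩ := p
  · rfl
  · rw [List.getLast?_cons_cons] at h2
    exact absurd (List.mem_of_getLast? h2) (List.nodup_cons.1 hp).1

/-- A component with a branch vertex is simply laced. -/
theorem IsBranch.not_heavy [Finite W] (cs : CoxeterSystem M W) {x u v : B} (hx : IsBranch M x)
    (h : Linked M x u) : ¬ 4 ≤ M u v := by
  intro huv
  obtain ⟨p, hp, hpx, hpu⟩ := exists_path_head_getLast h
  obtain ⟨u', v', r, huv', hr, hru, hrx, hvr⟩ :=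
    hp.reverse.exists_suffix_avoiding cs (x := u) (y := v)
      (by rw [List.head?_reverse, hpu]) ((by norm_num : 3 ≤ 4).trans huv)
  have hrp : IsPath M r := hp.reverse.of_suffix hr
  rw [List.getLast?_reverse, hpx] at hrx
  have h2 : 4 ≤ M v' u' := by
    rcases huv' with ⟨rfl, rfl⟩ | ⟨rfl, rfl⟩
    · rwa [M.symmetric]
    · exact huv
  obtain ⟨y, z, hyz, hy, hz, hyp, hzp, he⟩ := hx.exists_two_avoiding cs hrp.reverse
    (by rw [List.head?_reverse, hrx]) v'
  rw [List.mem_reverse] at hyp hzp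
  have hxr := List.mem_of_getLast? hrx
  have hur := List.mem_of_head? hru
  have key : ∀ y, 3 ≤ M x y → (r = [x] → y ≠ v') → v' ≠ y := by
    rintro _ hy hne rfl
    have := hrp.eq_of_adj cs hvr hxr hur (three_le_symm hy) (by omega)
    subst this
    exact hne (eq_singleton_of_head?_getLast? hrp.1 hru hrx) rfl
  have he' : r = [x] → y ≠ v' ∧ z ≠ v' := fun h => he (by rw [h]; rfl)
  have := attach_sum_pos cs hrp (ne_nil_of_head? hru)
    [(v', √2 / 2, u'), (y, 1 / 2, x), (z, 1 / 2, x)]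
    (by simp [hxr, hur, hvr, hyp, hzp])
    (by simp [hyz, key y hy fun h => (he' h).1, key z hz fun h => (he' h).2])
  simp only [List.map_cons, List.map_nil, List.sum_cons, List.sum_nil] at this
  have h1 := half_attach_le (three_le_symm hy)
  have h3 := half_attach_le (three_le_symm hz)
  have h4 := sqrt_attach_le h2
  linarith

/-- No vertex has four neighbours. -/
theorem eq_or_eq_of_adj_of_branch [Finite W] (cs : CoxeterSystem M W) {x a b c d : B}
    (hab : a ≠ b) (hac : a ≠ c) (hbc : b ≠ c) (ha : 3 ≤ M x a) (hb : 3 ≤ M x b) (hc : 3 ≤ M x c)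
    (hd : 3 ≤ M x d) : d = a ∨ d = b ∨ d = c := by
  by_contra! h
  have := attach_sum_pos cs (p := [x]) ⟨by simp, by simp⟩ (by simp)
    [(d, 1 / 2, x), (a, 1 / 2, x), (b, 1 / 2, x), (c, 1 / 2, x)]
    (by simp [(ne_of_three_le ha).symm, (ne_of_three_le hb).symm, (ne_of_three_le hc).symm,
      (ne_of_three_le hd).symm])
    (by simp [h, hab, hac, hbc])
  simp only [List.map_cons, List.map_nil, List.sum_cons, List.sum_nil] at this
  have h1 := half_attach_le (three_le_symm ha)
  have h2 := half_attach_le (three_le_symm hb)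
  have h3 := half_attach_le (three_le_symm hc)
  have h4 := half_attach_le (three_le_symm hd)
  linarith

theorem not_path_five [Finite W] (cs : CoxeterSystem M W) {z x y w : B}
    (hp : IsPath M [z, x, y, w]) : ¬ 5 ≤ M x y := by
  intro hxy
  have h := hp.1
  have h2 := hp.2
  simp at h h2
  have h3 := listForm_cons_le (M := M) (y := z) (v := x) (c := 1) (d := 2)
    (l := [(w, 1), (y, 2), (x, 2)]) (by simp) (by simp) (by simp; tauto) (by simp)
  have h4 := listForm_cons_le (M := M) (y := w) (v := y) (c := 1) (d := 2)
    (l := [(y, 2), (x, 2)]) (by simp) (by simp) (by simp; tauto) (by simp)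
  have h5 := listForm_cons_le (M := M) (y := y) (v := x) (c := 2) (d := 2)
    (l := [(x, 2)]) (by simp) (by simp) (by simp; tauto) (by simp)
  have h6 : listForm M [(x, 2)] = 4 := by simp [listForm, listPair]; norm_num
  have h7 := listForm_pos cs (l := [(z, 1), (w, 1), (y, 2), (x, 2)]) (by simp) (by simp)
  have g1 := gram_le_half h2.1
  have g2 := gram_le_half (three_le_symm h2.2.2)
  have g3 := gram_le_five (by rwa [M.symmetric] : 5 ≤ M y x)
  linarith

/-- The affine diagram of type `E₆` does not occur. -/
theorem false_of_affine_six [Finite W] (cs : CoxeterSystem M W) {x a b c a' b' c' : B}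
    (hab : a ≠ b) (hac : a ≠ c) (hbc : b ≠ c) (ha : 3 ≤ M x a) (hb : 3 ≤ M x b) (hc : 3 ≤ M x c)
    (ha' : 3 ≤ M a a') (hb' : 3 ≤ M b b') (hc' : 3 ≤ M c c') (hax : a' ≠ x) (hbx : b' ≠ x)
    (hcx : c' ≠ x) : False := by
  have path : ∀ a b a' b', a ≠ b → 3 ≤ M x a → 3 ≤ M x b → 3 ≤ M a a' → 3 ≤ M b b' → a' ≠ x →
      b' ≠ x → [a', a, x, b, b'].Nodup := by
    intro a b a' b' hab ha hb ha' hb' hax hbx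
    have h1 : IsPath M [b, b'] := ⟨by simpa using ne_of_three_le hb', by simpa using hb'⟩
    have h2 := (h1.cons cs hb (by simpa using hbx.symm)).cons cs (three_le_symm ha)
      (by simpa using hab)
    exact (h2.cons cs (three_le_symm ha') (by simpa using hax)).1
  have p1 := path a b a' b' hab ha hb ha' hb' hax hbx
  have p2 := path a c a' c' hac ha hc ha' hc' hax hcx
  have p3 := path b c b' c' hbc hb hc hb' hc' hbx hcx
  simp at p1 p2 p3
  have h1 := listForm_cons_le (M := M) (y := a') (v := a) (c := 1) (d := 2)
    (l := [(a, 2), (b', 1), (b, 2), (c', 1), (c, 2), (x, 3)]) (by simp) (by simp)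
    (by simp; grind) (by simp)
  have h2 := listForm_cons_le (M := M) (y := a) (v := x) (c := 2) (d := 3)
    (l := [(b', 1), (b, 2), (c', 1), (c, 2), (x, 3)]) (by simp) (by simp)
    (by simp; grind) (by simp)
  have h3 := listForm_cons_le (M := M) (y := b') (v := b) (c := 1) (d := 2)
    (l := [(b, 2), (c', 1), (c, 2), (x, 3)]) (by simp) (by simp)
    (by simp; grind) (by simp)
  have h4 := listForm_cons_le (M := M) (y := b) (v := x) (c := 2) (d := 3)
    (l := [(c', 1), (c, 2), (x, 3)]) (by simp) (by simp)
    (by simp; grind) (by simp)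
  have h5 := listForm_cons_le (M := M) (y := c') (v := c) (c := 1) (d := 2)
    (l := [(c, 2), (x, 3)]) (by simp) (by simp)
    (by simp; grind) (by simp)
  have h6 := listForm_cons_le (M := M) (y := c) (v := x) (c := 2) (d := 3)
    (l := [(x, 3)]) (by simp) (by simp)
    (by simp; grind) (by simp)
  have h7 : listForm M [(x, 3)] = 9 := by simp [listForm, listPair]; norm_num
  have h8 := listForm_pos cs
    (l := [(a', 1), (a, 2), (b', 1), (b, 2), (c', 1), (c, 2), (x, 3)]) (by simp) (by simp)
  have g1 := gram_le_half (three_le_symm ha)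
  have g2 := gram_le_half (three_le_symm hb)
  have g3 := gram_le_half (three_le_symm hc)
  have g4 := gram_le_half (three_le_symm ha')
  have g5 := gram_le_half (three_le_symm hb')
  have g6 := gram_le_half (three_le_symm hc')
  linarith

/-- The affine diagram of type `E₇` does not occur. -/
theorem false_of_affine_seven [Finite W] (cs : CoxeterSystem M W) {x a b c a' b' a'' b'' : B}
    (hab : a ≠ b) (hac : a ≠ c) (hbc : b ≠ c) (ha : 3 ≤ M x a) (hb : 3 ≤ M x b) (hc : 3 ≤ M x c)
    (ha' : 3 ≤ M a a') (hb' : 3 ≤ M b b') (ha'' : 3 ≤ M a' a'') (hb'' : 3 ≤ M b' b'')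
    (hax : a' ≠ x) (hbx : b' ≠ x) (haa : a'' ≠ a) (hbb : b'' ≠ b) : False := by
  have arm : ∀ b b' b'', 3 ≤ M x b → 3 ≤ M b b' → 3 ≤ M b' b'' → b' ≠ x → b'' ≠ b →
      IsPath M [x, b, b', b''] := by
    intro b b' b'' hb hb' hb'' hbx hbb
    have h1 : IsPath M [b', b''] := ⟨by simpa using ne_of_three_le hb'', by simpa using hb''⟩
    exact (h1.cons cs hb' (by simpa using hbb.symm)).cons cs hb (by simpa using hbx.symm)
  have p1 := (((arm b b' b'' hb hb' hb'' hbx hbb).cons cs (three_le_symm ha)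
    (by simpa using hab)).cons cs (three_le_symm ha') (by simpa using hax)).cons cs
    (three_le_symm ha'') (by simpa using haa)
  have p2 := (arm b b' b'' hb hb' hb'' hbx hbb).cons cs (three_le_symm hc)
    (by simpa using hbc.symm)
  have p3 := (arm a a' a'' ha ha' ha'' hax haa).cons cs (three_le_symm hc)
    (by simpa using hac.symm)
  replace p1 := p1.1
  replace p2 := p2.1
  replace p3 := p3.1
  simp at p1 p2 p3
  have h1 := listForm_cons_le (M := M) (y := a'') (v := a') (c := 1) (d := 2)
    (l := [(a', 2), (a, 3), (b'', 1), (b', 2), (b, 3), (c, 2), (x, 4)]) (by simp) (by simp)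
    (by simp; grind) (by simp)
  have h2 := listForm_cons_le (M := M) (y := a') (v := a) (c := 2) (d := 3)
    (l := [(a, 3), (b'', 1), (b', 2), (b, 3), (c, 2), (x, 4)]) (by simp) (by simp)
    (by simp; grind) (by simp)
  have h3 := listForm_cons_le (M := M) (y := a) (v := x) (c := 3) (d := 4)
    (l := [(b'', 1), (b', 2), (b, 3), (c, 2), (x, 4)]) (by simp) (by simp)
    (by simp; grind) (by simp)
  have h4 := listForm_cons_le (M := M) (y := b'') (v := b') (c := 1) (d := 2)
    (l := [(b', 2), (b, 3), (c, 2), (x, 4)]) (by simp) (by simp)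
    (by simp; grind) (by simp)
  have h5 := listForm_cons_le (M := M) (y := b') (v := b) (c := 2) (d := 3)
    (l := [(b, 3), (c, 2), (x, 4)]) (by simp) (by simp)
    (by simp; grind) (by simp)
  have h6 := listForm_cons_le (M := M) (y := b) (v := x) (c := 3) (d := 4)
    (l := [(c, 2), (x, 4)]) (by simp) (by simp)
    (by simp; grind) (by simp)
  have h7 := listForm_cons_le (M := M) (y := c) (v := x) (c := 2) (d := 4)
    (l := [(x, 4)]) (by simp) (by simp)
    (by simp; grind) (by simp)
  have h8 : listForm M [(x, 4)] = 16 := by simp [listForm, listPair]; norm_num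
  have h9 := listForm_pos cs
    (l := [(a'', 1), (a', 2), (a, 3), (b'', 1), (b', 2), (b, 3), (c, 2), (x, 4)])
    (by simp) (by simp)
  have g1 := gram_le_half (three_le_symm ha)
  have g2 := gram_le_half (three_le_symm hb)
  have g3 := gram_le_half (three_le_symm hc)
  have g4 := gram_le_half (three_le_symm ha')
  have g5 := gram_le_half (three_le_symm hb')
  have g6 := gram_le_half (three_le_symm ha'')
  have g7 := gram_le_half (three_le_symm hb'')
  linarith

end Features

/-! ### Normal forms up to conjugacy for chains of involutions -/

section Chains

variable {G : Type*} [Group G]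

/-- The subgroup generated by the members of a list. -/
def listClosure (l : List G) : Subgroup G := Subgroup.closure {g | g ∈ l}

theorem mem_listClosure {l : List G} {g : G} (h : g ∈ l) : g ∈ listClosure l :=
  Subgroup.subset_closure h

theorem listClosure_mono {l m : List G} (h : l ⊆ m) : listClosure l ≤ listClosure m :=
  Subgroup.closure_mono h

theorem listClosure_nil : listClosure ([] : List G) = ⊥ := by simp [listClosure]

theorem commute_of_mem_listClosure {l : List G} {s x : G} (h : ∀ y ∈ l, Commute s y)
    (hx : x ∈ listClosure l) : Commute s x := by
  have : listClosure l ≤ Subgroup.centralizer {s} :=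
    (Subgroup.closure_le _).2 fun y hy => Subgroup.mem_centralizer_singleton_iff.2 (h y hy).eq.symm
  exact (Subgroup.mem_centralizer_singleton_iff.1 (this hx)).symm

theorem prod_reverse_mem_listClosure (l : List G) : l.reverse.prod ∈ listClosure l :=
  Subgroup.list_prod_mem _ fun _ hx => mem_listClosure (List.mem_reverse.1 hx)

/-- A set containing `1` and stable under right multiplication by the generators (all of finite
order two) contains the group they generate. -/
theorem listClosure_induction {l : List G} {p : G → Prop} (one : p 1)
    (hl : ∀ s ∈ l, s * s = 1) (mul : ∀ g, p g → ∀ s ∈ l, p (g * s)) {g : G}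
    (hg : g ∈ listClosure l) : p g := by
  induction hg using Subgroup.closure_induction_right with
  | one => exact one
  | mul_right x hx y hy ih => exact mul x ih y hy
  | mul_inv_cancel x hx y hy ih =>
    rw [inv_eq_of_mul_eq_one_left (hl y hy)]
    exact mul x ih y hy

/-- Involutions satisfying the relations of type `A`. -/
def IsChainA : List G → Prop
  | [] => True
  | s :: l => s * s = 1 ∧ IsChainA l ∧ (∀ x ∈ l.tail, Commute s x) ∧
      ∀ t ∈ l.head?, s * t * s = t * s * t

theorem IsChainA.sq_eq_one {l : List G} (hl : IsChainA l) : ∀ s ∈ l, s * s = 1 := by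
  induction l with
  | nil => simp
  | cons s l ih =>
    intro t ht
    rcases List.mem_cons.1 ht with rfl | ht
    exacts [hl.1, ih hl.2.1 t ht]

theorem IsChainA.double_coset {s : G} {l : List G} (h : IsChainA (s :: l)) {g : G}
    (hg : g ∈ listClosure (s :: l)) :
    g ∈ listClosure l ∨ ∃ a ∈ listClosure l, ∃ b ∈ listClosure l, g = a * s * b := by
  induction l generalizing s g with
  | nil =>
    refine listClosure_induction (p := fun g => g ∈ listClosure [] ∨ ∃ a ∈ listClosure [],
      ∃ b ∈ listClosure [], g = a * s * b) (Or.inl (one_mem _)) h.sq_eq_one ?_ hg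
    simp only [listClosure_nil, Subgroup.mem_bot, List.mem_singleton]
    rintro g (rfl | ⟨a, rfl, b, rfl, rfl⟩) t rfl
    · exact Or.inr ⟨1, rfl, 1, rfl, by simp⟩
    · exact Or.inl (by simpa using h.1)
  | cons t l ih =>
    refine listClosure_induction (p := fun g => g ∈ listClosure (t :: l) ∨
      ∃ a ∈ listClosure (t :: l), ∃ b ∈ listClosure (t :: l), g = a * s * b)
      (Or.inl (one_mem _)) h.sq_eq_one ?_ hg
    obtain ⟨hs, hl, hcomm, hbraid⟩ := h
    have hbraid := hbraid t rfl
    have hsub : listClosure l ≤ listClosure (t :: l) :=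
      listClosure_mono (List.subset_cons_self t l)
    have htm : t ∈ listClosure (t :: l) := mem_listClosure (by simp)
    rintro g hg u hu
    rcases List.mem_cons.1 hu with rfl | hu
    · rcases hg with hg | ⟨a, ha, b, hb, rfl⟩
      · exact Or.inr ⟨g, hg, 1, one_mem _, by simp⟩
      · rcases ih hl hb with hb | ⟨c, hc, d, hd, rfl⟩
        · left
          have := (commute_of_mem_listClosure hcomm hb).eq
          rw [mul_assoc, ← this, mul_assoc, ← mul_assoc u, hs, one_mul]
          exact mul_mem ha (hsub hb)
        · right
          have h1 := (commute_of_mem_listClosure hcomm hc).eq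
          have h2 := (commute_of_mem_listClosure hcomm hd).eq
          refine ⟨a * c * t, mul_mem (mul_mem ha (hsub hc)) htm, t * d,
            mul_mem htm (hsub hd), ?_⟩
          calc a * u * (c * t * d) * u = a * (u * c) * t * (d * u) := by group
            _ = a * c * (u * t * u) * d := by rw [h1, ← h2]; group
            _ = _ := by rw [hbraid]; group
    · rcases hg with hg | ⟨a, ha, b, hb, rfl⟩
      · exact Or.inl (mul_mem hg (mem_listClosure hu))
      · exact Or.inr ⟨a, ha, b * u, mul_mem hb (mem_listClosure hu), by group⟩

/-- Every element generated by a chain of type `A` is conjugate to a product along an initial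
segment of the chain, up to elements of the parabolic subgroup two steps further on. -/
theorem IsChainA.exists_conj {L : List G} (hL : IsChainA L) {w : G} (hw : w ∈ listClosure L) :
    ∃ u ∈ listClosure L.tail, ∃ pre post : List G, L = pre ++ post ∧
      ∃ x ∈ listClosure post.tail, u * w * u⁻¹ = x * pre.reverse.prod := by
  induction L generalizing w with
  | nil => exact ⟨1, one_mem _, [], [], rfl, w, hw, by simp⟩
  | cons s l ih =>
    rcases hL.double_coset hw with hw | ⟨a, ha, b, hb, rfl⟩
    · exact ⟨1, one_mem _, [], s :: l, rfl, w, hw, by simp⟩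
    · obtain ⟨u, hu, pre, post, rfl, x, hx, h⟩ := ih hL.2.1 (mul_mem hb ha)
      have hu' := listClosure_mono (List.tail_subset (pre ++ post)) hu
      refine ⟨u * b, mul_mem hu' hb, s :: pre, post, rfl, x, hx, ?_⟩
      have hcomm := (commute_of_mem_listClosure hL.2.2.1 (inv_mem hu)).eq
      rw [List.reverse_cons, List.prod_append, List.prod_singleton, ← mul_assoc x, ← h]
      simp only [mul_inv_rev, mul_assoc, mul_inv_cancel_left]
      rw [hcomm]

/-- Involutions satisfying the relations of type `B`, the double bond being at the end. -/
def IsChainB : List G → Prop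
  | [] => False
  | [t] => t * t = 1
  | s :: r :: m => s * s = 1 ∧ IsChainB (r :: m) ∧ (∀ x ∈ m, Commute s x) ∧
      (m = [] → Commute (s * r * s) r) ∧ (m ≠ [] → s * r * s = r * s * r)

/-- The conjugate of the last element of a list by the preceding ones. -/
def lastConj : List G → G
  | [] => 1
  | [t] => t
  | s :: r :: m => s * lastConj (r :: m) * s

theorem IsChainB.sq_eq_one {l : List G} (hl : IsChainB l) : ∀ s ∈ l, s * s = 1 := by
  induction l with
  | nil => simp
  | cons s l ih =>
    intro t ht
    cases l with
    | nil =>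
      rw [List.mem_singleton] at ht
      rw [ht]
      exact hl
    | cons r m =>
      rcases List.mem_cons.1 ht with rfl | ht
      exacts [hl.1, ih hl.2.1 t ht]

theorem lastConj_mem (l : List G) : lastConj l ∈ listClosure l := by
  induction l with
  | nil => exact one_mem _
  | cons s l ih =>
    cases l with
    | nil => exact mem_listClosure (by simp [lastConj])
    | cons r m =>
      have hs : s ∈ listClosure (s :: r :: m) := mem_listClosure (by simp)
      exact mul_mem (mul_mem hs (listClosure_mono (List.subset_cons_self s _) ih)) hs

theorem IsChainB.commute_lastConj {l : List G} (hl : IsChainB l) {x : G}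
    (hx : x ∈ listClosure l.tail) : Commute (lastConj l) x := by
  induction l generalizing x with
  | nil => exact hl.elim
  | cons s l ih =>
    refine commute_of_mem_listClosure ?_ hx
    intro g hg
    cases l with
    | nil => simp at hg
    | cons r m =>
      obtain ⟨hs, hl', hcomm, hend, hbraid⟩ := hl
      have aux : ∀ y, Commute s y → Commute (lastConj (r :: m)) y →
          Commute (lastConj (s :: r :: m)) y := fun y h1 h2 => (h1.mul_left h2).mul_left h1
      rcases List.mem_cons.1 hg with rfl | hg
      · cases m with
        | nil => exact hend rfl
        | cons q m =>
          have hb := hbraid (by simp)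
          have hsT : s * lastConj (q :: m) = lastConj (q :: m) * s :=
            commute_of_mem_listClosure hcomm (lastConj_mem (q :: m))
          change s * (g * lastConj (q :: m) * g) * s * g =
            g * (s * (g * lastConj (q :: m) * g) * s)
          calc s * (g * lastConj (q :: m) * g) * s * g
              = s * g * lastConj (q :: m) * (g * s * g) := by group
            _ = s * g * (lastConj (q :: m) * s) * g * s := by rw [← hb]; group
            _ = (s * g * s) * lastConj (q :: m) * g * s := by rw [← hsT]; group
            _ = _ := by rw [hb]; group
      · exact aux g (hcomm g hg) (ih hl' (mem_listClosure hg))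

theorem IsChainB.double_coset {s r : G} {m : List G} (h : IsChainB (s :: r :: m)) {g : G}
    (hg : g ∈ listClosure (s :: r :: m)) :
    g ∈ listClosure (r :: m) ∨
      (∃ a ∈ listClosure (r :: m), ∃ b ∈ listClosure (r :: m), g = a * s * b) ∨
      ∃ a ∈ listClosure (r :: m), g = a * lastConj (s :: r :: m) := by
  induction m generalizing s r g with
  | nil =>
    have hT := fun x hx => h.commute_lastConj (x := x) hx
    refine listClosure_induction (p := fun g => g ∈ listClosure [r] ∨
      (∃ a ∈ listClosure [r], ∃ b ∈ listClosure [r], g = a * s * b) ∨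
      ∃ a ∈ listClosure [r], g = a * lastConj [s, r]) (Or.inl (one_mem _)) h.sq_eq_one ?_ hg
    have hr2 : r * r = 1 := h.sq_eq_one r (by simp)
    obtain ⟨hs, hr, hcomm, hend, hbraid⟩ := h
    have hrm : r ∈ listClosure [r] := mem_listClosure (by simp)
    rintro g hg t ht
    rw [List.mem_cons, List.mem_singleton] at ht
    rcases ht with rfl | rfl
    · rcases hg with hg | ⟨a, ha, b, hb, rfl⟩ | ⟨a, ha, rfl⟩
      · exact Or.inr (Or.inl ⟨g, hg, 1, one_mem _, by simp⟩)
      · have hb' : b = 1 ∨ b = r := by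
          refine listClosure_induction (p := fun b => b = 1 ∨ b = r) (Or.inl rfl)
            (by simp [hr2]) ?_ hb
          rintro g (rfl | rfl) q hq
          · right; simpa using hq
          · left
            rw [List.mem_singleton.1 hq, hr2]
        rcases hb' with rfl | rfl
        · left; rw [mul_one, mul_assoc, hs, mul_one]; exact ha
        · right; right
          exact ⟨a, ha, by simp [lastConj, mul_assoc]⟩
      · refine Or.inr (Or.inl ⟨a, ha, r, hrm, ?_⟩)
        simp [lastConj, mul_assoc, hs]
    · rcases hg with hg | ⟨a, ha, b, hb, rfl⟩ | ⟨a, ha, rfl⟩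
      · exact Or.inl (mul_mem hg hrm)
      · exact Or.inr (Or.inl ⟨a, ha, b * t, mul_mem hb hrm, by group⟩)
      · refine Or.inr (Or.inr ⟨a * t, mul_mem ha hrm, ?_⟩)
        rw [mul_assoc, (hT t hrm).eq, mul_assoc]
  | cons q m ih =>
    have hT := fun x hx => h.commute_lastConj (x := x) hx
    refine listClosure_induction (p := fun g => g ∈ listClosure (r :: q :: m) ∨
      (∃ a ∈ listClosure (r :: q :: m), ∃ b ∈ listClosure (r :: q :: m), g = a * s * b) ∨
      ∃ a ∈ listClosure (r :: q :: m), g = a * lastConj (s :: r :: q :: m))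
      (Or.inl (one_mem _)) h.sq_eq_one ?_ hg
    obtain ⟨hs, hl, hcomm, hend, hbraid⟩ := h
    have hbraid := hbraid (by simp)
    have hsub : listClosure (q :: m) ≤ listClosure (r :: q :: m) :=
      listClosure_mono (List.subset_cons_self r _)
    have hrm : r ∈ listClosure (r :: q :: m) := mem_listClosure (by simp)
    rintro g hg t ht
    rcases List.mem_cons.1 ht with rfl | ht
    · rcases hg with hg | ⟨a, ha, b, hb, rfl⟩ | ⟨a, ha, rfl⟩
      · exact Or.inr (Or.inl ⟨g, hg, 1, one_mem _, by simp⟩)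
      · rcases ih hl hb with hb | ⟨c, hc, d, hd, rfl⟩ | ⟨c, hc, rfl⟩
        · left
          have := (commute_of_mem_listClosure hcomm hb).eq
          rw [mul_assoc, ← this, mul_assoc, ← mul_assoc t, hs, one_mul]
          exact mul_mem ha (hsub hb)
        · right; left
          have h1 := (commute_of_mem_listClosure hcomm hc).eq
          have h2 := (commute_of_mem_listClosure hcomm hd).eq
          refine ⟨a * c * r, mul_mem (mul_mem ha (hsub hc)) hrm, r * d,
            mul_mem hrm (hsub hd), ?_⟩
          calc a * t * (c * r * d) * t = a * (t * c) * r * (d * t) := by group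
            _ = a * c * (t * r * t) * d := by rw [h1, ← h2]; group
            _ = _ := by rw [hbraid]; group
        · right; right
          have h1 := (commute_of_mem_listClosure hcomm hc).eq
          refine ⟨a * c, mul_mem ha (hsub hc), ?_⟩
          change _ = a * c * (t * lastConj (r :: q :: m) * t)
          calc a * t * (c * lastConj (r :: q :: m)) * t
              = a * (t * c) * lastConj (r :: q :: m) * t := by group
            _ = _ := by rw [h1]; group
      · refine Or.inr (Or.inl ⟨a, ha, lastConj (r :: q :: m), lastConj_mem _, ?_⟩)
        change a * (t * lastConj (r :: q :: m) * t) * t = _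
        simp [mul_assoc, hs]
    · have htm := mem_listClosure ht
      rcases hg with hg | ⟨a, ha, b, hb, rfl⟩ | ⟨a, ha, rfl⟩
      · exact Or.inl (mul_mem hg htm)
      · exact Or.inr (Or.inl ⟨a, ha, b * t, mul_mem hb htm, by group⟩)
      · refine Or.inr (Or.inr ⟨a * t, mul_mem ha htm, ?_⟩)
        rw [mul_assoc, (hT t htm).eq, mul_assoc]

theorem IsChainB.exists_conj {L : List G} (hL : IsChainB L) {w : G} (hw : w ∈ listClosure L) :
    ∃ u ∈ listClosure L.tail, ∃ (pre : List G) (p : G) (q : List G), L = pre ++ p :: q ∧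
      ∃ x ∈ listClosure q, u * w * u⁻¹ = x * pre.reverse.prod ∨
        u * w * u⁻¹ = x * (lastConj (p :: q) * pre.reverse.prod) := by
  induction L generalizing w with
  | nil => exact hL.elim
  | cons s l ih =>
    cases l with
    | nil =>
      have hw' : w = 1 ∨ w = s := by
        refine listClosure_induction (p := fun b => b = 1 ∨ b = s) (Or.inl rfl)
          hL.sq_eq_one ?_ hw
        rintro g (rfl | rfl) q hq
        · right; simpa using hq
        · left
          rw [List.mem_singleton.1 hq]
          exact hL
      refine ⟨1, one_mem _, [], s, [], rfl, 1, one_mem _, ?_⟩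
      simpa [lastConj] using hw'
    | cons r m =>
      rcases hL.double_coset hw with hw | ⟨a, ha, b, hb, rfl⟩ | ⟨a, ha, rfl⟩
      · exact ⟨1, one_mem _, [], s, r :: m, rfl, w, hw, Or.inl (by simp)⟩
      · obtain ⟨u, hu, pre, p, q, hpq, x, hx, h⟩ := ih hL.2.1 (mul_mem hb ha)
        have hu' := listClosure_mono (List.tail_subset (r :: m)) hu
        refine ⟨u * b, mul_mem hu' hb, s :: pre, p, q, by rw [hpq]; rfl, x, hx, ?_⟩
        have hcomm := (commute_of_mem_listClosure hL.2.2.1 (inv_mem hu)).eq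
        have key : u * b * (a * s * b) * (u * b)⁻¹ = u * (b * a) * u⁻¹ * s := by
          simp only [mul_inv_rev, mul_assoc, mul_inv_cancel_left]
          rw [hcomm]
        rw [List.reverse_cons, List.prod_append, List.prod_singleton, key]
        rcases h with h | h
        · left; rw [h, mul_assoc]
        · right; rw [h]; simp only [mul_assoc]
      · exact ⟨1, one_mem _, [], s, r :: m, rfl, a, ha, Or.inr (by simp)⟩

/-- Elements of a chain that are not adjacent commute. -/
theorem IsChainB.commute_of_append {pre q : List G} {p : G} (h : IsChainB (pre ++ p :: q))
    {x y : G} (hx : x ∈ listClosure q) (hy : y ∈ listClosure pre) : Commute x y := by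
  refine (commute_of_mem_listClosure (fun s hs => ?_) hx).symm
  refine (commute_of_mem_listClosure (fun r hr => ?_) hy).symm
  clear hx hy
  induction pre with
  | nil => simp at hr
  | cons a pre ih =>
    have hsub : IsChainB (pre ++ p :: q) ∧ ∀ z ∈ (pre ++ p :: q).tail, Commute a z := by
      cases pre with
      | nil => cases q with
        | nil => simp at hs
        | cons b q => exact ⟨h.2.1, h.2.2.1⟩
      | cons b pre => exact ⟨h.2.1, h.2.2.1⟩
    rcases List.mem_cons.1 hr with rfl | hr
    · refine (hsub.2 s ?_).symm
      cases pre <;> simp [hs]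
    · exact ih hsub.1 hr

end Chains

/-! ### Elements of a parabolic subgroup of type `A` -/

section TypeA

theorem listClosure_map_simple (cs : CoxeterSystem M W) (l : List B) :
    listClosure (l.map cs.simple) = parabolic cs {i | i ∈ l} := by
  rw [listClosure, parabolic]
  congr 1
  ext g
  simp

theorem commute_simple_of_eq_two (cs : CoxeterSystem M W) {i j : B} (h : M i j = 2) :
    Commute (cs.simple i) (cs.simple j) := by
  have h1 := cs.simple_mul_simple_pow i j
  rw [h, pow_two] at h1
  have h2 := eq_inv_of_mul_eq_one_left h1
  rwa [mul_inv_rev, cs.inv_simple, cs.inv_simple] at h2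

theorem braid_simple_of_eq_three (cs : CoxeterSystem M W) {i j : B} (h : M i j = 3) :
    cs.simple i * cs.simple j * cs.simple i = cs.simple j * cs.simple i * cs.simple j := by
  have h1 := cs.simple_mul_simple_pow i j
  rw [h, pow_succ, pow_two] at h1
  have h2 := eq_inv_of_mul_eq_one_left
    (a := cs.simple i * cs.simple j * cs.simple i) (b := cs.simple j * cs.simple i * cs.simple j)
    (by rw [← h1]; group)
  simpa [mul_assoc] using h2

theorem eq_two_of_not_three_le [Finite W] (cs : CoxeterSystem M W) {i j : B} (hij : i ≠ j)
    (h : ¬3 ≤ M i j) : M i j = 2 := by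
  have h0 := matrix_ne_zero cs i j
  have h1 := M.off_diagonal i j hij
  omega

/-- In type `A` all cuspidal elements are conjugate. -/
theorem IsCuspidal.conj_of_isChainA (cs : CoxeterSystem M W) {L : List B} (hL : L.Nodup)
    (hA : IsChainA (L.map cs.simple)) {w w' : W} (hw : IsCuspidal cs {i | i ∈ L} w)
    (hw' : IsCuspidal cs {i | i ∈ L} w') : ∃ u ∈ parabolic cs {i | i ∈ L}, u * w * u⁻¹ = w' := by
  have key : ∀ v, IsCuspidal cs {i | i ∈ L} v → ∃ u ∈ parabolic cs {i | i ∈ L},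
      u * v * u⁻¹ = (L.map cs.simple).reverse.prod := by
    intro v hv
    obtain ⟨u, hu, pre, post, hLp, x, hx, h⟩ :=
      hA.exists_conj (w := v) (by rw [listClosure_map_simple]; exact hv.1)
    have hu' : u ∈ parabolic cs {i | i ∈ L} := by
      rw [← listClosure_map_simple]
      exact listClosure_mono (List.tail_subset _) hu
    obtain ⟨l₁, l₂, rfl, rfl, rfl⟩ := List.map_eq_append_iff.1 hLp
    cases l₂ with
    | nil =>
      simp only [List.map_nil, List.tail_nil, listClosure_nil, Subgroup.mem_bot] at hx
      exact ⟨u, hu', by simpa [hx] using h⟩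
    | cons p q =>
      have hp1 : p ∉ l₁ := fun hp => (List.nodup_append.1 hL).2.2 p hp p (by simp) rfl
      have hp2 : p ∉ q := (List.nodup_cons.1 (List.nodup_append.1 hL).2.1).1
      refine absurd ?_ (hv.2 {i | i ∈ l₁ ++ q} ⟨?_, fun hsub => ?_⟩ u hu')
      · rw [h, ← listClosure_map_simple, List.map_append]
        refine mul_mem (listClosure_mono (List.subset_append_right _ _) hx)
          (listClosure_mono (List.subset_append_left _ _) (prod_reverse_mem_listClosure _))
      · intro i hi
        simp only [Set.mem_ofPred_eq, List.mem_append, List.mem_cons] at hi ⊢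
        tauto
      · have : p ∈ {i | i ∈ l₁ ++ q} := hsub (by simp)
        simp [hp1, hp2] at this
  obtain ⟨u, hu, h⟩ := key w hw
  obtain ⟨u', hu', h'⟩ := key w' hw'
  refine ⟨u'⁻¹ * u, mul_mem (inv_mem hu') hu, ?_⟩
  calc u'⁻¹ * u * w * (u'⁻¹ * u)⁻¹ = u'⁻¹ * (u * w * u⁻¹) * u' := by group
    _ = w' := by rw [h, ← h']; group

end TypeA

/-! ### Automorphisms interchanging the two ends of a diagram of type `D` -/

section TypeD

variable {G : Type*} [Group G]

theorem IsChainA.map {H : Type*} [Group H] (f : G →* H) {l : List G} (h : IsChainA l) :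
    IsChainA (l.map f) := by
  induction l with
  | nil => trivial
  | cons s l ih =>
    obtain ⟨hs, hl, hc, hb⟩ := h
    refine ⟨by rw [← map_mul, hs, map_one], ih hl, ?_, ?_⟩
    · rw [← List.map_tail]
      simp only [List.mem_map]
      rintro _ ⟨x, hx, rfl⟩
      exact (hc x hx).map f
    · cases l with
      | nil => simp
      | cons t l =>
        simp only [List.map_cons, List.head?_cons, Option.mem_some_iff, forall_eq']
        simp only [← map_mul, hb t rfl]

theorem IsChainA.isChainB_append {l : List G} {y t : G} (h : IsChainA (l ++ [y]))
    (ht : t * t = 1) (hc : ∀ s ∈ l, Commute s t) (hy : Commute (y * t * y) t) :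
    IsChainB (l ++ [y, t]) := by
  induction l with
  | nil => exact ⟨h.1, ht, by simp, fun _ => hy, by simp⟩
  | cons a l ih =>
    have ih := ih h.2.1 fun s hs => hc s (by simp [hs])
    obtain ⟨hs, hl, hcomm, hb⟩ := h
    have hat := hc a (by simp)
    cases l with
    | nil =>
      refine ⟨hs, ih, ?_, by simp, fun _ => hb y rfl⟩
      simpa using hat
    | cons b l =>
      refine ⟨hs, ih, ?_, by simp, fun _ => hb b rfl⟩
      intro x hx
      have hx' : x ∈ l ∨ x = y ∨ x = t := by simpa using hx
      rcases hx' with hx' | rfl | rfl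
      · exact hcomm x (by simp [hx'])
      · exact hcomm x (by simp)
      · exact hat

theorem IsChainB.of_append {pre q : List G} (h : IsChainB (pre ++ q)) (hq : q ≠ []) :
    IsChainB q := by
  induction pre with
  | nil => exact h
  | cons a pre ih =>
    obtain ⟨b, m, hm⟩ := List.exists_cons_of_ne_nil (l := pre ++ q) (by simp [hq])
    rw [List.cons_append, hm] at h
    exact ih (hm ▸ h.2.1)

theorem lastConj_map {H : Type*} [Group H] (f : G →* H) {l : List G} {t : G}
    (hl : ∀ s ∈ l, f s = 1) : f (lastConj (l ++ [t])) = f t := by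
  induction l with
  | nil => rfl
  | cons s l ih =>
    have ih := ih fun r hr => hl r (by simp [hr])
    have hs := hl s (by simp)
    cases l with
    | nil =>
      change f (s * t * s) = f t
      simp [hs]
    | cons r l =>
      change f (s * lastConj (r :: (l ++ [t])) * s) = f t
      rw [map_mul, map_mul, hs, one_mul, mul_one]
      exact ih

/-- The holomorph of a group. -/
abbrev Holomorph (G : Type*) [Group G] := G ⋊[MonoidHom.id (MulAut G)] MulAut G

theorem Holomorph.left_conj_inl (u : Holomorph G) (w : G) :
    (u * SemidirectProduct.inl w * u⁻¹).left = u.left * u.right w * u.left⁻¹ := by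
  simp

theorem map_parabolic_le (cs : CoxeterSystem M W) {τ : MulAut W} {Z Z' : Set B}
    (h : ∀ i ∈ Z, τ (cs.simple i) ∈ parabolic cs Z') {v : W} (hv : v ∈ parabolic cs Z) :
    τ v ∈ parabolic cs Z' := by
  refine parabolic_induction cs (p := fun v => τ v ∈ parabolic cs Z') (by simp [one_mem]) ?_ hv
  intro v _ i hi hv
  rw [map_mul]
  exact mul_mem hv (h i hi)

theorem Holomorph.left_mem_of_mem (cs : CoxeterSystem M W) {τ : MulAut W} (hττ : τ * τ = 1)
    {Z : Set B} (hZ : ∀ i ∈ Z, τ (cs.simple i) ∈ parabolic cs Z) {m : List (Holomorph W)}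
    (hm : ∀ g ∈ m, g = SemidirectProduct.inr τ ∨ ∃ i ∈ Z, g = SemidirectProduct.inl (cs.simple i))
    {g : Holomorph W} (hg : g ∈ listClosure m) :
    g.left ∈ parabolic cs Z ∧ (g.right = 1 ∨ g.right = τ) := by
  refine listClosure_induction (p := fun g => g.left ∈ parabolic cs Z ∧
    (g.right = 1 ∨ g.right = τ)) ⟨one_mem _, Or.inl rfl⟩ ?_ ?_ hg
  · intro s hs
    rcases hm s hs with rfl | ⟨i, -, rfl⟩
    · rw [← map_mul, hττ, map_one]
    · rw [← map_mul, cs.simple_mul_simple_self, map_one]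
  · rintro g ⟨h1, h2⟩ s hs
    rcases hm s hs with rfl | ⟨i, hi, rfl⟩
    · refine ⟨by simpa using h1, ?_⟩
      rcases h2 with h2 | h2
      · right; simp [h2]
      · left; simp [h2, hττ]
    · refine ⟨?_, by simpa using h2⟩
      rw [SemidirectProduct.mul_left, SemidirectProduct.left_inl]
      refine mul_mem h1 ?_
      rcases h2 with h2 | h2
      · rw [h2]
        exact simple_mem_parabolic cs hi
      · rw [h2]
        exact hZ i hi

theorem IsCuspidal.left_conj_notMem (cs : CoxeterSystem M W) {w : W}
    (hw : IsCuspidal cs Set.univ w) {τ : MulAut W} (hττ : τ * τ = 1) {Z Z' : Set B}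
    (hZ : Z ≠ Set.univ) (hZ' : Z' ≠ Set.univ)
    (h : ∀ i ∈ Z, τ (cs.simple i) ∈ parabolic cs Z') {u : Holomorph W}
    (hu : u.right = 1 ∨ u.right = τ) :
    (u * SemidirectProduct.inl w * u⁻¹).left ∉ parabolic cs Z := by
  have htop : ∀ v, v ∈ parabolic cs Set.univ := fun v => by
    simp [parabolic, cs.subgroup_closure_range_simple]
  rw [Holomorph.left_conj_inl]
  rcases hu with hu | hu
  · rw [hu]
    exact hw.2 Z (Set.ssubset_univ_iff.2 hZ) u.left (htop _)
  · rw [hu]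
    intro hmem
    refine hw.2 Z' (Set.ssubset_univ_iff.2 hZ') (τ u.left) (htop _) ?_
    have := map_parabolic_le cs h hmem
    have h2 : τ (τ w) = w := by rw [← MulAut.mul_apply, hττ, MulAut.one_apply]
    simpa [h2] using this

/-- Cuspidal elements in type `D` are conjugate to their images under the automorphism that
interchanges the two end nodes adjacent to the branch node. -/
theorem IsCuspidal.exists_conj_eq_of_swap (cs : CoxeterSystem M W) {y₁ y₂ : B} {l : List B}
    {τ : MulAut W} (hτ₁ : τ (cs.simple y₁) = cs.simple y₂)
    (hτ₂ : τ (cs.simple y₂) = cs.simple y₁)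
    (hτ : ∀ i, i ≠ y₁ → i ≠ y₂ → τ (cs.simple i) = cs.simple i)
    (hA : IsChainA ((l ++ [y₁]).map cs.simple)) (hy : Commute (cs.simple y₁) (cs.simple y₂))
    (hnd : (l ++ [y₁]).Nodup) (hy₂ : y₂ ∉ l ++ [y₁]) (hall : ∀ i, i ∈ l ++ [y₁] ∨ i = y₂)
    {w : W} (hw : IsCuspidal cs Set.univ w) : ∃ u : W, u * w * u⁻¹ = τ w := by
  have hττ : τ * τ = 1 := by
    have : (τ * τ).toMonoidHom = MonoidHom.id W := by
      refine cs.ext_simple fun i => ?_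
      change τ (τ (cs.simple i)) = cs.simple i
      by_cases h1 : i = y₁
      · rw [h1, hτ₁, hτ₂]
      · by_cases h2 : i = y₂
        · rw [h2, hτ₂, hτ₁]
        · rw [hτ i h1 h2, hτ i h1 h2]
    ext v
    exact DFunLike.congr_fun this v
  set t : Holomorph W := SemidirectProduct.inr τ with ht
  set f : B → Holomorph W := fun i => SemidirectProduct.inl (cs.simple i) with hf
  have htt : t * t = 1 := by rw [ht, ← map_mul, hττ, map_one]
  have htf : ∀ i, t * f i * t⁻¹ = SemidirectProduct.inl (τ (cs.simple i)) := fun i => by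
    rw [ht, ← map_inv]
    exact (SemidirectProduct.inl_aut (φ := MonoidHom.id (MulAut W)) τ (cs.simple i)).symm
  have htinv : t⁻¹ = t := inv_eq_of_mul_eq_one_left htt
  have hB : IsChainB ((l.map f) ++ [f y₁, t]) := by
    have h1 := hA.map (SemidirectProduct.inl : W →* Holomorph W)
    rw [List.map_map, List.map_append] at h1
    refine IsChainA.isChainB_append h1 htt ?_ ?_
    · intro s hs
      obtain ⟨i, hi, rfl⟩ := List.mem_map.1 hs
      have h2 := htf i
      rw [hτ i ?_ ?_] at h2
      · exact (mul_inv_eq_iff_eq_mul.1 h2).symm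
      · rintro rfl
        exact (List.nodup_append.1 hnd).2.2 i hi i (by simp) rfl
      · rintro rfl
        exact hy₂ (by simp [hi])
    · have h2 := htf y₁
      rw [hτ₁, htinv] at h2
      have h3 : Commute (f y₁) (f y₂) := hy.map _
      change f y₁ * t * f y₁ * t = t * (f y₁ * t * f y₁)
      calc f y₁ * t * f y₁ * t = f y₁ * (t * f y₁ * t) := by group
        _ = (t * f y₁ * t) * f y₁ := by rw [h2]; exact h3.eq
        _ = _ := by group
  have hgen : ∀ {m : List (Holomorph W)}, m ⊆ l.map f ++ [f y₁, t] → ∀ {g}, g ∈ listClosure m →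
      g.right = 1 ∨ g.right = τ := by
    intro m hm g hg
    refine (Holomorph.left_mem_of_mem cs hττ (Z := Set.univ) (fun i _ => ?_)
      (fun g hg => ?_) hg).2
    · simp [parabolic, cs.subgroup_closure_range_simple]
    · have := hm hg
      simp only [List.mem_append, List.mem_map, List.mem_cons, List.not_mem_nil, or_false] at this
      rcases this with ⟨i, -, rfl⟩ | rfl | rfl
      exacts [Or.inr ⟨i, trivial, rfl⟩, Or.inr ⟨y₁, trivial, rfl⟩, Or.inl rfl]
  have hwL : (SemidirectProduct.inl w : Holomorph W) ∈ listClosure (l.map f ++ [f y₁, t]) := by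
    have hsimple : ∀ i, f i ∈ listClosure (l.map f ++ [f y₁, t]) := by
      intro i
      have hty : t ∈ listClosure (l.map f ++ [f y₁, t]) := mem_listClosure (by simp)
      rcases hall i with hi | rfl
      · refine mem_listClosure ?_
        rcases List.mem_append.1 hi with hi | hi
        · exact List.mem_append_left _ (List.mem_map_of_mem hi)
        · rw [List.mem_singleton.1 hi]
          simp
      · have h2 := htf y₁
        rw [hτ₁] at h2
        change SemidirectProduct.inl (cs.simple i) ∈ _
        rw [← h2]
        exact mul_mem (mul_mem hty (mem_listClosure (by simp))) (inv_mem hty)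
    clear hw
    induction w using cs.simple_induction with
    | simple i => exact hsimple i
    | one => rw [map_one]; exact one_mem _
    | mul a b ha hb => rw [map_mul]; exact mul_mem ha hb
  obtain ⟨u, hu, pre, p, q, hL, x, hx, h⟩ := hB.exists_conj hwL
  have hur := hgen (List.tail_subset _) hu
  have hpre : pre ⊆ l.map f ++ [f y₁, t] := by rw [hL]; exact List.subset_append_left _ _
  have hq : q ⊆ l.map f ++ [f y₁, t] := by
    rw [hL]
    exact fun a ha => List.mem_append_right _ (List.mem_cons_of_mem _ ha)
  rcases h with h | h
  · exfalso
    have hmem : u * SemidirectProduct.inl w * u⁻¹ ∈ listClosure (pre ++ q) := by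
      rw [h]
      exact mul_mem (listClosure_mono (List.subset_append_right _ _) hx)
        (listClosure_mono (List.subset_append_left _ _) (prod_reverse_mem_listClosure _))
    have hL' : (l ++ [y₁]).map f ++ [t] = pre ++ p :: q := by simpa using hL
    rcases List.eq_nil_or_concat q with rfl | ⟨q', r, rfl⟩
    · obtain ⟨hL1, hL2⟩ := List.append_inj' hL' rfl
      rw [List.append_nil, ← hL1] at hmem
      have hle : listClosure ((l ++ [y₁]).map f) ≤
          (parabolic cs {i | i ∈ l ++ [y₁]}).map (SemidirectProduct.inl : W →* Holomorph W) := by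
        refine (Subgroup.closure_le _).2 fun g hg => ?_
        obtain ⟨i, hi, rfl⟩ := List.mem_map.1 hg
        exact ⟨cs.simple i, simple_mem_parabolic cs hi, rfl⟩
      obtain ⟨v, hv, hvu⟩ := hle hmem
      refine hw.left_conj_notMem cs hττ (Z := {i | i ∈ l ++ [y₁]}) (Z' := {i | i ≠ y₁})
        (fun hZ => hy₂ (hZ.ge trivial)) (fun hZ => hZ.ge (Set.mem_univ y₁) rfl) ?_ hur ?_
      · intro i hi
        by_cases h1 : i = y₁
        · rw [h1, hτ₁]
          refine simple_mem_parabolic cs ?_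
          rintro rfl
          exact hy₂ (by simp)
        · rw [hτ i h1 (by rintro rfl; exact hy₂ hi)]
          exact simple_mem_parabolic cs h1
      · rw [← hvu]
        exact hv
    · rw [List.concat_eq_append, ← List.cons_append, ← List.append_assoc] at hL'
      obtain ⟨hL1, hL2⟩ := List.append_inj' hL' rfl
      obtain ⟨l₁, l₃, hl, rfl, hl3⟩ := List.map_eq_append_iff.1 hL1
      obtain ⟨p₀, l₂, rfl, rfl, rfl⟩ := List.map_eq_cons_iff.1 hl3
      obtain rfl : t = r := by simpa using hL2
      rw [hl] at hnd hy₂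
      have hp₀ : p₀ ≠ y₂ := by
        rintro rfl
        simp at hy₂
      have hZ : ∀ i ∈ {i | i ≠ p₀ ∧ (p₀ = y₁ → i ≠ y₂)},
          τ (cs.simple i) ∈ parabolic cs {i | i ≠ p₀ ∧ (p₀ = y₁ → i ≠ y₂)} := by
        rintro i ⟨hi, hi2⟩
        by_cases h1 : i = y₁
        · rw [h1, hτ₁]
          exact simple_mem_parabolic cs ⟨hp₀.symm, fun h => absurd (h1.trans h.symm) hi⟩
        · by_cases h2 : i = y₂
          · have h3 : p₀ ≠ y₁ := fun h => hi2 h h2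
            rw [h2, hτ₂]
            exact simple_mem_parabolic cs ⟨h3.symm, fun h => absurd h h3⟩
          · rw [hτ i h1 h2]
            exact simple_mem_parabolic cs ⟨hi, hi2⟩
      have hZ' : {i | i ≠ p₀ ∧ (p₀ = y₁ → i ≠ y₂)} ≠ Set.univ := fun h =>
        (h.ge (Set.mem_univ p₀)).1 rfl
      refine hw.left_conj_notMem cs hττ hZ' hZ' hZ hur
        (Holomorph.left_mem_of_mem cs hττ hZ (fun g hg => ?_) hmem).1
      have hg : g ∈ l₁.map f ∨ g ∈ l₂.map f ∨ g = t := by simpa [or_assoc] using hg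
      rw [or_iff_not_imp_left]
      intro hgt
      have : ∃ i ∈ l₁ ++ l₂, f i = g := by
        rcases hg with hg | hg | hg
        · obtain ⟨i, hi, rfl⟩ := List.mem_map.1 hg
          exact ⟨i, List.mem_append_left _ hi, rfl⟩
        · obtain ⟨i, hi, rfl⟩ := List.mem_map.1 hg
          exact ⟨i, List.mem_append_right _ hi, rfl⟩
        · exact absurd hg hgt
      obtain ⟨i, hi, rfl⟩ := this
      have hi' : i ∈ l₁ ∨ i ∈ l₂ := List.mem_append.1 hi
      refine ⟨i, ⟨?_, ?_⟩, rfl⟩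
      · rintro rfl
        rcases hi' with hi' | hi'
        · exact (List.nodup_append.1 hnd).2.2 i hi' i (by simp) rfl
        · exact (List.nodup_cons.1 (List.nodup_append.1 hnd).2.1).1 hi'
      · rintro - rfl
        exact hy₂ (by simp only [List.mem_append, List.mem_cons]; tauto)
  · set c := lastConj (p :: q) * pre.reverse.prod with hc
    have hcomm : Commute (u * SemidirectProduct.inl w * u⁻¹) c := by
      rw [h]
      refine Commute.mul_left ?_ (Commute.refl c)
      rw [hL] at hB
      refine Commute.mul_right ?_ (hB.commute_of_append hx (prod_reverse_mem_listClosure _))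
      refine (IsChainB.commute_lastConj (l := p :: q) ?_ hx).symm
      exact hB.of_append (by simp)
    have hcr : c.right = τ := by
      have hfr : ∀ g ∈ (l ++ [y₁]).map f,
          (SemidirectProduct.rightHom : Holomorph W →* MulAut W) g = 1 := by
        intro g hg
        obtain ⟨i, -, rfl⟩ := List.mem_map.1 hg
        exact SemidirectProduct.rightHom_inl (φ := MonoidHom.id (MulAut W)) (cs.simple i)
      have hL' : (l ++ [y₁]).map f ++ [t] = pre ++ p :: q := by simpa using hL
      rcases List.eq_nil_or_concat (p :: q) with hpq | ⟨q', r, hpq⟩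
      · exact absurd hpq (by simp)
      rw [hpq, List.concat_eq_append, ← List.append_assoc] at hL'
      obtain ⟨hL1, hL2⟩ := List.append_inj' hL' rfl
      obtain rfl : t = r := by simpa using hL2
      rw [hL1] at hfr
      rw [hc, hpq, List.concat_eq_append]
      rw [← SemidirectProduct.rightHom_eq_right]
      rw [map_mul, lastConj_map _ fun s hs => hfr s (List.mem_append_right _ hs), map_list_prod,
        List.prod_eq_one, mul_one, ht, SemidirectProduct.rightHom_inr]
      intro g hg
      obtain ⟨g', hg', rfl⟩ := List.mem_map.1 hg
      exact hfr g' (List.mem_append_left _ (List.mem_reverse.1 hg'))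
    set c' := u⁻¹ * c * u with hc'
    have hcr' : c'.right = τ := by
      rw [hc']
      simp only [SemidirectProduct.mul_right, SemidirectProduct.inv_right, hcr]
      rcases hur with hur | hur <;> simp [hur]
    have hcomm' : c' * SemidirectProduct.inl w = SemidirectProduct.inl w * c' := by
      have h1 := hcomm.eq
      calc c' * SemidirectProduct.inl w
          = u⁻¹ * (c * (u * SemidirectProduct.inl w * u⁻¹)) * u := by rw [hc']; group
        _ = _ := by rw [← h1, hc']; group
    have hleft := congrArg SemidirectProduct.left hcomm'
    simp only [SemidirectProduct.mul_left, hcr', SemidirectProduct.left_inl,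
      SemidirectProduct.right_inl, map_one, MulAut.one_apply, MonoidHom.id_apply] at hleft
    refine ⟨c'.left⁻¹, ?_⟩
    rw [inv_inv, mul_assoc, ← hleft]
    group

end TypeD

/-! ### Passing to the Coxeter group of a subdiagram -/

section Transfer

/-- The Coxeter matrix of a subdiagram. -/
def subdiagram (M : CoxeterMatrix B) (I : Set B) : CoxeterMatrix I where
  M i j := M i j
  isSymm := by
    ext i j
    exact M.symmetric j i
  diagonal i := M.diagonal i
  off_diagonal i j h := M.off_diagonal i j fun h' => h (Subtype.ext h')

@[simp]
theorem subdiagram_apply (I : Set B) (i j : I) : subdiagram M I i j = M i j := rfl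

theorem parabolic_univ (cs : CoxeterSystem M W) : parabolic cs Set.univ = ⊤ := by
  rw [parabolic, Set.image_univ, cs.subgroup_closure_range_simple]

/-- The diagram automorphism `σ` is induced by an automorphism of the Coxeter group that maps every
cuspidal element to a conjugate. -/
def FixesCuspidal (M : CoxeterMatrix B) (σ : Equiv.Perm B) : Prop :=
  ∃ τ : MulAut M.Group, (∀ i, τ (M.simple i) = M.simple (σ i)) ∧
    ∀ w, IsCuspidal M.toCoxeterSystem Set.univ w → ∃ u : M.Group, u * w * u⁻¹ = τ w

theorem FixesCuspidal.mul {σ σ' : Equiv.Perm B} (h : FixesCuspidal M σ)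
    (h' : FixesCuspidal M σ') : FixesCuspidal M (σ * σ') := by
  obtain ⟨τ, hτ, hw⟩ := h
  obtain ⟨τ', hτ', hw'⟩ := h'
  refine ⟨τ * τ', fun i => by simp [hτ, hτ'], fun w hc => ?_⟩
  obtain ⟨u, hu⟩ := hw' w hc
  have hmem : u ∈ parabolic M.toCoxeterSystem Set.univ := by
    rw [parabolic_univ]
    trivial
  obtain ⟨v, hv⟩ := hw _ (hc.conj hmem)
  refine ⟨v * u, ?_⟩
  rw [MulAut.mul_apply, ← hu, ← hv]
  group

theorem exists_mulAut (σ : Equiv.Perm B) (hσ : ∀ i j, M (σ i) (σ j) = M i j) :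
    ∃ τ : MulAut M.Group, ∀ i, τ (M.simple i) = M.simple (σ i) := by
  set cs := M.toCoxeterSystem
  have h1 : M.IsLiftable fun i => cs.simple (σ i) := fun i j => by
    rw [← hσ]
    exact cs.simple_mul_simple_pow _ _
  have h2 : M.IsLiftable fun i => cs.simple (σ.symm i) := fun i j => by
    rw [← σ.apply_symm_apply i, ← σ.apply_symm_apply j, hσ]
    simp only [Equiv.apply_symm_apply]
    exact cs.simple_mul_simple_pow _ _
  refine ⟨MonoidHom.toMulEquiv (cs.lift ⟨_, h1⟩) (cs.lift ⟨_, h2⟩) ?_ ?_, fun i => ?_⟩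
  · refine cs.ext_simple fun i => ?_
    simp [cs.lift_apply_simple]
  · refine cs.ext_simple fun i => ?_
    simp [cs.lift_apply_simple]
  · exact cs.lift_apply_simple h1 i

theorem conj_eq_conj_of_simple (cs : CoxeterSystem M W) {I : Set B} {g n : W}
    (h : ∀ i ∈ I, g * cs.simple i * g⁻¹ = n * cs.simple i * n⁻¹) {w : W}
    (hw : w ∈ parabolic cs I) : g * w * g⁻¹ = n * w * n⁻¹ := by
  refine parabolic_induction cs (p := fun w => g * w * g⁻¹ = n * w * n⁻¹) (by simp) ?_ hw
  intro w _ i hi ih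
  calc g * (w * cs.simple i) * g⁻¹ = (g * w * g⁻¹) * (g * cs.simple i * g⁻¹) := by group
    _ = n * (w * cs.simple i) * n⁻¹ := by rw [ih, h i hi]; group

theorem FixesCuspidal.exists_conj (cs : CoxeterSystem M W) {I : Set B} {σ : Equiv.Perm I}
    (hσ : FixesCuspidal (subdiagram M I) σ) {n : W}
    (hn : ∀ i : I, n * cs.simple i * n⁻¹ = cs.simple (σ i)) {w : W} (hw : IsCuspidal cs I w) :
    ∃ u ∈ parabolic cs I, u * w * u⁻¹ = n * w * n⁻¹ := by
  obtain ⟨τ, hτ, hcusp⟩ := hσ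
  set cs' := (subdiagram M I).toCoxeterSystem with hcs'
  have hl : (subdiagram M I).IsLiftable fun i : I => cs.simple i := fun i j =>
    cs.simple_mul_simple_pow i j
  set π : (subdiagram M I).Group →* W := cs'.lift ⟨_, hl⟩ with hπ
  have hπs : ∀ i, π (cs'.simple i) = cs.simple i := cs'.lift_apply_simple hl
  have hmap : ∀ (K : Set I) (g), g ∈ parabolic cs' K → π g ∈ parabolic cs ((↑) '' K) := by
    intro K g hg
    refine parabolic_induction cs' (p := fun g => π g ∈ parabolic cs ((↑) '' K))
      (by simp [one_mem]) ?_ hg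
    intro g _ i hi h
    rw [map_mul, hπs]
    exact mul_mem h (simple_mem_parabolic cs ⟨i, hi, rfl⟩)
  have htop : ∀ g, π g ∈ parabolic cs I := fun g => by
    have := hmap Set.univ g (by simp [parabolic_univ])
    simpa using this
  have hsurj : ∀ v ∈ parabolic cs I, ∃ g, π g = v := by
    intro v hv
    refine parabolic_induction cs (p := fun v => ∃ g, π g = v) ⟨1, map_one π⟩ ?_ hv
    rintro _ - i hi ⟨g, rfl⟩
    exact ⟨g * cs'.simple ⟨i, hi⟩, by rw [map_mul, hπs]⟩
  have hconj : ∀ g, π (τ g) = n * π g * n⁻¹ := by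
    intro g
    have : π.comp τ.toMonoidHom = (MulAut.conj n).toMonoidHom.comp π := by
      refine cs'.ext_simple fun i => ?_
      change π (τ (cs'.simple i)) = n * π (cs'.simple i) * n⁻¹
      rw [hπs, hn, ← hπs]
      exact congrArg π (hτ i)
    exact DFunLike.congr_fun this g
  obtain ⟨g, rfl⟩ := hsurj w hw.1
  have hg : IsCuspidal cs' Set.univ g := by
    refine ⟨by simp [parabolic_univ], fun K hK u _ hmem => ?_⟩
    have := hmap K _ hmem
    rw [map_mul, map_mul, map_inv] at this
    refine hw.2 _ ⟨by simp, fun hsub => hK.2 fun i _ => ?_⟩ (π u) (htop u) this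
    obtain ⟨j, hj, hji⟩ := hsub i.2
    rwa [← Subtype.ext hji]
  obtain ⟨u, hu⟩ := hcusp g hg
  exact ⟨π u, htop u, by rw [← hconj, ← hu, map_mul, map_mul, map_inv]⟩

/-- The list is a type `A` diagram. -/
def IsLinear (M : CoxeterMatrix B) : List B → Prop
  | [] => True
  | s :: l => IsLinear M l ∧ (∀ c ∈ l.tail, M s c = 2) ∧ ∀ t ∈ l.head?, M s t = 3

theorem IsPath.isLinear [Finite W] (cs : CoxeterSystem M W) {L : List B} (hL : IsPath M L)
    (h3 : ∀ i ∈ L, ∀ j ∈ L, M i j ≤ 3) : IsLinear M L := by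
  induction L with
  | nil => trivial
  | cons a L ih =>
    refine ⟨ih hL.tail fun i hi j hj => h3 i (by simp [hi]) j (by simp [hj]), ?_, ?_⟩
    · cases L with
      | nil => simp
      | cons b L =>
        intro c hc
        refine eq_two_of_not_three_le cs ?_ (hL.not_adj_of_mem cs hc)
        rintro rfl
        exact (List.nodup_cons.1 hL.1).1 (List.mem_cons_of_mem _ hc)
    · cases L with
      | nil => simp
      | cons b L =>
        simp only [List.head?_cons, Option.mem_some_iff, forall_eq']
        exact le_antisymm (h3 a (by simp) b (by simp)) (isPath_cons_cons.1 hL).2.1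

theorem IsLinear.isChainA (cs : CoxeterSystem M W) {L : List B} (hL : IsLinear M L) :
    IsChainA (L.map cs.simple) := by
  induction L with
  | nil => trivial
  | cons a L ih =>
    obtain ⟨hl, h2, h3⟩ := hL
    refine ⟨cs.simple_mul_simple_self a, ih hl, ?_, ?_⟩
    · rw [← List.map_tail]
      simp only [List.mem_map]
      rintro _ ⟨c, hc, rfl⟩
      exact commute_simple_of_eq_two cs (h2 c hc)
    · rw [List.head?_map]
      rintro _ ht
      obtain ⟨c, hc, rfl⟩ := Option.map_eq_some_iff.1 ht
      exact braid_simple_of_eq_three cs (h3 c hc)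

theorem isLinear_subdiagram {I : Set B} {L : List I} (hL : IsLinear M (L.map (↑))) :
    IsLinear (subdiagram M I) L := by
  induction L with
  | nil => trivial
  | cons a L ih =>
    obtain ⟨hl, h2, h3⟩ := hL
    refine ⟨ih hl, fun c hc => h2 c ?_, fun t ht => h3 t ?_⟩
    · rw [← List.map_tail]
      exact List.mem_map_of_mem hc
    · rw [List.head?_map, Option.mem_def.1 ht]
      rfl

theorem fixesCuspidal_swap_of_isLinear {y₁ y₂ : B} {l : List B} (hl : IsLinear M (l ++ [y₁]))
    (hnd : (l ++ [y₁]).Nodup) (hy₂ : y₂ ∉ l ++ [y₁]) (hall : ∀ i, i ∈ l ++ [y₁] ∨ i = y₂)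
    (hy : M y₁ y₂ = 2) (hsymm : ∀ i ∈ l, M i y₁ = M i y₂) :
    FixesCuspidal M (Equiv.swap y₁ y₂) := by
  have hne : y₁ ≠ y₂ := by
    rintro rfl
    simp at hy₂
  have hmem : ∀ i, i ≠ y₁ → i ≠ y₂ → i ∈ l := fun i h1 h2 => by
    simpa [h1, h2] using hall i
  obtain ⟨τ, hτ⟩ := exists_mulAut (M := M) (Equiv.swap y₁ y₂) fun i j => by
    by_cases hi1 : i = y₁ <;> by_cases hi2 : i = y₂ <;> by_cases hj1 : j = y₁ <;>
      by_cases hj2 : j = y₂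
    all_goals first
      | exact absurd (hi1.symm.trans hi2) hne
      | exact absurd (hj1.symm.trans hj2) hne
      | skip
    all_goals
      simp only [hi1, hi2, hj1, hj2, Equiv.swap_apply_left, Equiv.swap_apply_right, ne_eq,
        not_false_eq_true, Equiv.swap_apply_of_ne_of_ne, M.diagonal, M.symmetric y₂ y₁,
        M.symmetric y₁ j, M.symmetric y₂ j]
    all_goals first
      | exact hsymm j (hmem j hj1 hj2)
      | exact (hsymm j (hmem j hj1 hj2)).symm
      | exact hsymm i (hmem i hi1 hi2)
      | exact (hsymm i (hmem i hi1 hi2)).symm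
  refine ⟨τ, hτ, fun w hw => ?_⟩
  refine hw.exists_conj_eq_of_swap M.toCoxeterSystem (y₁ := y₁) (y₂ := y₂) (l := l) ?_ ?_ ?_
    (hl.isChainA _) (commute_simple_of_eq_two _ hy) hnd hy₂ hall
  · rw [M.toCoxeterSystem_simple, hτ, Equiv.swap_apply_left]
  · rw [M.toCoxeterSystem_simple, hτ, Equiv.swap_apply_right]
  · intro i h1 h2
    rw [M.toCoxeterSystem_simple, hτ, Equiv.swap_apply_of_ne_of_ne h1 h2]

/-- The case of a type `D` subdiagram. -/
theorem fixesCuspidal_swap [Finite W] (cs : CoxeterSystem M W) {I : Set B} {y₁ y₂ : I}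
    {l : List B} (hl : IsPath M (l ++ [(y₁ : B)])) (h3 : ∀ i ∈ I, ∀ j ∈ I, M i j ≤ 3)
    (hI : ∀ i, i ∈ I ↔ i ∈ l ++ [(y₁ : B)] ∨ i = y₂) (hy₂ : (y₂ : B) ∉ l ++ [(y₁ : B)])
    (hy : M y₁ y₂ = 2) (hsymm : ∀ i ∈ l, M i y₁ = M i y₂) :
    FixesCuspidal (subdiagram M I) (Equiv.swap y₁ y₂) := by
  have hlI : ∀ i ∈ l ++ [(y₁ : B)], i ∈ I := fun i hi => (hI i).2 (Or.inl hi)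
  have hlin := hl.isLinear cs fun i hi j hj => h3 i (hlI i hi) j (hlI j hj)
  have hl' : ∀ i ∈ l, i ∈ I := fun i hi => hlI i (List.mem_append_left _ hi)
  lift l to List I using hl'
  have hmap : l.map (↑) ++ [(y₁ : B)] = (l ++ [y₁]).map (↑) := by simp
  rw [hmap] at hlin hl hy₂
  have hmem : ∀ i : I, (i : B) ∈ (l ++ [y₁]).map (↑) ↔ i ∈ l ++ [y₁] := fun i =>
    List.mem_map_of_injective Subtype.val_injective
  have hall : ∀ i : I, i ∈ l ++ [y₁] ∨ i = y₂ := fun i => by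
    have := (hI i).1 i.2
    rw [hmap, hmem] at this
    exact this.imp_right Subtype.ext
  convert fixesCuspidal_swap_of_isLinear (isLinear_subdiagram hlin) (hl.1.of_map _)
    ((hmem y₂).not.1 hy₂) hall hy fun i hi => hsymm i (List.mem_map_of_mem hi)

end Transfer

/-! ### The longest element in type `E₆` -/

section TypeE

/-- Adjacency in the diagram `E₆`: the branch node is `0`, its neighbours are `1`, `2`, `3`, and
`4`, `5` are the end nodes next to `1`, `2`. -/
def esixAdj (a b : Fin 6) : Bool :=
  match a.val, b.val with
  | 0, 1 | 1, 0 | 0, 2 | 2, 0 | 0, 3 | 3, 0 | 1, 4 | 4, 1 | 2, 5 | 5, 2 => true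
  | _, _ => false

/-- Apply a braid or commutation relation of `E₆` at the given position of a word. -/
def esixMove : ℕ → List (Fin 6) → List (Fin 6)
  | 0, a :: b :: c :: l =>
    if esixAdj a b then if c = a then b :: a :: b :: l else a :: b :: c :: l
    else b :: a :: c :: l
  | 0, [a, b] => if esixAdj a b then [a, b] else [b, a]
  | p + 1, a :: l => a :: esixMove p l
  | _, l => l

theorem esixMove_prod {G : Type*} [Group G] {s : Fin 6 → G}
    (hb : ∀ a b, esixAdj a b = true → s a * s b * s a = s b * s a * s b)
    (hc : ∀ a b, esixAdj a b = false → Commute (s a) (s b)) (p : ℕ) (l : List (Fin 6)) :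
    ((esixMove p l).map s).prod = (l.map s).prod := by
  fun_induction esixMove p l with
  | case1 a b l h => simpa [mul_assoc] using congrArg (· * (l.map s).prod) (hb _ _ h).symm
  | case2 => rfl
  | case3 a b c l h =>
    simpa [mul_assoc] using congrArg (· * (s c * (l.map s).prod)) (hc a b (by simpa using h)).eq.symm
  | case4 => rfl
  | case5 a b h => simpa using (hc a b (by simpa using h)).eq.symm
  | case6 p a l ih => simp [ih]
  | case7 => rfl

theorem foldl_esixMove_prod {G : Type*} [Group G] {s : Fin 6 → G}
    (hb : ∀ a b, esixAdj a b = true → s a * s b * s a = s b * s a * s b)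
    (hc : ∀ a b, esixAdj a b = false → Commute (s a) (s b)) (ps : List ℕ) (l : List (Fin 6)) :
    ((ps.foldl (fun l p => esixMove p l) l).map s).prod = (l.map s).prod := by
  induction ps generalizing l with
  | nil => rfl
  | cons p ps ih => rw [List.foldl_cons, ih, esixMove_prod hb hc]

/-- A reduced word for the longest element. -/
def esixWord : List (Fin 6) :=
  (List.replicate 6 [0, 4, 5, 1, 2, 3]).flatten

/-- The nontrivial automorphism of the diagram. -/
def esixFlip : Fin 6 → Fin 6 := ![0, 2, 1, 3, 5, 4]

/-- Moves that carry a simple reflection from the end of `esixWord` to its front. -/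
def esixMoves : Fin 6 → List ℕ :=
  ![
    [10, 9, 8, 7, 5, 10, 13, 12, 11, 9, 11, 8, 15, 14, 12, 18, 17, 15, 22, 21, 20, 18, 21, 27,
     31, 30, 29, 28, 26, 28, 25, 23, 22, 20, 22, 19, 17, 19, 21, 22, 23, 16, 14, 16, 18, 19,
     13, 11, 13, 15, 16, 10, 9, 7, 9, 12, 10, 12, 11, 13, 14, 6, 4, 10, 13, 15, 20, 19, 18,
     16, 23, 22, 21, 19, 23, 22, 27, 31, 30, 29, 28, 26, 28, 24, 23, 21, 23, 24, 20, 18, 20,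
     22, 23, 24, 17, 12, 15, 13, 15, 14, 17, 11, 12, 9, 13, 11, 10, 13, 12, 14, 18, 16, 18,
     17, 19, 20, 21, 8, 22, 26, 25, 24, 23, 21, 27, 26, 24, 23, 22, 30, 29, 27, 30, 31, 29,
     31, 28, 26, 28, 30, 31, 25, 34, 32, 34, 33, 31, 33, 35, 29, 28, 27, 26, 24, 26, 32, 31,
     29, 27, 29, 32, 30, 28, 32, 31, 30, 31, 23, 25, 18, 21, 19, 21, 20, 25, 23, 25, 24, 26,
     27, 28, 17, 18, 20, 22, 25, 23, 25, 24, 26, 27, 28, 16, 17, 15, 17, 18, 19, 14, 13, 12,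
     11, 10, 13, 11, 13, 12, 14, 15, 7, 8, 6, 8, 12, 15, 14, 13, 11, 13, 9, 11, 13, 18, 22,
     21, 20, 19, 17, 19, 15, 14, 12, 14, 10, 13, 12, 11, 15, 18, 16, 14, 16, 13, 14, 18, 25,
     24, 23, 21, 19, 17, 21, 25, 24, 22, 20, 22, 19, 20, 24, 23, 22, 21, 25, 24, 23, 29, 27,
     29, 28, 30, 31, 32, 16, 5, 7, 9, 10, 11, 12, 3, 12, 11, 10, 9, 7, 5, 7, 12, 15, 14, 13,
     11, 13, 10, 8, 6, 10, 11, 17, 16, 14, 12, 14, 20, 19, 17, 15, 13, 17, 24, 23, 22, 20, 18,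
     16, 20, 23, 21, 19, 21, 18, 19, 23, 22, 21, 24, 23, 26, 29, 27, 29, 28, 30, 31, 32, 15,
     16, 9, 12, 10, 12, 11, 13, 14, 8, 9, 10, 11, 2, 1],
    [3, 7, 6, 5, 4, 2, 4, 1, 10, 9, 8, 6, 10, 9, 14, 18, 17, 16, 15, 13, 15, 11, 10, 8, 13,
     11, 10, 15, 13, 12, 19, 18, 16, 22, 21, 19, 22, 26, 30, 29, 28, 27, 25, 27, 23, 21, 23,
     20, 18, 20, 22, 23, 17, 15, 17, 19, 20, 14, 13, 11, 13, 14, 16, 9, 12, 13, 11, 13, 21,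
     26, 25, 24, 22, 29, 28, 27, 25, 29, 28, 32, 30, 29, 27, 29, 30, 26, 24, 26, 28, 29, 30,
     23, 18, 21, 19, 21, 20, 23, 17, 18, 20, 24, 22, 24, 23, 25, 26, 27, 16, 17, 15, 17, 18,
     19, 14, 15, 7, 8, 5, 13, 12, 11, 9, 7, 6, 9, 15, 14, 12, 10, 8, 12, 18, 21, 20, 19, 17,
     19, 15, 13, 11, 15, 18, 16, 14, 16, 13, 14, 18, 24, 23, 21, 19, 17, 21, 24, 22, 20, 22,
     19, 20, 24, 23, 22, 28, 26, 28, 27, 29, 30, 31, 16, 10, 11, 12, 4, 12, 11, 10, 8, 6, 8,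
     12, 11, 9, 7, 11, 10, 9, 12, 11, 10, 11, 16, 14, 16, 15, 17, 18, 19, 3, 2, 0, 2, 5, 3, 5,
     4, 6, 7, 8, 35, 34],
    [2, 6, 5, 4, 3, 1, 10, 9, 8, 6, 10, 13, 12, 11, 9, 18, 17, 16, 14, 12, 16, 15, 22, 21, 20,
     18, 21, 27, 31, 30, 29, 28, 26, 28, 25, 23, 22, 20, 22, 19, 17, 19, 21, 22, 23, 16, 14,
     16, 17, 13, 11, 13, 15, 17, 18, 19, 10, 12, 8, 12, 10, 12, 11, 13, 14, 7, 5, 7, 9, 10,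
     11, 4, 9, 17, 16, 15, 14, 12, 17, 20, 19, 18, 16, 18, 15, 22, 21, 19, 25, 24, 22, 29, 28,
     27, 25, 28, 33, 32, 30, 29, 27, 29, 26, 24, 26, 28, 29, 30, 23, 21, 23, 25, 26, 20, 18,
     20, 22, 23, 17, 16, 14, 16, 19, 17, 19, 18, 20, 21, 13, 11, 13, 15, 16, 17, 18, 10, 8,
     10, 7, 6, 5, 3, 5, 12, 11, 10, 8, 6, 8, 12, 15, 14, 13, 11, 13, 9, 7, 11, 13, 20, 19, 18,
     16, 14, 12, 14, 10, 18, 17, 15, 13, 12, 11, 13, 17, 16, 24, 23, 22, 20, 18, 17, 15, 17,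
     20, 23, 21, 19, 21, 18, 19, 23, 22, 21, 24, 23, 26, 29, 27, 29, 28, 30, 31, 32, 14, 9,
     10, 11, 2, 4, 0, 4, 2, 4, 3, 5, 6, 7, 35],
    [8, 12, 11, 10, 9, 7, 13, 12, 10, 9, 8, 16, 15, 13, 16, 20, 24, 23, 22, 21, 19, 21, 17,
     15, 17, 14, 12, 14, 16, 17, 11, 23, 22, 21, 20, 18, 23, 25, 24, 22, 25, 34, 33, 32, 31,
     29, 27, 26, 24, 26, 23, 25, 21, 22, 20, 22, 25, 23, 25, 24, 26, 19, 17, 19, 21, 22, 23,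
     24, 15, 14, 13, 12, 10, 12, 18, 17, 15, 13, 15, 18, 16, 14, 18, 17, 16, 17, 22, 20, 22,
     21, 23, 24, 25, 9, 11, 4, 7, 5, 7, 6, 11, 9, 11, 10, 12, 13, 14, 3, 4, 6, 8, 11, 9, 11,
     10, 12, 13, 14, 2, 3, 1, 2, 0, 2, 3, 4, 5],
    [1, 0, 7, 6, 5, 9, 8, 16, 15, 14, 13, 11, 15, 18, 20, 25, 24, 23, 21, 28, 27, 26, 24, 28,
     27, 32, 35, 34, 33, 31, 33, 29, 28, 26, 28, 29, 25, 23, 25, 27, 28, 29, 22, 17, 20, 18,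
     20, 19, 22, 16, 17, 14, 18, 16, 15, 18, 17, 19, 23, 21, 23, 22, 24, 25, 26, 13, 17, 15,
     17, 16, 18, 19, 12, 10, 12, 14, 15, 16, 17, 9, 7, 9, 10, 6, 4, 6, 7, 8, 3],
    [0, 6, 5, 4, 8, 16, 15, 14, 13, 11, 16, 19, 18, 17, 15, 17, 14, 21, 20, 18, 24, 23, 21,
     28, 27, 26, 24, 27, 33, 35, 34, 32, 34, 31, 29, 28, 26, 28, 25, 23, 25, 27, 28, 29, 22,
     20, 22, 24, 25, 19, 17, 19, 21, 22, 16, 15, 13, 15, 18, 16, 18, 17, 19, 20, 12, 10, 12,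
     14, 15, 16, 17, 9, 7, 9, 6, 5, 3, 5, 6, 7, 2]]

theorem foldl_esixMoves (i : Fin 6) :
    (esixMoves i).foldl (fun l p => esixMove p l) (esixWord ++ [i]) = esixFlip i :: esixWord := by
  revert i
  decide +kernel

theorem esixWord_prod_mul {G : Type*} [Group G] {s : Fin 6 → G}
    (hb : ∀ a b, esixAdj a b = true → s a * s b * s a = s b * s a * s b)
    (hc : ∀ a b, esixAdj a b = false → Commute (s a) (s b)) (i : Fin 6) :
    (esixWord.map s).prod * s i = s (esixFlip i) * (esixWord.map s).prod := by
  have := foldl_esixMove_prod hb hc (esixMoves i) (esixWord ++ [i])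
  rw [foldl_esixMoves] at this
  simpa using this.symm

end TypeE

/-! ### Cuspidal classes under conjugation: reduction to connected diagrams -/

section Split

/-- Conjugation by `n` permutes the simple reflections in `I` according to `σ`. -/
def PermutesBy (cs : CoxeterSystem M W) (I : Set B) (n : W) (σ : B → B) : Prop :=
  ∀ i ∈ I, σ i ∈ I ∧ n * cs.simple i * n⁻¹ = cs.simple (σ i)

/-- Conjugation by `n` maps each cuspidal element of `W_I` to a `W_I`-conjugate. -/
def FixesCuspidalClasses (cs : CoxeterSystem M W) (I : Set B) (n : W) : Prop :=
  ∀ w, IsCuspidal cs I w → ∃ u ∈ parabolic cs I, u * w * u⁻¹ = n * w * n⁻¹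

theorem exists_permutesBy (cs : CoxeterSystem M W) {I : Set B} {n : W}
    (h : ∀ i ∈ I, ∃ j ∈ I, n * cs.simple i * n⁻¹ = cs.simple j) :
    ∃ σ, PermutesBy cs I n σ := by
  choose! σ hσ using h
  exact ⟨σ, hσ⟩

theorem PermutesBy.injOn [Finite W] {cs : CoxeterSystem M W} {I : Set B} {n : W} {σ : B → B}
    (h : PermutesBy cs I n σ) : Set.InjOn σ I := by
  intro i hi j hj hij
  have h1 := (h i hi).2
  rw [hij, ← (h j hj).2] at h1
  exact simple_injective cs (mul_left_cancel (mul_right_cancel h1))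

theorem PermutesBy.matrix_eq [Finite W] {cs : CoxeterSystem M W} {I : Set B} {n : W} {σ : B → B}
    (h : PermutesBy cs I n σ) {i j : B} (hi : i ∈ I) (hj : j ∈ I) : M (σ i) (σ j) = M i j :=
  (matrix_eq_of_conj cs (h i hi).2 (h j hj).2).symm

theorem PermutesBy.mem_image [Finite W] {cs : CoxeterSystem M W} {I L : Set B} {n : W}
    {σ : B → B} (h : PermutesBy cs I n σ) (hLI : L ⊆ I) (hL : ∀ i ∈ L, σ i ∈ L) {j : B}
    (hj : j ∈ L) : ∃ i ∈ L, σ i = j := by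
  have hfin : L.Finite := by
    have := Finite.of_injective _ (simple_injective cs)
    exact Set.toFinite L
  exact ((hfin.injOn_iff_bijOn_of_mapsTo hL).1 (h.injOn.mono hLI)).surjOn hj

theorem PermutesBy.mem_of_apply_mem [Finite W] {cs : CoxeterSystem M W} {I L : Set B} {n : W}
    {σ : B → B} (h : PermutesBy cs I n σ) (hLI : L ⊆ I) (hL : ∀ i ∈ L, σ i ∈ L) {i : B}
    (hi : i ∈ I) (hi' : σ i ∈ L) : i ∈ L := by
  obtain ⟨j, hj, hji⟩ := h.mem_image hLI hL hi'
  rwa [← h.injOn (hLI hj) hi hji]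

theorem commute_of_mem_parabolic (cs : CoxeterSystem M W) {I J : Set B}
    (h2 : ∀ a ∈ I, ∀ b ∈ J, M a b = 2) {x y : W} (hx : x ∈ parabolic cs I)
    (hy : y ∈ parabolic cs J) : Commute x y := by
  refine parabolic_induction cs (p := fun x => Commute x y) (Commute.one_left y) ?_ hx
  intro x _ i hi ih
  refine ih.mul_left ?_
  refine parabolic_induction cs (p := fun y => Commute (cs.simple i) y) (Commute.one_right _) ?_ hy
  intro y _ j hj ih
  exact ih.mul_right (commute_simple_of_eq_two cs (h2 i hi j hj))

theorem exists_mul_of_mem_parabolic (cs : CoxeterSystem M W) {L I : Set B}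
    (h2 : ∀ a ∈ L, ∀ b ∈ I \ L, M a b = 2) {w : W} (hw : w ∈ parabolic cs I) :
    ∃ w₁ ∈ parabolic cs L, ∃ w₂ ∈ parabolic cs (I \ L), w = w₁ * w₂ := by
  refine parabolic_induction cs
    (p := fun w => ∃ w₁ ∈ parabolic cs L, ∃ w₂ ∈ parabolic cs (I \ L), w = w₁ * w₂)
    ⟨1, one_mem _, 1, one_mem _, by simp⟩ ?_ hw
  rintro _ - i hi ⟨w₁, h₁, w₂, h₂, rfl⟩
  by_cases hiL : i ∈ L
  · refine ⟨w₁ * cs.simple i, mul_mem h₁ (simple_mem_parabolic cs hiL), w₂, h₂, ?_⟩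
    rw [mul_assoc, mul_assoc,
      (commute_of_mem_parabolic cs h2 (simple_mem_parabolic cs hiL) h₂).eq]
  · exact ⟨w₁, h₁, w₂ * cs.simple i, mul_mem h₂ (simple_mem_parabolic cs ⟨hi, hiL⟩),
      mul_assoc _ _ _⟩

theorem IsCuspidal.left_of_mul (cs : CoxeterSystem M W) {L I : Set B} (hLI : L ⊆ I)
    (h2 : ∀ a ∈ L, ∀ b ∈ I \ L, M a b = 2) {w₁ w₂ : W} (h₁ : w₁ ∈ parabolic cs L)
    (h₂ : w₂ ∈ parabolic cs (I \ L)) (hw : IsCuspidal cs I (w₁ * w₂)) : IsCuspidal cs L w₁ := by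
  refine ⟨h₁, fun K hK u hu hmem => ?_⟩
  refine hw.2 (K ∪ (I \ L)) ⟨Set.union_subset (hK.1.trans hLI) Set.sdiff_subset, fun hsub => ?_⟩ u
    (parabolic_mono cs hLI hu) ?_
  · refine hK.2 fun a ha => ?_
    rcases hsub (hLI ha) with h | h
    · exact h
    · exact absurd ha h.2
  · have : u * (w₁ * w₂) * u⁻¹ = (u * w₁ * u⁻¹) * w₂ := by
      have hc := (commute_of_mem_parabolic cs h2 hu h₂).inv_left.eq
      calc u * (w₁ * w₂) * u⁻¹ = u * w₁ * (w₂ * u⁻¹) := by group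
        _ = u * w₁ * u⁻¹ * w₂ := by rw [← hc]; group
    rw [this]
    exact mul_mem (parabolic_mono cs Set.subset_union_left hmem)
      (parabolic_mono cs Set.subset_union_right h₂)

/-- A cuspidal element of a direct product is a product of cuspidal elements. -/
theorem IsCuspidal.exists_mul (cs : CoxeterSystem M W) {L I : Set B} (hLI : L ⊆ I)
    (h2 : ∀ a ∈ L, ∀ b ∈ I \ L, M a b = 2) {w : W} (hw : IsCuspidal cs I w) :
    ∃ w₁ w₂, w = w₁ * w₂ ∧ IsCuspidal cs L w₁ ∧ IsCuspidal cs (I \ L) w₂ := by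
  obtain ⟨w₁, h₁, w₂, h₂, rfl⟩ := exists_mul_of_mem_parabolic cs h2 hw.1
  refine ⟨w₁, w₂, rfl, hw.left_of_mul cs hLI h2 h₁ h₂, ?_⟩
  have hdiff : I \ (I \ L) = L := Set.sdiff_sdiff_cancel_left hLI
  rw [(commute_of_mem_parabolic cs h2 h₁ h₂).eq] at hw
  refine hw.left_of_mul cs Set.sdiff_subset ?_ h₂ (by rwa [hdiff])
  rw [hdiff]
  intro a ha b hb
  rw [M.symmetric]
  exact h2 b hb a ha

theorem exists_conj_mul (cs : CoxeterSystem M W) {L I : Set B} (hLI : L ⊆ I)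
    (h2 : ∀ a ∈ L, ∀ b ∈ I \ L, M a b = 2) {w₁ w₂ w₁' w₂' : W} (h₁ : w₁ ∈ parabolic cs L)
    (h₂ : w₂ ∈ parabolic cs (I \ L)) (h₁' : ∃ u ∈ parabolic cs L, u * w₁ * u⁻¹ = w₁')
    (h₂' : ∃ u ∈ parabolic cs (I \ L), u * w₂ * u⁻¹ = w₂') :
    ∃ u ∈ parabolic cs I, u * (w₁ * w₂) * u⁻¹ = w₁' * w₂' := by
  obtain ⟨u, hu, rfl⟩ := h₁'
  obtain ⟨v, hv, rfl⟩ := h₂'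
  refine ⟨u * v, mul_mem (parabolic_mono cs hLI hu) (parabolic_mono cs Set.sdiff_subset hv), ?_⟩
  have hc1 := (commute_of_mem_parabolic cs h2 h₁ hv).eq
  have hc2 := (commute_of_mem_parabolic cs h2 hu (mul_mem (mul_mem hv h₂) (inv_mem hv))).inv_left.eq
  calc u * v * (w₁ * w₂) * (u * v)⁻¹ = u * (v * w₁) * w₂ * v⁻¹ * u⁻¹ := by group
    _ = u * w₁ * ((v * w₂ * v⁻¹) * u⁻¹) := by rw [← hc1]; group
    _ = u * w₁ * u⁻¹ * (v * w₂ * v⁻¹) := by rw [← hc2]; group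

theorem FixesCuspidalClasses.of_split (cs : CoxeterSystem M W) {L I : Set B} (hLI : L ⊆ I)
    (h2 : ∀ a ∈ L, ∀ b ∈ I \ L, M a b = 2) {n : W} (h₁ : FixesCuspidalClasses cs L n)
    (h₂ : FixesCuspidalClasses cs (I \ L) n) : FixesCuspidalClasses cs I n := by
  intro w hw
  obtain ⟨w₁, w₂, rfl, hw₁, hw₂⟩ := hw.exists_mul cs hLI h2
  obtain ⟨u, hu, h⟩ := exists_conj_mul cs hLI h2 hw₁.1 hw₂.1 (h₁ _ hw₁) (h₂ _ hw₂)
  exact ⟨u, hu, by rw [h]; group⟩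

theorem PermutesBy.isCuspidal_conj [Finite W] {cs : CoxeterSystem M W} {I : Set B} {n : W}
    {σ : B → B} (h : PermutesBy cs I n σ) {w : W} (hw : IsCuspidal cs I w) :
    IsCuspidal cs I (n * w * n⁻¹) := by
  have hmem : ∀ v ∈ parabolic cs I, n * v * n⁻¹ ∈ parabolic cs I := by
    intro v hv
    refine parabolic_induction cs (p := fun v => n * v * n⁻¹ ∈ parabolic cs I) (by simp [one_mem])
      ?_ hv
    intro v _ i hi ih
    have : n * (v * cs.simple i) * n⁻¹ = n * v * n⁻¹ * (n * cs.simple i * n⁻¹) := by group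
    rw [this, (h i hi).2]
    exact mul_mem ih (simple_mem_parabolic cs (h i hi).1)
  have hinv : ∀ v ∈ parabolic cs I, ∀ K ⊆ I, v ∈ parabolic cs K →
      n⁻¹ * v * n ∈ parabolic cs {i | i ∈ I ∧ σ i ∈ K} := by
    intro v _ K hK hv
    refine parabolic_induction cs
      (p := fun v => n⁻¹ * v * n ∈ parabolic cs {i | i ∈ I ∧ σ i ∈ K}) (by simp [one_mem]) ?_ hv
    intro v _ j hj ih
    obtain ⟨i, hi, rfl⟩ := h.mem_image subset_rfl (fun i hi => (h i hi).1) (hK hj)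
    have : n⁻¹ * (v * cs.simple (σ i)) * n = n⁻¹ * v * n * cs.simple i := by
      rw [← (h i hi).2]; group
    rw [this]
    exact mul_mem ih (simple_mem_parabolic cs ⟨hi, hj⟩)
  refine ⟨hmem w hw.1, fun K hK u hu hK' => ?_⟩
  refine hw.2 {i | i ∈ I ∧ σ i ∈ K} ⟨fun i hi => hi.1, fun hsub => ?_⟩ (n⁻¹ * u * n) ?_ ?_
  · refine hK.2 fun j hj => ?_
    obtain ⟨i, hi, rfl⟩ := h.mem_image subset_rfl (fun i hi => (h i hi).1) hj
    exact (hsub hi).2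
  · exact parabolic_mono cs (fun i hi => hi.1) (hinv u hu I subset_rfl hu)
  · have := hinv _ (parabolic_mono cs hK.1 hK') K hK.1 hK'
    convert this using 1
    group

/-- Simple reflections joined by a path of odd edges are the only ones that can be conjugate. -/
theorem oddLinked_of_conj (cs : CoxeterSystem M W) {i j : B} {n : W}
    (h : n * cs.simple i * n⁻¹ = cs.simple j) :
    Relation.ReflTransGen (fun a b => Odd (M a b) ∧ a ≠ b) i j := by
  set R := Relation.ReflTransGen (fun a b => Odd (M a b) ∧ a ≠ b)
  have hsymm : ∀ a b, Odd (M a b) ∧ a ≠ b → Odd (M b a) ∧ b ≠ a := fun a b h =>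
    ⟨by rw [M.symmetric]; exact h.1, h.2.symm⟩
  set f : B → ℤˣ := fun k => if R i k then -1 else 1 with hf
  have hlift : M.IsLiftable f := by
    intro a b
    rcases Nat.even_or_odd (M a b) with he | ho
    · obtain ⟨k, hk⟩ := he
      rw [hk, ← two_mul, pow_mul, Int.units_sq, one_pow]
    · by_cases hab : a = b
      · subst hab
        rw [← sq, Int.units_sq, one_pow]
      · have : R i a ↔ R i b := ⟨fun h => h.tail ⟨ho, hab⟩, fun h => h.tail (hsymm _ _ ⟨ho, hab⟩)⟩
        have hfab : f a = f b := by simp only [hf, this]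
        rw [hfab, ← sq, Int.units_sq, one_pow]
  have h1 := congrArg (cs.lift ⟨f, hlift⟩) h
  rw [map_mul, map_mul, map_inv, cs.lift_apply_simple, cs.lift_apply_simple, mul_comm,
    inv_mul_cancel_left] at h1
  by_contra hR
  have hRi : R i i := Relation.ReflTransGen.refl
  simp only [hf, hRi, hR, if_true, if_false] at h1
  exact absurd h1 (by decide)

theorem three_le_of_odd {a b : B} (h : Odd (M a b) ∧ a ≠ b) : 3 ≤ M a b := by
  have h1 := M.off_diagonal a b h.2
  obtain ⟨k, hk⟩ := h.1
  omega

theorem PermutesBy.linked (cs : CoxeterSystem M W) {I : Set B} {n : W} {σ : B → B}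
    (h : PermutesBy cs I n σ) {i : B} (hi : i ∈ I) : Linked M i (σ i) :=
  (oddLinked_of_conj cs (h i hi).2).lift id fun _ _ => three_le_of_odd

end Split

/-! ### Diagrams without branch vertices and heavy edges -/

section Featureless

/-- A vertex with at least three neighbours in `I`. -/
def IsBranchIn (M : CoxeterMatrix B) (I : Set B) (x : B) : Prop :=
  ∃ a ∈ I, ∃ b ∈ I, ∃ c ∈ I, a ≠ b ∧ a ≠ c ∧ b ≠ c ∧ 3 ≤ M x a ∧ 3 ≤ M x b ∧ 3 ≤ M x c

theorem IsBranchIn.isBranch {I : Set B} {x : B} (h : IsBranchIn M I x) : IsBranch M x := by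
  obtain ⟨a, -, b, -, c, -, h⟩ := h
  exact ⟨a, b, c, h⟩

theorem IsBranchIn.mono {I J : Set B} (hIJ : I ⊆ J) {x : B} (h : IsBranchIn M I x) :
    IsBranchIn M J x := by
  obtain ⟨a, ha, b, hb, c, hc, h⟩ := h
  exact ⟨a, hIJ ha, b, hIJ hb, c, hIJ hc, h⟩

theorem exists_longest_list [Finite B] (P : List B → Prop) (hP : ∀ p, P p → p.Nodup)
    (h : ∃ p, P p) : ∃ p, P p ∧ ∀ q, P q → q.length ≤ p.length := by
  have := Fintype.ofFinite B
  have hb : ∀ k, (∃ p, P p ∧ p.length = k) → k ≤ Fintype.card B := by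
    rintro _ ⟨p, hp, rfl⟩
    exact (hP p hp).length_le_card
  obtain ⟨p₀, hp₀⟩ := h
  obtain ⟨p, hp, hlen⟩ := Nat.findGreatest_spec (P := fun k => ∃ p, P p ∧ p.length = k)
    (hb _ ⟨p₀, hp₀, rfl⟩) ⟨p₀, hp₀, rfl⟩
  refine ⟨p, hp, fun q hq => ?_⟩
  rw [hlen]
  exact Nat.le_findGreatest (hb _ ⟨q, hq, rfl⟩) ⟨q, hq, rfl⟩

/-- An interior vertex of a path with a neighbour off the path is a branch vertex. -/
theorem IsPath.isBranchIn_of_adj {p : List B} (hp : IsPath M p) {v c : B} (hv : v ∈ p)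
    (hc : c ∉ p) (hvc : 3 ≤ M v c) :
    p.head? = some v ∨ p.getLast? = some v ∨ IsBranchIn M (insert c {i | i ∈ p}) v := by
  obtain ⟨l₁, l₂, rfl⟩ := List.append_of_mem hv
  rcases List.eq_nil_or_concat l₁ with rfl | ⟨l, a, rfl⟩
  · exact Or.inl rfl
  rcases l₂ with _ | ⟨d, l'⟩
  · right; left
    simp
  right; right
  have hsub : [a, v, d] <:+: (l.concat a ++ v :: d :: l') := ⟨l, l', by simp⟩
  have hch := hp.2.infix hsub
  have hnd := hp.1.sublist hsub.sublist
  simp only [List.isChain_cons_cons] at hch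
  have had : a ≠ d := by
    rintro rfl
    simp at hnd
  have hac : a ≠ c := by
    rintro rfl
    exact hc (hsub.subset (by simp))
  have hdc : d ≠ c := by
    rintro rfl
    exact hc (hsub.subset (by simp))
  exact ⟨a, Or.inr (hsub.subset (by simp)), d, Or.inr (hsub.subset (by simp)), c, Or.inl rfl,
    had, hac, hdc, three_le_symm hch.1, hch.2.1, hvc⟩

theorem IsPath.cons_of_head? {p : List B} (hp : IsPath M p) {v c : B} (hv : p.head? = some v)
    (hc : c ∉ p) (hvc : 3 ≤ M v c) : IsPath M (c :: p) := by
  cases p with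
  | nil => simp at hv
  | cons a p =>
    obtain rfl : a = v := by simpa using hv
    exact isPath_cons_cons.2 ⟨hc, three_le_symm hvc, hp⟩

/-- In a disjoint union of type `A` diagrams, all cuspidal elements are conjugate. -/
theorem IsCuspidal.conj_of_featureless [Finite W] (cs : CoxeterSystem M W) {I : Set B}
    (hbr : ∀ x ∈ I, ¬IsBranchIn M I x) (h3 : ∀ i ∈ I, ∀ j ∈ I, M i j ≤ 3) {w w' : W}
    (hw : IsCuspidal cs I w) (hw' : IsCuspidal cs I w') :
    ∃ u ∈ parabolic cs I, u * w * u⁻¹ = w' := by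
  have hB := Finite.of_injective _ (simple_injective cs)
  induction I using WellFoundedLT.induction generalizing w w' with
  | ind I ih =>
  obtain ⟨p, ⟨hp, hpI⟩, hmax⟩ := exists_longest_list (fun p => IsPath M p ∧ ∀ i ∈ p, i ∈ I)
    (fun p hp => hp.1.1) ⟨[], ⟨by simp, by simp⟩, by simp⟩
  have hcl : ∀ v ∈ p, ∀ c ∈ I, c ∉ p → ¬3 ≤ M v c := by
    intro v hv c hcI hc hvc
    rcases hp.isBranchIn_of_adj hv hc hvc with h | h | h
    · have := hmax (c :: p) ⟨hp.cons_of_head? h hc hvc, by simpa [hcI] using hpI⟩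
      simp at this
    · have := hmax (c :: p.reverse) ⟨hp.reverse.cons_of_head? (by simpa using h) (by simpa) hvc,
        by simpa [hcI] using hpI⟩
      simp at this
    · exact hbr v (hpI v hv) (h.mono (Set.insert_subset hcI hpI))
  have hL : ∀ w w', IsCuspidal cs {i | i ∈ p} w → IsCuspidal cs {i | i ∈ p} w' →
      ∃ u ∈ parabolic cs {i | i ∈ p}, u * w * u⁻¹ = w' := fun w w' hw hw' =>
    IsCuspidal.conj_of_isChainA cs hp.1 ((hp.isLinear cs fun i hi j hj =>
      h3 i (hpI i hi) j (hpI j hj)).isChainA cs) hw hw'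
  by_cases hpe : {i | i ∈ p} = I
  · rw [hpe] at hL
    exact hL w w' hw hw'
  have hne : ∃ a, a ∈ p := by
    by_contra! hnil
    apply hpe
    ext i
    simp only [Set.mem_ofPred_eq, hnil, false_iff]
    intro hi
    have := hmax [i] ⟨⟨by simp, by simp⟩, by simpa using hi⟩
    rw [List.eq_nil_iff_forall_not_mem.2 hnil] at this
    simp at this
  obtain ⟨a, ha⟩ := hne
  have h2 : ∀ a ∈ {i | i ∈ p}, ∀ b ∈ I \ {i | i ∈ p}, M a b = 2 := fun a ha b hb =>
    eq_two_of_not_three_le cs (fun h => hb.2 (h ▸ ha)) (hcl a ha b hb.1 hb.2)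
  obtain ⟨w₁, w₂, rfl, hw₁, hw₂⟩ := hw.exists_mul cs hpI h2
  obtain ⟨w₁', w₂', rfl, hw₁', hw₂'⟩ := hw'.exists_mul cs hpI h2
  refine exists_conj_mul cs hpI h2 hw₁.1 hw₂.1 (hL _ _ hw₁ hw₁') ?_
  refine ih (I \ {i | i ∈ p}) ⟨Set.sdiff_subset, fun h => (h (hpI a ha)).2 ha⟩
    (fun x hx h => hbr x hx.1 (h.mono Set.sdiff_subset)) (fun i hi j hj => h3 i hi.1 j hj.1) hw₂ hw₂'

end Featureless

/-! ### Connected diagrams with a heavy edge -/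

section Heavy

/-- Every vertex in `I` is joined to `x` by a path in `I`. -/
def ConnectedFrom (M : CoxeterMatrix B) (I : Set B) (x : B) : Prop :=
  ∀ z ∈ I, Relation.ReflTransGen (fun a b => b ∈ I ∧ 3 ≤ M a b) x z

theorem Linked.symm {x y : B} (h : Linked M x y) : Linked M y x := by
  induction h with
  | refl => exact .refl
  | tail _ hbc ih => exact ih.head (three_le_symm hbc)

theorem ConnectedFrom.linked {I : Set B} {x z : B} (h : ConnectedFrom M I x) (hz : z ∈ I) :
    Linked M x z :=
  (h z hz).lift id fun _ _ h => h.2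

theorem ConnectedFrom.subset {I K : Set B} {x : B} (h : ConnectedFrom M I x) (hx : x ∈ K)
    (hK : ∀ v ∈ K, ∀ c ∈ I, 3 ≤ M v c → c ∈ K) : I ⊆ K := by
  intro z hz
  have h := h z hz
  clear hz
  induction h with
  | refl => exact hx
  | tail _ hbc ih => exact hK _ ih _ hbc.1 hbc.2

/-- An automorphism of a connected diagram fixing `x` and its neighbours, except for some leaves,
fixes everything but these leaves. -/
theorem PermutesBy.eq_or_mem_of_connected [Finite W] {cs : CoxeterSystem M W} {I : Set B} {n : W}
    {σ : B → B} (h : PermutesBy cs I n σ) {x : B} (hx : x ∈ I) (hconn : ConnectedFrom M I x)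
    (hσx : σ x = x) {S : Set B} (hS : ∀ i ∈ S, ∀ c ∈ I, 3 ≤ M i c → c = x)
    (hnb : ∀ c ∈ I, 3 ≤ M x c → σ c = c ∨ c ∈ S)
    (hbr : ∀ b ∈ I, b ≠ x → ¬IsBranchIn M I b) {i : B} (hi : i ∈ I) : σ i = i ∨ i ∈ S := by
  have hsub := hconn.subset
    (K := {z | z ∈ I ∧ (z ∈ S ∨ z = x ∨ σ z = z ∧ ∃ a ∈ I, 3 ≤ M z a ∧ σ a = a)})
    ⟨hx, Or.inr (Or.inl rfl)⟩ ?_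
  · rcases (hsub hi).2 with h | rfl | h
    · exact Or.inr h
    · exact Or.inl hσx
    · exact Or.inl h.1
  · rintro v ⟨hv, hv'⟩ c hc hvc
    refine ⟨hc, ?_⟩
    rcases hv' with hvS | rfl | ⟨hvσ, a, ha, hva, haσ⟩
    · exact Or.inr (Or.inl (hS v hvS c hc hvc))
    · rcases hnb c hc hvc with h | h
      · exact Or.inr (Or.inr ⟨h, v, hv, three_le_symm hvc, hσx⟩)
      · exact Or.inl h
    · by_cases hvx : v = x
      · subst hvx
        rcases hnb c hc hvc with h | h
        · exact Or.inr (Or.inr ⟨h, v, hv, three_le_symm hvc, hσx⟩)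
        · exact Or.inl h
      · refine Or.inr (Or.inr ⟨?_, v, hv, three_le_symm hvc, hvσ⟩)
        by_contra hcσ
        refine hbr v hv hvx ⟨a, ha, c, hc, σ c, (h c hc).1, ?_, ?_, Ne.symm hcσ, hva, hvc, ?_⟩
        · rintro rfl
          exact hcσ haσ
        · intro hac
          rw [← haσ] at hac
          exact hcσ (h.injOn ha hc hac ▸ haσ)
        · rw [← hvσ, h.matrix_eq hv hc]
          exact hvc

theorem PermutesBy.fixesCuspidalClasses_of_eq {cs : CoxeterSystem M W} {I : Set B} {n : W}
    {σ : B → B} (h : PermutesBy cs I n σ) (hσ : ∀ i ∈ I, σ i = i) :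
    FixesCuspidalClasses cs I n := by
  intro w hw
  refine ⟨1, one_mem _, conj_eq_conj_of_simple cs (fun i hi => ?_) hw.1⟩
  rw [(h i hi).2, hσ i hi]
  simp

theorem mul_zpow_mul_self {G : Type*} [Group G] {a b : G} (ha : a * a = 1) (hb : b * b = 1)
    (k : ℤ) : a * (a * b) ^ k = (a * b) ^ (-k) * a := by
  have h1 : a * (a * b) * a⁻¹ = (a * b)⁻¹ := by
    rw [mul_inv_rev, inv_eq_of_mul_eq_one_left ha, inv_eq_of_mul_eq_one_left hb, ← mul_assoc, ha,
      one_mul]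
  have h2 : a * (a * b) ^ k * a⁻¹ = (a * b) ^ (-k) := by
    rw [← conj_zpow, h1, zpow_neg, inv_zpow]
  rw [← h2]
  group

theorem exists_zpow_of_mem_parabolic_pair (cs : CoxeterSystem M W) {x y : B} {w : W}
    (hw : w ∈ parabolic cs {x, y}) :
    ∃ k : ℤ, w = (cs.simple x * cs.simple y) ^ k ∨
      w = (cs.simple x * cs.simple y) ^ k * cs.simple x := by
  refine parabolic_induction cs (p := fun w => ∃ k : ℤ, w = (cs.simple x * cs.simple y) ^ k ∨
    w = (cs.simple x * cs.simple y) ^ k * cs.simple x) ⟨0, by simp⟩ ?_ hw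
  rintro w - i hi ⟨k, rfl | rfl⟩
  · rcases hi with rfl | rfl
    · exact ⟨k, Or.inr rfl⟩
    · refine ⟨k - 1, Or.inr ?_⟩
      rw [zpow_sub_one]
      simp [mul_assoc]
  · rcases hi with rfl | rfl
    · exact ⟨k, Or.inl (by simp)⟩
    · refine ⟨k + 1, Or.inl ?_⟩
      rw [zpow_add_one]
      simp [mul_assoc]

/-- The case of a dihedral group. -/
theorem fixesCuspidalClasses_pair (cs : CoxeterSystem M W) {x y : B} (hxy : x ≠ y) {n : W}
    (hx : n * cs.simple x * n⁻¹ = cs.simple y) (hy : n * cs.simple y * n⁻¹ = cs.simple x) :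
    FixesCuspidalClasses cs {x, y} n := by
  intro w hw
  have hsx : cs.simple x ∈ parabolic cs {x, y} := simple_mem_parabolic cs (by simp)
  have hsy : cs.simple y ∈ parabolic cs {x, y} := simple_mem_parabolic cs (by simp)
  have haa := cs.simple_mul_simple_self x
  have hbb := cs.simple_mul_simple_self y
  obtain ⟨k, rfl | rfl⟩ := exists_zpow_of_mem_parabolic_pair cs hw.1
  · refine ⟨cs.simple x, hsx, ?_⟩
    have h1 : n * (cs.simple x * cs.simple y) * n⁻¹ = cs.simple y * cs.simple x := by
      rw [← conj_mul, hx, hy]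
    rw [← conj_zpow, ← conj_zpow, h1]
    simp
  · exfalso
    have hpow : ∀ j : ℤ, (cs.simple x * cs.simple y) ^ j ∈ parabolic cs {x, y} := fun j =>
      zpow_mem (mul_mem hsx hsy) j
    obtain ⟨j, rfl | rfl⟩ := Int.even_or_odd' k
    · refine hw.2 {x} ⟨by simp, fun h => hxy.symm (by simpa using h (by simp : y ∈ _))⟩ _
        (hpow (-j)) ?_
      have : (cs.simple x * cs.simple y) ^ (-j) * ((cs.simple x * cs.simple y) ^ (2 * j) *
          cs.simple x) * ((cs.simple x * cs.simple y) ^ (-j))⁻¹ = cs.simple x := by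
        rw [← mul_assoc, ← zpow_add, ← zpow_neg, mul_assoc, mul_zpow_mul_self haa hbb, ← mul_assoc,
          ← zpow_add]
        rw [show -j + 2 * j + -(- -j) = 0 by ring, zpow_zero, one_mul]
      rw [this]
      exact simple_mem_parabolic cs rfl
    · refine hw.2 {y} ⟨by simp, fun h => hxy (by simpa using h (by simp : x ∈ _))⟩ _
        (mul_mem hsx (hpow (-j))) ?_
      have : cs.simple x * (cs.simple x * cs.simple y) ^ (-j) *
          ((cs.simple x * cs.simple y) ^ (2 * j + 1) * cs.simple x) *
          (cs.simple x * (cs.simple x * cs.simple y) ^ (-j))⁻¹ = cs.simple y := by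
        have h1 : (cs.simple x * cs.simple y) ^ (-j) * ((cs.simple x * cs.simple y) ^ (2 * j + 1) *
          cs.simple x) * ((cs.simple x * cs.simple y) ^ (-j))⁻¹ =
            cs.simple x * cs.simple y * cs.simple x := by
          rw [← mul_assoc, ← zpow_add, ← zpow_neg, mul_assoc, mul_zpow_mul_self haa hbb,
            ← mul_assoc, ← zpow_add, show -j + (2 * j + 1) + -(- -j) = 1 by ring, zpow_one]
        calc _ = cs.simple x * ((cs.simple x * cs.simple y) ^ (-j) *
                  ((cs.simple x * cs.simple y) ^ (2 * j + 1) * cs.simple x) *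
                  ((cs.simple x * cs.simple y) ^ (-j))⁻¹) * (cs.simple x)⁻¹ := by group
          _ = cs.simple y := by
            rw [h1]
            simp [mul_assoc]
      rw [this]
      exact simple_mem_parabolic cs rfl

theorem odd_of_conj [Finite W] (cs : CoxeterSystem M W) {x y : B} (hxy : 3 ≤ M x y) {n : W}
    (h : n * cs.simple x * n⁻¹ = cs.simple y) : Odd (M x y) := by
  obtain ⟨p, hnd, hch, hlast⟩ := exists_path_of_reflTransGen (oddLinked_of_conj cs h)
  cases p with
  | nil => exact absurd hlast (ne_of_three_le hxy)
  | cons c p =>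
    rw [List.isChain_cons_cons] at hch
    rw [List.nodup_cons] at hnd
    have hy : y ∈ c :: p := by
      rw [← hlast, List.getLast_cons (by simp)]
      exact List.getLast_mem _
    have hp : IsPath M (c :: p) := ⟨hnd.2, hch.2.imp fun _ _ => three_le_of_odd⟩
    obtain rfl := hp.eq_of_adj cs hnd.1 (by simp) hy (three_le_of_odd hch.1) hxy
    exact hch.1.1

theorem isPath_four [Finite W] (cs : CoxeterSystem M W) {z x y w : B} (hzx : 3 ≤ M z x)
    (hxy : 3 ≤ M x y) (hyw : 3 ≤ M y w) (hzy : z ≠ y) (hxw : x ≠ w) : IsPath M [z, x, y, w] := by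
  refine IsPath.cons cs (IsPath.cons cs ⟨?_, ?_⟩ hxy ?_) hzx ?_
  · simpa using ne_of_three_le hyw
  · simpa using hyw
  · simpa using hxw
  · simpa using hzy

theorem PermutesBy.fixesCuspidalClasses_of_heavy [Finite W] {cs : CoxeterSystem M W} {I : Set B}
    {n : W} {σ : B → B} (h : PermutesBy cs I n σ) {x y : B} (hx : x ∈ I) (hy : y ∈ I)
    (hxy : 4 ≤ M x y) (hconn : ConnectedFrom M I x) : FixesCuspidalClasses cs I n := by
  have hbr : ∀ b ∈ I, ¬IsBranchIn M I b := fun b hb hb' =>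
    hb'.isBranch.not_heavy cs (hconn.linked hb).symm hxy
  have h3 : 3 ≤ M x y := by omega
  rcases heavy_edge_unique cs hxy (by rwa [h.matrix_eq hx hy]) (h.linked cs hx) with
    ⟨hσx, hσy⟩ | ⟨hσy, hσx⟩
  · refine h.fixesCuspidalClasses_of_eq fun i hi => ?_
    refine (h.eq_or_mem_of_connected hx hconn hσx.symm (S := ∅) (by simp) (fun c hc hxc => ?_)
      (fun b hb _ => hbr b hb) hi).resolve_right (by simp)
    left
    by_contra hcσ
    refine hbr x hx ⟨y, hy, c, hc, σ c, (h c hc).1, ?_, ?_, Ne.symm hcσ, h3, hxc, ?_⟩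
    · rintro rfl
      exact hcσ hσy.symm
    · intro hac
      rw [hσy] at hac
      exact hcσ (h.injOn hy hc hac ▸ hσy.symm)
    · rw [hσx, h.matrix_eq hx hc]
      exact hxc
  · have hodd := odd_of_conj cs h3 (hσx ▸ (h x hx).2)
    have h5 : 5 ≤ M x y := by
      obtain ⟨k, hk⟩ := hodd
      omega
    have hI : I = {x, y} := by
      refine Set.Subset.antisymm (hconn.subset (by simp) ?_) ?_
      · rintro v (rfl | rfl) z hz hvz
        · by_contra hzy
          simp only [Set.mem_insert_iff, Set.mem_singleton_iff, not_or] at hzy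
          refine not_path_five cs (isPath_four cs (three_le_symm hvz) h3 (w := σ z) ?_ hzy.2 ?_) h5
          · rw [hσx, h.matrix_eq hx hz]
            exact hvz
          · intro he
            rw [hσy] at he
            exact hzy.2 (h.injOn hz hy he.symm)
        · by_contra hzy
          simp only [Set.mem_insert_iff, Set.mem_singleton_iff, not_or] at hzy
          refine not_path_five cs (isPath_four cs (z := σ z) ?_ h3 hvz ?_ (Ne.symm hzy.1)) h5
          · rw [hσy, M.symmetric, h.matrix_eq hy hz]
            exact hvz
          · intro he
            rw [hσx] at he
            exact hzy.1 (h.injOn hz hx he)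
      · rintro v (rfl | rfl)
        · exact hx
        · exact hy
    have h1 := (h x hx).2
    have h2 := (h y hy).2
    rw [← hσx] at h1
    rw [← hσy] at h2
    rw [hI]
    exact fixesCuspidalClasses_pair cs (ne_of_three_le h3) h1 h2

end Heavy

/-! ### Connected diagrams with a branch vertex -/

section Branch

/-- The connected diagram `I` has the branch vertex `x` with neighbours `a`, `b`, `c`. -/
structure IsFork (M : CoxeterMatrix B) (I : Set B) (x a b c : B) : Prop where
  mem : x ∈ I
  conn : ConnectedFrom M I x
  mem_a : a ∈ I
  mem_b : b ∈ I
  mem_c : c ∈ I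
  hab : a ≠ b
  hac : a ≠ c
  hbc : b ≠ c
  xa : 3 ≤ M x a
  xb : 3 ≤ M x b
  xc : 3 ≤ M x c

namespace IsFork

variable {I : Set B} {x a b c : B}

theorem rotate (h : IsFork M I x a b c) : IsFork M I x b c a :=
  ⟨h.mem, h.conn, h.mem_b, h.mem_c, h.mem_a, h.hbc, h.hab.symm, h.hac.symm, h.xb, h.xc, h.xa⟩

theorem swap (h : IsFork M I x a b c) : IsFork M I x b a c :=
  ⟨h.mem, h.conn, h.mem_b, h.mem_a, h.mem_c, h.hab.symm, h.hbc, h.hac, h.xb, h.xa, h.xc⟩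

theorem isBranchIn (h : IsFork M I x a b c) : IsBranchIn M I x :=
  ⟨a, h.mem_a, b, h.mem_b, c, h.mem_c, h.hab, h.hac, h.hbc, h.xa, h.xb, h.xc⟩

theorem le_three [Finite W] (cs : CoxeterSystem M W) (h : IsFork M I x a b c) :
    ∀ i ∈ I, ∀ j ∈ I, M i j ≤ 3 := by
  intro i hi j _
  by_contra h4
  exact h.isBranchIn.isBranch.not_heavy cs (h.conn.linked hi) (by omega : 4 ≤ M i j)

theorem not_isBranchIn [Finite W] (cs : CoxeterSystem M W) (h : IsFork M I x a b c) {v : B}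
    (hv : v ∈ I) (hvx : v ≠ x) : ¬IsBranchIn M I v := fun hb =>
  hvx (h.isBranchIn.isBranch.unique cs hb.isBranch (h.conn.linked hv)).symm

theorem eq_of_adj [Finite W] (cs : CoxeterSystem M W) (h : IsFork M I x a b c) {d : B}
    (hd : 3 ≤ M x d) : d = a ∨ d = b ∨ d = c :=
  eq_or_eq_of_adj_of_branch cs h.hab h.hac h.hbc h.xa h.xb h.xc hd

theorem not_adj [Finite W] (cs : CoxeterSystem M W) (h : IsFork M I x a b c) : ¬3 ≤ M a b := by
  intro hab
  refine ne_of_three_le h.xb (IsPath.eq_of_adj cs (p := [x, b])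
    ⟨by simpa using ne_of_three_le h.xb, by simpa using h.xb⟩ (v := a) ?_ (by simp) (by simp)
    (three_le_symm h.xa) hab)
  simpa using ⟨(ne_of_three_le h.xa).symm, h.hab⟩

theorem isPath [Finite W] (cs : CoxeterSystem M W) (h : IsFork M I x a b c) :
    IsPath M [c, x, a] := by
  refine IsPath.cons cs ⟨?_, ?_⟩ (three_le_symm h.xc) ?_
  · simpa using ne_of_three_le h.xa
  · simpa using h.xa
  · simpa using h.hac.symm

variable {cs : CoxeterSystem M W} {n : W} {σ : B → B}

theorem apply_center [Finite W] (h : IsFork M I x a b c) (hσ : PermutesBy cs I n σ) :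
    σ x = x := by
  have hb : IsBranchIn M I (σ x) := by
    refine ⟨σ a, (hσ a h.mem_a).1, σ b, (hσ b h.mem_b).1, σ c, (hσ c h.mem_c).1,
      hσ.injOn.ne h.mem_a h.mem_b h.hab, hσ.injOn.ne h.mem_a h.mem_c h.hac,
      hσ.injOn.ne h.mem_b h.mem_c h.hbc, ?_, ?_, ?_⟩
    · rw [hσ.matrix_eq h.mem h.mem_a]
      exact h.xa
    · rw [hσ.matrix_eq h.mem h.mem_b]
      exact h.xb
    · rw [hσ.matrix_eq h.mem h.mem_c]
      exact h.xc
  by_contra hx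
  exact h.not_isBranchIn cs (hσ x h.mem).1 hx hb

theorem apply_arm [Finite W] (h : IsFork M I x a b c) (hσ : PermutesBy cs I n σ) :
    σ a = a ∨ σ a = b ∨ σ a = c := by
  refine h.eq_of_adj cs ?_
  rw [← h.apply_center hσ, hσ.matrix_eq h.mem h.mem_a]
  exact h.xa

theorem leaf_apply [Finite W] (h : IsFork M I x a b c) (hσ : PermutesBy cs I n σ)
    (ha : ∀ z ∈ I, 3 ≤ M a z → z = x) (z : B) (hz : z ∈ I) (hσa : 3 ≤ M (σ a) z) : z = x := by
  obtain ⟨z, hz', rfl⟩ := hσ.mem_image subset_rfl (fun i hi => (hσ i hi).1) hz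
  rw [hσ.matrix_eq h.mem_a hz'] at hσa
  rw [ha z hz' hσa, h.apply_center hσ]

theorem fixesCuspidal_swap [Finite W] (cs : CoxeterSystem M W) (h : IsFork M I x a b c)
    (ha : ∀ z ∈ I, 3 ≤ M a z → z = x) (hb : ∀ z ∈ I, 3 ≤ M b z → z = x) :
    FixesCuspidal (subdiagram M I) (Equiv.swap (⟨a, h.mem_a⟩ : I) ⟨b, h.mem_b⟩) := by
  have hB := Finite.of_injective _ (simple_injective cs)
  obtain ⟨p, ⟨hp, hpI, hpb, t, rfl⟩, hmax⟩ := exists_longest_list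
    (fun p => IsPath M p ∧ (∀ i ∈ p, i ∈ I) ∧ b ∉ p ∧ [c, x, a] <:+ p) (fun p hp => hp.1.1)
    ⟨[c, x, a], h.isPath cs, by simp [h.mem, h.mem_a, h.mem_c],
      by simp [h.hab.symm, h.hbc, (ne_of_three_le h.xb).symm], List.suffix_rfl⟩
  have hsub : I ⊆ {i | i ∈ t ++ [c, x, a] ∨ i = b} := by
    refine h.conn.subset (by simp) ?_
    rintro v (hv | rfl) d hd hvd
    · by_contra! hdp
      simp only [Set.mem_ofPred_eq, not_or] at hdp
      rcases hp.isBranchIn_of_adj hv hdp.1 hvd with hh | hh | hh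
      · have := hmax (d :: (t ++ [c, x, a])) ⟨hp.cons_of_head? hh hdp.1 hvd,
          by simpa [hd] using hpI, by simpa [Ne.symm hdp.2] using hpb,
          ⟨d :: t, by simp⟩⟩
        simp at this
      · have hav : a = v := by simpa using hh
        subst hav
        have := ha d hd hvd
        simp [this] at hdp
      · have hvx : v = x := by
          by_contra hvx
          exact h.not_isBranchIn cs (hpI v hv) hvx (hh.mono (Set.insert_subset hd hpI))
        subst hvx
        rcases h.eq_of_adj cs hvd with rfl | rfl | rfl <;> simp at hdp
    · left
      rw [hb d hd hvd]
      simp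
  have hl : t ++ [c, x] ++ [a] = t ++ [c, x, a] := by simp
  refine _root_.fixesCuspidal_swap cs (l := t ++ [c, x]) ?_ (h.le_three cs) ?_ ?_ ?_ ?_
  · rwa [hl]
  · intro i
    rw [hl]
    refine ⟨fun hi => hsub hi, ?_⟩
    rintro (hi | rfl)
    · exact hpI i hi
    · exact h.mem_b
  · rwa [hl]
  · exact eq_two_of_not_three_le cs h.hab (h.not_adj cs)
  · intro i hi
    have hiI : i ∈ I := hpI i (by rw [← hl]; exact List.mem_append_left _ hi)
    have hia : i ≠ a := by
      rintro rfl
      have := hp.1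
      rw [← hl, List.nodup_append] at this
      exact this.2.2 _ hi _ (by simp) rfl
    have hib : i ≠ b := by
      rintro rfl
      exact hpb (by rw [← hl]; exact List.mem_append_left _ hi)
    change M i a = M i b
    by_cases hix : i = x
    · subst hix
      have h1 := h.le_three cs i h.mem a h.mem_a
      have h2 := h.le_three cs i h.mem b h.mem_b
      have h3 := h.xa
      have h4 := h.xb
      omega
    · rw [eq_two_of_not_three_le cs hia fun h' => hix (ha i hiI (three_le_symm h')),
        eq_two_of_not_three_le cs hib fun h' => hix (hb i hiI (three_le_symm h'))]

theorem fixesCuspidalClasses_of_swap_leaves [Finite W] (h : IsFork M I x a b c)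
    (hσ : PermutesBy cs I n σ) (hσa : σ a = b) (hσb : σ b = a) (hσc : σ c = c)
    (ha : ∀ z ∈ I, 3 ≤ M a z → z = x) : FixesCuspidalClasses cs I n := by
  have hb : ∀ z ∈ I, 3 ≤ M b z → z = x := hσa ▸ h.leaf_apply hσ ha
  have hfix : ∀ i ∈ I, σ i = i ∨ i ∈ ({a, b} : Set B) := fun i hi =>
    hσ.eq_or_mem_of_connected h.mem h.conn (h.apply_center hσ)
      (by rintro v (rfl | rfl); exacts [ha, hb])
      (fun d _ hd => by rcases h.eq_of_adj cs hd with rfl | rfl | rfl <;> simp [hσc])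
      (fun v hv hvx => h.not_isBranchIn cs hv hvx) hi
  refine fun w hw => (h.fixesCuspidal_swap cs ha hb).exists_conj cs (fun i => ?_) hw
  rw [(hσ i i.2).2]
  congr 1
  by_cases hia : i = ⟨a, h.mem_a⟩
  · subst hia
    rw [Equiv.swap_apply_left]
    exact hσa
  by_cases hib : i = ⟨b, h.mem_b⟩
  · subst hib
    rw [Equiv.swap_apply_right]
    exact hσb
  rw [Equiv.swap_apply_of_ne_of_ne hia hib]
  refine (hfix i i.2).resolve_right ?_
  rintro (h' | h')
  · exact hia (Subtype.ext h')
  · exact hib (Subtype.ext h')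

theorem commute_of_not_adj [Finite W] (cs : CoxeterSystem M W) {i j : B} (h : ¬3 ≤ M i j) :
    Commute (cs.simple i) (cs.simple j) := by
  by_cases hij : i = j
  · rw [hij]
  · exact commute_simple_of_eq_two cs (eq_two_of_not_three_le cs hij h)

/-- The case of a type `E₆` diagram. -/
theorem fixesCuspidalClasses_of_swap_long [Finite W] (h : IsFork M I x a b c)
    (hσ : PermutesBy cs I n σ) (hσa : σ a = b) (hσb : σ b = a) (hσc : σ c = c) {y z : B}
    (hy : y ∈ I) (hay : 3 ≤ M a y) (hyx : y ≠ x) (hz : σ y = z) : FixesCuspidalClasses cs I n := by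
  have hσx := h.apply_center hσ
  have hzI : z ∈ I := hz ▸ (hσ y hy).1
  have hbz : 3 ≤ M b z := by rwa [← hz, ← hσa, hσ.matrix_eq h.mem_a hy]
  have hzx : z ≠ x := by
    rintro rfl
    exact hyx (hσ.injOn hy h.mem (hz.trans hσx.symm))
  have hc : ∀ d ∈ I, 3 ≤ M c d → d = x := by
    intro d _ hd
    by_contra hdx
    exact false_of_affine_six cs h.hab h.hac h.hbc h.xa h.xb h.xc hay hbz hd hyx hzx hdx
  have hya : ∀ d ∈ I, 3 ≤ M y d → d = a := by
    intro d hd hyd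
    by_contra hda
    refine false_of_affine_seven cs h.hab h.hac h.hbc h.xa h.xb h.xc hay hbz hyd
      (b'' := σ d) ?_ hyx hzx hda ?_
    · rwa [← hz, hσ.matrix_eq hy hd]
    · rw [← hσa]
      exact hσ.injOn.ne hd h.mem_a hda
  have hzb : ∀ d ∈ I, 3 ≤ M z d → d = b := by
    intro d hd hzd
    obtain ⟨d, hd', rfl⟩ := hσ.mem_image subset_rfl (fun i hi => (hσ i hi).1) hd
    rw [← hz, hσ.matrix_eq hy hd'] at hzd
    rw [hya d hd' hzd, hσa]
  have ha : ∀ d ∈ I, 3 ≤ M a d → d = x ∨ d = y := by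
    intro d hd had
    by_contra! hd'
    exact h.not_isBranchIn cs h.mem_a (ne_of_three_le h.xa).symm ⟨x, h.mem, y, hy, d, hd, hyx.symm,
      hd'.1.symm, hd'.2.symm, three_le_symm h.xa, hay, had⟩
  have hb : ∀ d ∈ I, 3 ≤ M b d → d = x ∨ d = z := by
    intro d hd had
    by_contra! hd'
    exact h.not_isBranchIn cs h.mem_b (ne_of_three_le h.xb).symm ⟨x, h.mem, z, hzI, d, hd, hzx.symm,
      hd'.1.symm, hd'.2.symm, three_le_symm h.xb, hbz, had⟩
  have hI : ∀ i ∈ I, i = x ∨ i = a ∨ i = b ∨ i = c ∨ i = y ∨ i = z := by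
    refine h.conn.subset (K := {i | i = x ∨ i = a ∨ i = b ∨ i = c ∨ i = y ∨ i = z}) (by simp) ?_
    rintro v (rfl | rfl | rfl | rfl | rfl | rfl) d hd hvd
    · rcases h.eq_of_adj cs hvd with h | h | h <;> simp [h]
    · rcases ha d hd hvd with h | h <;> simp [h]
    · rcases hb d hd hvd with h | h <;> simp [h]
    · simp [hc d hd hvd]
    · simp [hya d hd hvd]
    · simp [hzb d hd hvd]
  have hyz : y ≠ z := by
    rintro rfl
    exact h.hab (hzb a h.mem_a (three_le_symm hay))
  have n1 : ¬3 ≤ M a b := h.not_adj cs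
  have n2 : ¬3 ≤ M b c := h.rotate.not_adj cs
  have n3 : ¬3 ≤ M c a := h.rotate.rotate.not_adj cs
  have n4 : ¬3 ≤ M y x := fun h' => ne_of_three_le h.xa (hya x h.mem h')
  have n5 : ¬3 ≤ M z x := fun h' => ne_of_three_le h.xb (hzb x h.mem h')
  have n6 : ¬3 ≤ M z a := fun h' => h.hab (hzb a h.mem_a h')
  have n7 : ¬3 ≤ M y b := fun h' => h.hab (hya b h.mem_b h').symm
  have n8 : ¬3 ≤ M y c := fun h' => h.hac (hya c h.mem_c h').symm
  have n9 : ¬3 ≤ M z c := fun h' => h.hbc (hzb c h.mem_c h').symm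
  have n10 : ¬3 ≤ M y z := fun h' => n1 (three_le_symm (hya z hzI h' ▸ hbz))
  have hσz : σ z = y := by
    refine (ha _ (hσ z hzI).1 ?_).resolve_left ?_
    · rwa [← hσb, hσ.matrix_eq h.mem_b hzI]
    · rw [← hσx]
      exact hσ.injOn.ne hzI h.mem hzx
  set v : Fin 6 → B := ![x, a, b, c, y, z] with hv
  have hvI : ∀ p, v p ∈ I := by
    intro p
    fin_cases p
    exacts [h.mem, h.mem_a, h.mem_b, h.mem_c, hy, hzI]
  have hadj : ∀ p q, esixAdj p q = true ↔ 3 ≤ M (v p) (v q) := by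
    intro p q
    fin_cases p <;> fin_cases q <;>
      simp [hv, esixAdj, h.xa, h.xb, h.xc, hay, hbz, M.symmetric a x, M.symmetric b x,
        M.symmetric c x, M.symmetric y a, M.symmetric z b, n1, n2, n3, n4, n5, n6, n7, n8, n9, n10,
        M.symmetric b a, M.symmetric c b, M.symmetric a c, M.symmetric x y, M.symmetric x z,
        M.symmetric a z, M.symmetric b y, M.symmetric c y, M.symmetric c z, M.symmetric z y]
  have hflip : ∀ p, σ (v p) = v (esixFlip p) := by
    intro p
    fin_cases p
    exacts [hσx, hσa, hσb, hσc, hz, hσz]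
  have hword := esixWord_prod_mul (s := fun p => cs.simple (v p))
    (fun p q hpq => braid_simple_of_eq_three cs
      (le_antisymm (h.le_three cs _ (hvI p) _ (hvI q)) ((hadj p q).1 hpq)))
    (fun p q hpq => commute_of_not_adj cs fun h3 => by simp [(hadj p q).2 h3] at hpq)
  set g := (esixWord.map fun p => cs.simple (v p)).prod
  have hg : g ∈ parabolic cs I := by
    refine list_prod_mem ?_
    simp only [List.mem_map]
    rintro _ ⟨p, -, rfl⟩
    exact simple_mem_parabolic cs (hvI p)
  refine fun w hw => ⟨g, hg, conj_eq_conj_of_simple cs (fun i hi => ?_) hw.1⟩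
  obtain ⟨p, rfl⟩ : ∃ p, v p = i := by
    rcases hI i hi with rfl | rfl | rfl | rfl | rfl | rfl
    exacts [⟨0, rfl⟩, ⟨1, rfl⟩, ⟨2, rfl⟩, ⟨3, rfl⟩, ⟨4, rfl⟩, ⟨5, rfl⟩]
  rw [(hσ _ hi).2, hflip, hword]
  group

theorem fixesCuspidalClasses_of_swap [Finite W] (h : IsFork M I x a b c)
    (hσ : PermutesBy cs I n σ) (hσa : σ a = b) (hσb : σ b = a) (hσc : σ c = c) :
    FixesCuspidalClasses cs I n := by
  by_cases ha : ∀ z ∈ I, 3 ≤ M a z → z = x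
  · exact h.fixesCuspidalClasses_of_swap_leaves hσ hσa hσb hσc ha
  · push Not at ha
    obtain ⟨y, hy, hay, hyx⟩ := ha
    exact h.fixesCuspidalClasses_of_swap_long hσ hσa hσb hσc hy hay hyx rfl

/-- Triality in type `D₄`. -/
theorem fixesCuspidalClasses_of_cycle [Finite W] (h : IsFork M I x a b c)
    (hσ : PermutesBy cs I n σ) (hσa : σ a = b) (hσb : σ b = c) (hσc : σ c = a) :
    FixesCuspidalClasses cs I n := by
  have hσx := h.apply_center hσ
  have ha : ∀ z ∈ I, 3 ≤ M a z → z = x := by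
    intro z hz haz
    by_contra hzx
    have h1 := (hσ z hz).1
    refine false_of_affine_six cs h.hab h.hac h.hbc h.xa h.xb h.xc haz (b' := σ z)
      (c' := σ (σ z)) ?_ ?_ hzx ?_ ?_
    · rwa [← hσa, hσ.matrix_eq h.mem_a hz]
    · rwa [← hσb, ← hσa, hσ.matrix_eq (hσ a h.mem_a).1 h1, hσ.matrix_eq h.mem_a hz]
    · rw [← hσx]
      exact hσ.injOn.ne hz h.mem hzx
    · rw [← hσx]
      refine hσ.injOn.ne h1 h.mem ?_
      nth_rewrite 1 [← hσx]
      exact hσ.injOn.ne hz h.mem hzx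
  have hb : ∀ z ∈ I, 3 ≤ M b z → z = x := hσa ▸ h.leaf_apply hσ ha
  have hc : ∀ z ∈ I, 3 ≤ M c z → z = x := hσb ▸ h.rotate.leaf_apply hσ hb
  have hI : ∀ i ∈ I, i = x ∨ i = a ∨ i = b ∨ i = c := by
    refine h.conn.subset (K := {i | i = x ∨ i = a ∨ i = b ∨ i = c}) (by simp) ?_
    rintro v (rfl | rfl | rfl | rfl) d hd hvd
    · rcases h.eq_of_adj cs hvd with h | h | h <;> simp [h]
    · simp [ha d hd hvd]
    · simp [hb d hd hvd]
    · simp [hc d hd hvd]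
  refine fun w hw => ((h.fixesCuspidal_swap cs ha hb).mul
    (h.rotate.fixesCuspidal_swap cs hb hc)).exists_conj cs (fun i => ?_) hw
  rw [(hσ i i.2).2, Equiv.Perm.mul_apply]
  congr 1
  obtain ⟨i, hi⟩ := i
  have hxa := ne_of_three_le h.xa
  have hxb := ne_of_three_le h.xb
  have hxc := ne_of_three_le h.xc
  rcases hI i hi with rfl | rfl | rfl | rfl
  · rw [Equiv.swap_apply_of_ne_of_ne (a := (⟨b, h.mem_b⟩ : I)) (by simpa) (by simpa),
      Equiv.swap_apply_of_ne_of_ne (by simpa) (by simpa)]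
    exact hσx
  · rw [Equiv.swap_apply_of_ne_of_ne (a := (⟨b, h.mem_b⟩ : I)) (by simpa using h.hab)
        (by simpa using h.hac),
      Equiv.swap_apply_left]
    exact hσa
  · rw [Equiv.swap_apply_left (⟨_, h.mem_b⟩ : I),
      Equiv.swap_apply_of_ne_of_ne (by simpa using h.hac.symm) (by simpa using h.hbc.symm)]
    exact hσb
  · rw [Equiv.swap_apply_right, Equiv.swap_apply_right]
    exact hσc

theorem fixesCuspidalClasses_of_fixed [Finite W] (h : IsFork M I x a b c)
    (hσ : PermutesBy cs I n σ) (hσa : σ a = a) (hσb : σ b = b) (hσc : σ c = c) :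
    FixesCuspidalClasses cs I n := by
  refine hσ.fixesCuspidalClasses_of_eq fun i hi => ?_
  refine (hσ.eq_or_mem_of_connected h.mem h.conn (h.apply_center hσ) (S := ∅) (by simp)
    (fun d _ hd => ?_) (fun v hv hvx => h.not_isBranchIn cs hv hvx) hi).resolve_right (by simp)
  rcases h.eq_of_adj cs hd with rfl | rfl | rfl
  exacts [Or.inl hσa, Or.inl hσb, Or.inl hσc]

theorem fixesCuspidalClasses [Finite W] (h : IsFork M I x a b c) (hσ : PermutesBy cs I n σ) :
    FixesCuspidalClasses cs I n := by
  have hne1 := hσ.injOn.ne h.mem_a h.mem_b h.hab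
  have hne2 := hσ.injOn.ne h.mem_a h.mem_c h.hac
  have hne3 := hσ.injOn.ne h.mem_b h.mem_c h.hbc
  rcases h.apply_arm hσ with h1 | h1 | h1 <;> rcases h.rotate.apply_arm hσ with h2 | h2 | h2 <;>
    rcases h.rotate.rotate.apply_arm hσ with h3 | h3 | h3
  all_goals first
    | exact absurd (h1.trans h2.symm) hne1
    | exact absurd (h1.trans h3.symm) hne2
    | exact absurd (h2.trans h3.symm) hne3
    | exact h.fixesCuspidalClasses_of_fixed hσ h1 h2 h3
    | exact h.fixesCuspidalClasses_of_swap hσ h1 h2 h3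
    | exact h.rotate.fixesCuspidalClasses_of_swap hσ h2 h3 h1
    | exact h.rotate.rotate.fixesCuspidalClasses_of_swap hσ h3 h1 h2
    | exact h.fixesCuspidalClasses_of_cycle hσ h1 h2 h3
    | exact h.swap.fixesCuspidalClasses_of_cycle hσ h2 h1 h3

end IsFork

end Branch

/-! ### Conjugacy of cuspidal elements -/

section Main

theorem PermutesBy.fixesCuspidalClasses [Finite W] (cs : CoxeterSystem M W) {I : Set B} {n : W}
    {σ : B → B} (h : PermutesBy cs I n σ) : FixesCuspidalClasses cs I n := by
  have hB := Finite.of_injective _ (simple_injective cs)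
  induction I using WellFoundedLT.induction with
  | ind I ih =>
  have key : ∀ x ∈ I, Relation.ReflTransGen (fun a b => b ∈ I ∧ 3 ≤ M a b) x (σ x) →
      ¬ConnectedFrom M I x → FixesCuspidalClasses cs I n := by
    intro x hx hσx hconn
    set L := {z | Relation.ReflTransGen (fun a b => b ∈ I ∧ 3 ≤ M a b) x z} with hL
    have hLI : L ⊆ I := by
      intro z hz
      rcases Relation.ReflTransGen.cases_tail hz with rfl | ⟨_, _, hz⟩
      · exact hx
      · exact hz.1
    have hσL : ∀ z ∈ L, σ z ∈ L := by
      intro z hz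
      induction hz with
      | refl => exact hσx
      | tail hb hbc ih' =>
        refine Relation.ReflTransGen.tail ih' ⟨(h _ hbc.1).1, ?_⟩
        rw [h.matrix_eq (hLI hb) hbc.1]
        exact hbc.2
    have h2 : ∀ a ∈ L, ∀ b ∈ I \ L, M a b = 2 := fun a ha b hb =>
      eq_two_of_not_three_le cs (fun hab => hb.2 (hab ▸ ha)) fun hab =>
        hb.2 (Relation.ReflTransGen.tail ha ⟨hb.1, hab⟩)
    refine FixesCuspidalClasses.of_split cs hLI h2
      (ih L ⟨hLI, fun hIL => hconn fun z hz => hIL hz⟩ fun i hi => ⟨hσL i hi, (h i (hLI hi)).2⟩)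
      (ih (I \ L) ⟨Set.sdiff_subset, fun hsub => (hsub hx).2 Relation.ReflTransGen.refl⟩
        fun i hi => ⟨⟨(h i hi.1).1, fun hi' => hi.2 (h.mem_of_apply_mem hLI hσL hi.1 hi')⟩,
          (h i hi.1).2⟩)
  by_cases hbr : ∃ x ∈ I, IsBranchIn M I x
  · obtain ⟨x, hx, hb⟩ := hbr
    obtain ⟨a, ha, b, hb', c, hc, hab, hac, hbc, xa, xb, xc⟩ := hb
    by_cases hconn : ConnectedFrom M I x
    · exact IsFork.fixesCuspidalClasses ⟨hx, hconn, ha, hb', hc, hab, hac, hbc, xa, xb, xc⟩ h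
    · refine key x hx ?_ hconn
      rw [← IsBranch.unique cs ⟨a, b, c, hab, hac, hbc, xa, xb, xc⟩ (u := σ x) ?_ (h.linked cs hx)]
      refine ⟨σ a, σ b, σ c, h.injOn.ne ha hb' hab, h.injOn.ne ha hc hac, h.injOn.ne hb' hc hbc,
        ?_, ?_, ?_⟩
      · rwa [h.matrix_eq hx ha]
      · rwa [h.matrix_eq hx hb']
      · rwa [h.matrix_eq hx hc]
  by_cases hheavy : ∃ x ∈ I, ∃ y ∈ I, 4 ≤ M x y
  · obtain ⟨x, hx, y, hy, hxy⟩ := hheavy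
    by_cases hconn : ConnectedFrom M I x
    · exact h.fixesCuspidalClasses_of_heavy hx hy hxy hconn
    · refine key x hx ?_ hconn
      rcases heavy_edge_unique cs hxy (by rwa [h.matrix_eq hx hy]) (h.linked cs hx) with
        ⟨hσx, -⟩ | ⟨-, hσx⟩
      · rw [← hσx]
      · rw [← hσx]
        exact Relation.ReflTransGen.single ⟨hy, by omega⟩
  · intro w hw
    refine hw.conj_of_featureless cs (fun x hx hb => hbr ⟨x, hx, hb⟩) (fun i hi j hj => ?_)
      (h.isCuspidal_conj hw)
    by_contra hij
    exact hheavy ⟨i, hi, j, hj, by omega⟩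

theorem IsCuspidal.conj_of_isConj [Finite W] (cs : CoxeterSystem M W) {I : Set B} {x y : W}
    (hx : IsCuspidal cs I x) (hy : IsCuspidal cs I y) (hxy : IsConj x y) :
    ∃ u ∈ parabolic cs I, u * x * u⁻¹ = y := by
  obtain ⟨g, rfl⟩ := isConj_iff.1 hxy
  obtain ⟨u, hu, v, hv, n, rfl, hn, -⟩ := hx.exists_conj hy
  obtain ⟨σ, hσ⟩ := exists_permutesBy cs hn
  obtain ⟨t, ht, htx⟩ := hσ.fixesCuspidalClasses cs _ (hx.conj hu)
  refine ⟨v * t * u, mul_mem (mul_mem hv ht) hu, ?_⟩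
  calc v * t * u * x * (v * t * u)⁻¹ = v * (t * (u * x * u⁻¹) * t⁻¹) * v⁻¹ := by group
    _ = v * n * u * x * (v * n * u)⁻¹ := by rw [htx]; group

theorem IsElementOf.isCuspidal {cs : CoxeterSystem M W} {I : Set B} {w x : W}
    (h : IsElementOf cs I w) (hx : x ∈ parabolic cs I) (hwx : IsConj w x) : IsCuspidal cs I x := by
  refine ⟨hx, fun K hK u hu hmem => ?_⟩
  refine (Set.eq_empty_iff_forall_notMem.1 (h.2 K hK)) (u * x * u⁻¹) ⟨⟨?_, ?_⟩, hmem⟩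
  · exact hwx.trans (isConj_iff.2 ⟨u, rfl⟩)
  · exact mul_mem (mul_mem hu hx) (inv_mem hu)

theorem IsElementOf.exists_mem {cs : CoxeterSystem M W} {I : Set B} {w : W}
    (h : IsElementOf cs I w) : ∃ x ∈ parabolic cs I, IsConj w x := by
  obtain ⟨⟨v, hv, heq⟩, -⟩ := h
  have hmem : v ∈ {x : W | ∃ u ∈ parabolic cs I, u * v * u⁻¹ = x} := ⟨1, one_mem _, by simp⟩
  rw [← heq] at hmem
  exact ⟨v, hv, hmem.1⟩

theorem IsElementOf.congr {cs : CoxeterSystem M W} {I : Set B} {w w' : W}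
    (h : IsElementOf cs I w) (hw : IsConj w w') : IsElementOf cs I w' := by
  have : {x : W | IsConj w' x} = {x : W | IsConj w x} :=
    Set.ext fun x => ⟨fun hx => hw.trans hx, fun hx => hw.symm.trans hx⟩
  rw [IsElementOf, this]
  exact h

theorem IsElementOf.conjSubsets {cs : CoxeterSystem M W} {I J : Set B} {w : W}
    (hI : IsElementOf cs I w) (hJ : IsElementOf cs J w) : ConjSubsets cs I J := by
  obtain ⟨x, hx, hwx⟩ := hI.exists_mem
  obtain ⟨y, hy, hwy⟩ := hJ.exists_mem
  obtain ⟨g, rfl⟩ := isConj_iff.1 (hwx.symm.trans hwy)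
  obtain ⟨u, -, v, -, n, -, hn, hn'⟩ := (hI.isCuspidal hx hwx).exists_conj (hJ.isCuspidal hy hwy)
  refine ⟨n, Set.Subset.antisymm ?_ ?_⟩
  · rintro _ ⟨_, ⟨i, hi, rfl⟩, rfl⟩
    obtain ⟨j, hj, hij⟩ := hn i hi
    exact ⟨j, hj, hij.symm⟩
  · rintro _ ⟨j, hj, rfl⟩
    obtain ⟨i, hi, hij⟩ := hn' j hj
    refine ⟨_, ⟨i, hi, rfl⟩, ?_⟩
    change n * cs.simple i * n⁻¹ = _
    rw [← hij]
    group

theorem exists_isElementOf [Finite W] (cs : CoxeterSystem M W) (w : W) :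
    ∃ I, IsElementOf cs I w := by
  have hB := Finite.of_injective _ (simple_injective cs)
  obtain ⟨I, ⟨v, hwv, hv⟩, hmin⟩ := WellFounded.has_min (wellFounded_lt (α := Set B))
    {I | ∃ x, IsConj w x ∧ x ∈ parabolic cs I}
    ⟨Set.univ, w, IsConj.refl w, by rw [parabolic_univ]; trivial⟩
  have hcusp : ∀ x ∈ parabolic cs I, IsConj w x → IsCuspidal cs I x := fun x hx hwx =>
    ⟨hx, fun K hK u _ hmem =>
      hmin K ⟨_, hwx.trans (isConj_iff.2 ⟨u, rfl⟩), hmem⟩ hK⟩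
  refine ⟨I, ⟨v, hv, Set.Subset.antisymm ?_ ?_⟩, fun K hK => ?_⟩
  · rintro x ⟨hwx, hx⟩
    exact (hcusp v hv hwv).conj_of_isConj cs (hcusp x hx hwx) (hwv.symm.trans hwx)
  · rintro _ ⟨u, hu, rfl⟩
    exact ⟨hwv.trans (isConj_iff.2 ⟨u, rfl⟩), mul_mem (mul_mem hu hv) (inv_mem hu)⟩
  · refine Set.eq_empty_iff_forall_notMem.2 ?_
    rintro x ⟨⟨hwx, -⟩, hx⟩
    exact hmin K ⟨x, hwx, hx⟩ hK

end Main

/-- The λ-set `C(λ)` is the union of the conjugacy classes it contains,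
and `W` is the disjoint union of its λ-sets. -/
theorem statement1 [Fintype W] (cs : CoxeterSystem M W) (lam : CoxeterClass cs) :
    (lambdaSetQ cs lam =
      ⋃₀ {C : Set W | (∃ w : W, C = {x : W | IsConj w x}) ∧ C ⊆ lambdaSetQ cs lam}) ∧
    (∀ w : W, ∃! mu : CoxeterClass cs, w ∈ lambdaSetQ cs mu) := by
  refine ⟨Set.Subset.antisymm ?_ (Set.sUnion_subset fun C hC => hC.2), fun w => ?_⟩
  · rintro w ⟨I, hI, hw⟩
    exact ⟨{x | IsConj w x}, ⟨⟨w, rfl⟩, fun x hx => ⟨I, hI, hw.congr hx⟩⟩, IsConj.refl w⟩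
  · obtain ⟨I, hI⟩ := exists_isElementOf cs w
    refine ⟨Quotient.mk (coxSetoid cs) I, ⟨I, rfl, hI⟩, ?_⟩
    rintro _ ⟨J, rfl, hJ⟩
    exact Quotient.sound (hJ.conjSubsets hI)
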